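/- Let p ∈ (1,∞), s ∈ (0,1), and let v ∈ W^{s,p}(ℝⁿ) be a weak solution of the homogeneous Dirichlet problem −L_Φ v = 0 in Ω, v = g on ℝⁿ∖Ω, with B_{2r}(x₀) ⊂ Ω. Then there exist constants α ∈ (0, sp/q_*) and c, both depending only on n, s, p, Λ, such that A(v; x₀, ρ) ≤ c (ρ/r)^α E(v; x₀, r) for all 0 < ρ ≤ r. -/

import Mathlib

noncomputable section

open MeasureTheory Metric Set Filter Topology
open scoped ENNReal NNReal

/-- Euclidean space `ℝⁿ`. -/
abbrev Rn (n : ℕ) : Type := EuclideanSpace ℝ (Fin n)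

/-- `q_* = max {1, p-1}`. -/
def qStar (p : ℝ) : ℝ := max 1 (p - 1)

/-- `q̄ = min {n(p-1)/(n-s), p}`. -/
def qBar (n : ℕ) (s p : ℝ) : ℝ := min ((n : ℝ) * (p - 1) / ((n : ℝ) - s)) p

/-- Gagliardo seminorm raised to the power `p`, as an `ℝ≥0∞`-valued double integral. -/
def gagliardo (n : ℕ) (s p : ℝ) (O : Set (Rn n)) (v : Rn n → ℝ) : ℝ≥0∞ :=
  ∫⁻ x in O, ∫⁻ y in O, ENNReal.ofReal (|v x - v y| ^ p / ‖x - y‖ ^ ((n : ℝ) + s * p))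

/-- `v ∈ W^{s,p}(O)`. -/
def memWsp (n : ℕ) (s p : ℝ) (O : Set (Rn n)) (v : Rn n → ℝ) : Prop :=
  AEMeasurable v (volume.restrict O) ∧
    (∫⁻ x in O, ENNReal.ofReal (|v x| ^ p)) < ⊤ ∧ gagliardo n s p O v < ⊤

/-- `Tail(v; x₀, r)`. -/
def tailFn (n : ℕ) (s p : ℝ) (v : Rn n → ℝ) (x₀ : Rn n) (r : ℝ) : ℝ≥0∞ :=
  (ENNReal.ofReal (r ^ (s * p)) *
      ∫⁻ x in (ball x₀ r)ᶜ,
        ENNReal.ofReal (|v x| ^ (p - 1) / ‖x - x₀‖ ^ ((n : ℝ) + s * p))) ^ (1 / (p - 1))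

/-- `v ∈ L^{p-1}_{sp}(ℝⁿ)`. -/
def memTailSpace (n : ℕ) (s p : ℝ) (v : Rn n → ℝ) : Prop :=
  AEMeasurable v (volume : Measure (Rn n)) ∧
    (∀ R : ℝ, (∫⁻ x in ball (0 : Rn n) R, ENNReal.ofReal (|v x| ^ (p - 1))) < ⊤) ∧
    ∀ z : Rn n, ∀ r : ℝ, 0 < r → tailFn n s p v z r < ⊤

/-- `φ ∈ C_0^∞(O)`. -/
def IsTestFun (n : ℕ) (O : Set (Rn n)) (φ : Rn n → ℝ) : Prop :=
  ContDiff ℝ (⊤ : ℕ∞) φ ∧ HasCompactSupport φ ∧ tsupport φ ⊆ O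

/-- The nonlocal form `⟨-L_Φ u, φ⟩`. -/
def nonlocalForm (n : ℕ) (Φ : ℝ → ℝ) (K : Rn n → Rn n → ℝ) (u φ : Rn n → ℝ) : ℝ :=
  ∫ x : Rn n, ∫ y : Rn n, Φ (u x - u y) * (φ x - φ y) * K x y

/-- Ellipticity/coercivity bounds on the kernel `K`. -/
def KernelBounds (n : ℕ) (Λ s p : ℝ) (K : Rn n → Rn n → ℝ) : Prop :=
  Measurable (Function.uncurry K) ∧
    ∀ x y : Rn n, x ≠ y →
      1 / (Λ * ‖x - y‖ ^ ((n : ℝ) + s * p)) ≤ K x y ∧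
        K x y ≤ Λ / ‖x - y‖ ^ ((n : ℝ) + s * p)

/-- Structure conditions on `Φ`. -/
def PhiBounds (Λ p : ℝ) (Φ : ℝ → ℝ) : Prop :=
  Continuous Φ ∧ Φ 0 = 0 ∧
    ∀ t : ℝ, |t| ^ p / Λ ≤ Φ t * t ∧ Φ t * t ≤ Λ * |t| ^ p

/-- `∫ φ dμ` for a signed measure `μ`. -/
def sintegral (n : ℕ) (μ : MeasureTheory.SignedMeasure (Rn n)) (φ : Rn n → ℝ) : ℝ :=
  (∫ x, φ x ∂μ.toJordanDecomposition.posPart) -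
    ∫ x, φ x ∂μ.toJordanDecomposition.negPart

/-- Weak (energy) solution of `-L_Φ u = f` in `Ω`, `u = g` on `ℝⁿ ∖ Ω`. -/
def WeakSol (n : ℕ) (Φ : ℝ → ℝ) (K : Rn n → Rn n → ℝ) (s p : ℝ)
    (Ω : Set (Rn n)) (f g u : Rn n → ℝ) : Prop :=
  memWsp n s p univ u ∧ (∀ᵐ x : Rn n, x ∉ Ω → u x = g x) ∧
    ∀ φ : Rn n → ℝ, IsTestFun n Ω φ → nonlocalForm n Φ K u φ = ∫ x : Rn n, φ x * f x

/-- Weak subsolution of the homogeneous equation `-L_Φ w = 0` in `Ω`. -/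
def WeakSubSol (n : ℕ) (Φ : ℝ → ℝ) (K : Rn n → Rn n → ℝ) (s p : ℝ)
    (Ω : Set (Rn n)) (w : Rn n → ℝ) : Prop :=
  memWsp n s p univ w ∧
    ∀ φ : Rn n → ℝ, IsTestFun n Ω φ → (∀ x, 0 ≤ φ x) → nonlocalForm n Φ K w φ ≤ 0

/-- The approximation properties required of a SOLA. -/
def SOLAApprox (n : ℕ) (Φ : ℝ → ℝ) (K : Rn n → Rn n → ℝ) (s p : ℝ)
    (Ω : Set (Rn n)) (μ : MeasureTheory.SignedMeasure (Rn n)) (g u : Rn n → ℝ)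
    (uj μj gj : ℕ → Rn n → ℝ) : Prop :=
  (∀ j, ContDiff ℝ (⊤ : ℕ∞) (μj j) ∧ HasCompactSupport (μj j)) ∧
  (∀ j, ContDiff ℝ (⊤ : ℕ∞) (gj j) ∧ HasCompactSupport (gj j)) ∧
  (∀ j, WeakSol n Φ K s p Ω (μj j) (gj j) (uj j)) ∧
  (∀ᵐ x : Rn n, Tendsto (fun j => uj j x) atTop (𝓝 (u x))) ∧
  (∀ q : ℝ, qStar p ≤ q → q < qBar n s p → ∀ z : Rn n, ∀ r : ℝ, 0 < r →
    Tendsto (fun j => ∫⁻ x in ball z r, ENNReal.ofReal (|uj j x - u x| ^ q)) atTop (𝓝 0)) ∧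
  (∀ φ : Rn n → ℝ, Continuous φ → HasCompactSupport φ → tsupport φ ⊆ Ω →
    Tendsto (fun j => ∫ x : Rn n, φ x * μj j x) atTop (𝓝 (sintegral n μ φ))) ∧
  (∀ z : Rn n, ∀ r : ℝ, 0 < r →
    Filter.limsup (fun j => ∫⁻ x in ball z r, ENNReal.ofReal |μj j x|) atTop
      ≤ μ.totalVariation (closedBall z r)) ∧
  (∀ z : Rn n, ∀ r : ℝ, 0 < r →
    Tendsto (fun j =>
        (∫⁻ x in ball z r, ENNReal.ofReal (|gj j x - g x| ^ p)) +
          gagliardo n s p (ball z r) (fun x => gj j x - g x)) atTop (𝓝 0) ∧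
      Tendsto (fun j => tailFn n s p (fun x => gj j x - g x) z r) atTop (𝓝 0))

/-- SOLA of the Dirichlet problem `-L_Φ u = μ` in `Ω`, `u = g` on `ℝⁿ ∖ Ω`. -/
def IsSOLA (n : ℕ) (Φ : ℝ → ℝ) (K : Rn n → Rn n → ℝ) (s p : ℝ)
    (Ω : Set (Rn n)) (μ : MeasureTheory.SignedMeasure (Rn n)) (g u : Rn n → ℝ) : Prop :=
  (∀ h q : ℝ, 0 < h → h < s → qStar p ≤ q → q < qBar n s p → memWsp n h q Ω u) ∧
  (∀ φ : Rn n → ℝ, IsTestFun n Ω φ → nonlocalForm n Φ K u φ = sintegral n μ φ) ∧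
  (∀ᵐ x : Rn n, x ∉ Ω → u x = g x) ∧
  ∃ uj μj gj : ℕ → Rn n → ℝ, SOLAApprox n Φ K s p Ω μ g u uj μj gj

/-- Truncated Wolff potential `W^ν_{s,p}(x₀, r)`. -/
def wolff (n : ℕ) (s p : ℝ) (ν : Measure (Rn n)) (x₀ : Rn n) (r : ℝ) : ℝ≥0∞ :=
  ∫⁻ ρ in Ioc (0 : ℝ) r,
    (ν (ball x₀ ρ) / ENNReal.ofReal (ρ ^ ((n : ℝ) - s * p))) ^ (1 / (p - 1)) /
      ENNReal.ofReal ρ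

/-- Integral average of `u` over `B_r(x₀)`. -/
def ballAvg (n : ℕ) (u : Rn n → ℝ) (x₀ : Rn n) (r : ℝ) : ℝ :=
  ⨍ x in ball x₀ r, u x

/-- Local excess `A(f; x₀, r)`. -/
def locExcess (n : ℕ) (p : ℝ) (f : Rn n → ℝ) (x₀ : Rn n) (r : ℝ) : ℝ≥0∞ :=
  ((volume (ball x₀ r))⁻¹ *
      ∫⁻ x in ball x₀ r, ENNReal.ofReal (|f x - ballAvg n f x₀ r| ^ qStar p)) ^ (1 / qStar p)

/-- Global excess `E(f; x₀, r)`. -/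
def excess (n : ℕ) (s p : ℝ) (f : Rn n → ℝ) (x₀ : Rn n) (r : ℝ) : ℝ≥0∞ :=
  locExcess n p f x₀ r + tailFn n s p (fun x => f x - ballAvg n f x₀ r) x₀ r

/-- `g ∈ W^{s,p}_loc(ℝⁿ) ∩ L^{p-1}_{sp}(ℝⁿ)`. -/
def BoundaryDatum (n : ℕ) (s p : ℝ) (g : Rn n → ℝ) : Prop :=
  (∀ z : Rn n, ∀ r : ℝ, 0 < r → memWsp n s p (ball z r) g) ∧ memTailSpace n s p g

/-- Symmetric measurable kernel with ellipticity bounds. -/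
def SymKernel (n : ℕ) (Λ s p : ℝ) (Kt : Rn n → Rn n → ℝ) : Prop :=
  KernelBounds n Λ s p Kt ∧ ∀ x y : Rn n, Kt x y = Kt y x

/-- Weak solution of the kernel-`Kt` fractional `p`-Laplace equation with datum `f` in `O`. -/
def WeakSolP (n : ℕ) (Kt : Rn n → Rn n → ℝ) (s p : ℝ) (O : Set (Rn n))
    (f u : Rn n → ℝ) : Prop :=
  memWsp n s p univ u ∧
    ∀ φ : Rn n → ℝ, IsTestFun n O φ →
      (∫ x : Rn n, ∫ y : Rn n,
          |u x - u y| ^ (p - 2) * (u x - u y) * (φ x - φ y) * Kt x y) =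
        ∫ x : Rn n, φ x * f x

/-- Integration in dilated and translated coordinates. -/
lemma lintegral_eq_dilate {n : ℕ} {F : Rn n → ℝ≥0∞} (hF : Measurable F) (z : Rn n) {R : ℝ}
    (hR : 0 < R) :
    ∫⁻ y, F y = ENNReal.ofReal (R ^ (n : ℝ)) * ∫⁻ h, F (z + R • h) := by
  have h1 : ∫⁻ h, F (z + R • h) = ENNReal.ofReal (R ^ (n : ℝ))⁻¹ * ∫⁻ y, F y := by
    have h2 : ∫⁻ h, F (z + R • h) = ∫⁻ y, F (z + y) ∂(Measure.map (R • ·) volume) := by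
      exact (lintegral_map (f := fun y => F (z + y)) (hF.comp (measurable_const_add z))
        (measurable_const_smul R)).symm
    rw [h2, Measure.map_addHaar_smul _ hR.ne', lintegral_smul_measure, lintegral_add_left_eq_self]
    simp [abs_of_pos hR, ENNReal.ofReal_inv_of_pos (pow_pos hR n)]
  rw [h1, ← mul_assoc, ← ENNReal.ofReal_mul (by positivity), mul_inv_cancel₀ (by positivity)]
  simp

lemma volume_ball_eq {n : ℕ} (hn : 2 ≤ n) (z : Rn n) {R : ℝ} (hR : 0 < R) :
    volume (ball z R) = ENNReal.ofReal (R ^ (n : ℝ) * (volume (ball (0 : Rn n) 1)).toReal) := by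
  have : Nonempty (Fin n) := ⟨⟨0, by omega⟩⟩
  rw [Measure.addHaar_ball_of_pos _ _ hR, ENNReal.ofReal_mul (by positivity),
    ENNReal.ofReal_toReal measure_ball_lt_top.ne]
  simp

lemma unit_ball_pos (n : ℕ) : 0 < (volume (ball (0 : Rn n) 1)).toReal :=
  ENNReal.toReal_pos (measure_ball_pos _ _ one_pos).ne' measure_ball_lt_top.ne

lemma lintegral_norm_rpow_compl_ball_scale {n : ℕ} (a : ℝ) (z : Rn n) {R : ℝ} (hR : 0 < R) :
    ∫⁻ y in (ball z R)ᶜ, ENNReal.ofReal (‖y - z‖ ^ a) =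
      ENNReal.ofReal (R ^ ((n : ℝ) + a)) *
        ∫⁻ h in (ball (0 : Rn n) 1)ᶜ, ENNReal.ofReal (‖h‖ ^ a) := by
  rw [← lintegral_indicator measurableSet_ball.compl,
    ← lintegral_indicator measurableSet_ball.compl,
    lintegral_eq_dilate (Measurable.indicator (by fun_prop) measurableSet_ball.compl) z hR,
    Real.rpow_add hR, ENNReal.ofReal_mul (by positivity), mul_assoc]
  congr 1
  rw [← lintegral_const_mul']
  · congr 1
    ext h
    by_cases hh : ‖h‖ < 1
    · have : R * ‖h‖ < R := by nlinarith
      simp [indicator, norm_smul, abs_of_pos hR, hh, this]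
    · have : ¬ R * ‖h‖ < R := by nlinarith
      simp [indicator, norm_smul, abs_of_pos hR, hh, this]
      rw [← ENNReal.ofReal_mul (by positivity), Real.mul_rpow hR.le (by positivity)]
  · simp

lemma lintegral_norm_rpow_ball_scale {n : ℕ} (a : ℝ) (z : Rn n) {R : ℝ} (hR : 0 < R) :
    ∫⁻ y in ball z R, ENNReal.ofReal (‖y - z‖ ^ a) =
      ENNReal.ofReal (R ^ ((n : ℝ) + a)) *
        ∫⁻ h in ball (0 : Rn n) 1, ENNReal.ofReal (‖h‖ ^ a) := by
  rw [← lintegral_indicator measurableSet_ball,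
    ← lintegral_indicator measurableSet_ball,
    lintegral_eq_dilate (Measurable.indicator (by fun_prop) measurableSet_ball) z hR,
    Real.rpow_add hR, ENNReal.ofReal_mul (by positivity), mul_assoc]
  congr 1
  rw [← lintegral_const_mul']
  · congr 1
    ext h
    by_cases hh : ‖h‖ < 1
    · have : R * ‖h‖ < R := by nlinarith
      simp [indicator, norm_smul, abs_of_pos hR, hh, this]
      rw [← ENNReal.ofReal_mul (by positivity), Real.mul_rpow hR.le (by positivity)]
    · have : ¬ R * ‖h‖ < R := by nlinarith
      simp [indicator, norm_smul, abs_of_pos hR, hh, this]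
  · simp

lemma lintegral_norm_rpow_compl_unit_ball_lt_top {n : ℕ} {a : ℝ} (ha : (n : ℝ) < a) :
    ∫⁻ h in (ball (0 : Rn n) 1)ᶜ, ENNReal.ofReal (‖h‖ ^ (-a)) < ⊤ := by
  have ha0 : 0 < a := lt_of_le_of_lt (Nat.cast_nonneg n) ha
  have h1 := finite_integral_one_add_norm (E := Rn n) (μ := volume) (r := a) (by simpa using ha)
  calc ∫⁻ h in (ball (0 : Rn n) 1)ᶜ, ENNReal.ofReal (‖h‖ ^ (-a))
      ≤ ∫⁻ h in (ball (0 : Rn n) 1)ᶜ, ENNReal.ofReal (2 ^ a) *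
          ENNReal.ofReal ((1 + ‖h‖) ^ (-a)) := by
        refine setLIntegral_mono' measurableSet_ball.compl fun h hh => ?_
        have hh' : 1 ≤ ‖h‖ := by simpa using hh
        rw [← ENNReal.ofReal_mul (by positivity)]
        refine ENNReal.ofReal_le_ofReal ?_
        rw [Real.rpow_neg (by positivity), Real.rpow_neg (by positivity), ← div_eq_mul_inv,
          le_div_iff₀ (by positivity), inv_mul_le_iff₀ (by positivity),
          ← Real.mul_rpow (by positivity) (by positivity)]
        exact Real.rpow_le_rpow (by positivity) (by linarith) ha0.le
    _ ≤ ∫⁻ h, ENNReal.ofReal (2 ^ a) * ENNReal.ofReal ((1 + ‖h‖) ^ (-a)) :=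
        setLIntegral_le_lintegral _ _
    _ < ⊤ := by
        rw [lintegral_const_mul' _ _ (by simp)]
        exact ENNReal.mul_lt_top (by simp) h1

lemma lintegral_norm_rpow_unit_ball_lt_top {n : ℕ} (hn : 2 ≤ n) {a : ℝ} (ha : 0 < (n : ℝ) + a) :
    ∫⁻ h in ball (0 : Rn n) 1, ENNReal.ofReal (‖h‖ ^ a) < ⊤ := by
  have : Nonempty (Fin n) := ⟨⟨0, by omega⟩⟩
  have h1 : IntegrableOn (fun h : Rn n => ‖h‖ ^ a) (ball 0 1) := by
    rw [integrableOn_fun_norm_addHaar volume (f := fun t => t ^ a)]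
    have h2 : IntegrableOn (fun y : ℝ => y ^ ((n : ℝ) - 1 + a)) (Ioo 0 1) :=
      (intervalIntegral.integrableOn_Ioo_rpow_iff one_pos).2 (by linarith)
    refine h2.congr_fun (fun y hy => ?_) measurableSet_Ioo
    simp only [finrank_euclideanSpace, Fintype.card_fin, smul_eq_mul]
    rw [Real.rpow_add hy.1, ← Real.rpow_natCast, Nat.cast_sub (by omega)]
    simp
  have h3 := h1.2
  rw [hasFiniteIntegral_iff_ofReal (Eventually.of_forall fun h => by positivity)] at h3
  exact h3

/-- Mass of the kernel outside of balls. -/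
lemma exists_tail_kernel_bound (n : ℕ) {s p : ℝ} (hs : 0 < s) (hp : 1 < p) :
    ∃ C : ℝ, 1 ≤ C ∧ ∀ (z : Rn n) (R : ℝ), 0 < R →
      ∫⁻ y in (ball z R)ᶜ, ENNReal.ofReal (‖y - z‖ ^ (-((n : ℝ) + s * p))) ≤
        ENNReal.ofReal (C * R ^ (-(s * p))) := by
  have h := lintegral_norm_rpow_compl_unit_ball_lt_top (n := n) (a := n + s * p)
    (by have := mul_pos hs (by linarith : (0 : ℝ) < p); linarith)
  refine ⟨1 + ENNReal.toReal (∫⁻ h in (ball (0 : Rn n) 1)ᶜ,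
    ENNReal.ofReal (‖h‖ ^ (-((n : ℝ) + s * p)))), by simp, fun z R hR => ?_⟩
  rw [lintegral_norm_rpow_compl_ball_scale _ z hR, mul_comm,
    ENNReal.ofReal_mul (by positivity)]
  have e : (n : ℝ) + -(n + s * p) = -(s * p) := by ring
  rw [e]
  gcongr
  rw [← ENNReal.ofReal_toReal h.ne]
  refine ENNReal.ofReal_le_ofReal ?_
  rw [ENNReal.toReal_ofReal (by positivity)]
  linarith

/-- Local integrability of the kernel against the `p`-th power of the distance. -/
lemma exists_ball_kernel_bound {n : ℕ} (hn : 2 ≤ n) {s p : ℝ} (hs1 : s < 1) (hp : 1 < p) :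
    ∃ C : ℝ, 1 ≤ C ∧ ∀ (z : Rn n) (R : ℝ), 0 < R →
      ∫⁻ y in ball z R, ENNReal.ofReal (‖y - z‖ ^ (p - ((n : ℝ) + s * p))) ≤
        ENNReal.ofReal (C * R ^ (p - s * p)) := by
  have h := lintegral_norm_rpow_unit_ball_lt_top hn (a := p - (n + s * p))
    (by nlinarith)
  refine ⟨1 + ENNReal.toReal (∫⁻ h in ball (0 : Rn n) 1,
    ENNReal.ofReal (‖h‖ ^ (p - ((n : ℝ) + s * p)))), by simp, fun z R hR => ?_⟩
  rw [lintegral_norm_rpow_ball_scale _ z hR, mul_comm,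
    ENNReal.ofReal_mul (by positivity)]
  have e : (n : ℝ) + (p - (n + s * p)) = p - s * p := by ring
  rw [e]
  gcongr
  rw [← ENNReal.ofReal_toReal h.ne]
  refine ENNReal.ofReal_le_ofReal ?_
  rw [ENNReal.toReal_ofReal (by positivity)]
  linarith

/-- Pairings with diagonal translations of an `L^p` function depend continuously on the shift. -/
lemma continuous_integral_mul_translate {n : ℕ} {p q : ℝ} (hpq : p.HolderConjugate q)
    {G H : Rn n × Rn n → ℝ} (hG : MemLp G (ENNReal.ofReal q) volume)
    (hH : MemLp H (ENNReal.ofReal p) volume) :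
    Continuous fun h : Rn n => ∫ z : Rn n × Rn n, G z * H (z.1 - h, z.2 - h) := by
  have hp1 : Fact (1 ≤ ENNReal.ofReal p) := ⟨by simpa using hpq.lt.le⟩
  have hq1 : Fact (1 ≤ ENNReal.ofReal q) := ⟨by simpa using hpq.symm.lt.le⟩
  have hc : ENNReal.HolderConjugate (ENNReal.ofReal q) (ENNReal.ofReal p) :=
    hpq.symm.ennrealOfReal
  let g : C(Rn n, C(Rn n × Rn n, Rn n × Rn n)) :=
    (ContinuousMap.mk (fun a : Rn n × (Rn n × Rn n) => (a.2.1 - a.1, a.2.2 - a.1))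
      (by fun_prop)).curry
  have hg : ∀ h, MeasurePreserving (g h) (volume : Measure (Rn n × Rn n)) volume := fun h =>
    (measurePreserving_sub_right volume h).prod (measurePreserving_sub_right volume h)
  have h1 : Continuous fun h => Lp.compMeasurePreserving (g h) (hg h) (hH.toLp H) :=
    Continuous.compMeasurePreservingLp continuous_const g.continuous hg (by simp)
  have h2 := (((ContinuousLinearMap.mul ℝ ℝ).lpPairing volume (ENNReal.ofReal q)
    (ENNReal.ofReal p)) (hG.toLp G)).continuous.comp h1
  refine h2.congr fun h => ?_
  rw [Function.comp_apply, ContinuousLinearMap.lpPairing_eq_integral,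
    Lp.toLp_compMeasurePreserving]
  refine integral_congr_ae ?_
  filter_upwards [hG.coeFn_toLp, (hH.comp_measurePreserving (hg h)).coeFn_toLp] with z h1 h2
  rw [h1, h2]
  rfl

section form

variable {n : ℕ} {s p Λ : ℝ} {Φ : ℝ → ℝ} {K : Rn n → Rn n → ℝ} {u φ : Rn n → ℝ}

lemma PhiBounds.abs_le (hΦ : PhiBounds Λ p Φ) (hΛ : 1 ≤ Λ) (t : ℝ) :
    |Φ t| ≤ Λ * |t| ^ (p - 1) := by
  rcases eq_or_ne t 0 with rfl | ht
  · rw [hΦ.2.1]; simp; positivity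
  · have h := hΦ.2.2 t
    have h0 : 0 < |t| := abs_pos.2 ht
    have h1 : |Φ t| * |t| ≤ Λ * |t| ^ p := by
      rw [← abs_mul, abs_of_nonneg (le_trans (by positivity) h.1)]
      exact h.2
    rw [Real.rpow_sub_one h0.ne', ← mul_div_assoc, le_div_iff₀ h0]
    exact h1

lemma KernelBounds.le_and_le (hK : KernelBounds n Λ s p K) {x y : Rn n}
    (hxy : x ≠ y) :
    Λ⁻¹ * ‖x - y‖ ^ (-((n : ℝ) + s * p)) ≤ K x y ∧
      K x y ≤ Λ * ‖x - y‖ ^ (-((n : ℝ) + s * p)) := by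
  have h := hK.2 x y hxy
  rw [Real.rpow_neg (norm_nonneg _)]
  simpa [div_eq_mul_inv, mul_inv, mul_comm] using h

lemma abs_flux_le (hK : KernelBounds n Λ s p K) (hΦ : PhiBounds Λ p Φ) (hΛ : 1 ≤ Λ)
    (u : Rn n → ℝ) (x y : Rn n) :
    |Φ (u x - u y) * K x y| ≤
      Λ ^ 2 * |u x - u y| ^ (p - 1) * ‖x - y‖ ^ (-((n : ℝ) + s * p)) := by
  rcases eq_or_ne x y with rfl | hxy
  · rw [sub_self, hΦ.2.1]; simp; positivity
  · have h1 := hΦ.abs_le hΛ (u x - u y)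
    have h2 := hK.le_and_le hxy
    have h3 : |K x y| ≤ Λ * ‖x - y‖ ^ (-((n : ℝ) + s * p)) := by
      rw [abs_of_nonneg (le_trans (by positivity) h2.1)]
      exact h2.2
    rw [abs_mul]
    calc _ ≤ (Λ * |u x - u y| ^ (p - 1)) * (Λ * ‖x - y‖ ^ (-((n : ℝ) + s * p))) := by gcongr
      _ = _ := by ring

lemma measurable_flux (hK : KernelBounds n Λ s p K) (hΦ : PhiBounds Λ p Φ) (hu : Measurable u) :
    Measurable fun z : Rn n × Rn n => Φ (u z.1 - u z.2) * K z.1 z.2 :=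
  (hΦ.1.measurable.comp (by fun_prop)).mul hK.1

lemma gagliardo_univ_eq (hu : Measurable u) :
    gagliardo n s p univ u = ∫⁻ z : Rn n × Rn n,
      ENNReal.ofReal (|u z.1 - u z.2| ^ p * ‖z.1 - z.2‖ ^ (-((n : ℝ) + s * p))) := by
  rw [Measure.volume_eq_prod, lintegral_prod _ (by fun_prop)]
  simp only [gagliardo, Measure.restrict_univ]
  simp only [Real.rpow_neg (norm_nonneg _), div_eq_mul_inv]

lemma rpow_sub_one_mul_le {a b p : ℝ} (ha : 0 ≤ a) (hb : 0 ≤ b) (hp : 1 < p) :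
    a ^ (p - 1) * b ≤ a ^ p + b ^ p := by
  rcases le_total a b with h | h
  · calc a ^ (p - 1) * b ≤ b ^ (p - 1) * b := by gcongr
      _ = b ^ p := by
        rw [← Real.rpow_add_one' hb (by linarith)]; ring_nf
      _ ≤ _ := le_add_of_nonneg_left (by positivity)
  · calc a ^ (p - 1) * b ≤ a ^ (p - 1) * a := by gcongr
      _ = a ^ p := by
        rw [← Real.rpow_add_one' ha (by linarith)]; ring_nf
      _ ≤ _ := le_add_of_nonneg_right (by positivity)

lemma abs_form_integrand_le (hK : KernelBounds n Λ s p K) (hΦ : PhiBounds Λ p Φ) (hΛ : 1 ≤ Λ)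
    (hp : 1 < p) (u : Rn n → ℝ) (x y : Rn n) (a : ℝ) :
    |Φ (u x - u y) * K x y * a| ≤
      Λ ^ 2 * (|u x - u y| ^ p * ‖x - y‖ ^ (-((n : ℝ) + s * p)) +
        |a| ^ p * ‖x - y‖ ^ (-((n : ℝ) + s * p))) := by
  rw [abs_mul]
  calc _ ≤ (Λ ^ 2 * |u x - u y| ^ (p - 1) * ‖x - y‖ ^ (-((n : ℝ) + s * p))) * |a| := by
        gcongr; exact abs_flux_le hK hΦ hΛ u x y
    _ = Λ ^ 2 * (|u x - u y| ^ (p - 1) * |a|) * ‖x - y‖ ^ (-((n : ℝ) + s * p)) := by ring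
    _ ≤ Λ ^ 2 * (|u x - u y| ^ p + |a| ^ p) * ‖x - y‖ ^ (-((n : ℝ) + s * p)) := by
        gcongr; exact rpow_sub_one_mul_le (abs_nonneg _) (abs_nonneg _) hp
    _ = _ := by ring

lemma integrable_form (hK : KernelBounds n Λ s p K) (hΦ : PhiBounds Λ p Φ) (hΛ : 1 ≤ Λ)
    (hp : 1 < p) (hu : Measurable u) (hφ : Measurable φ)
    (hgu : gagliardo n s p univ u < ⊤) (hgφ : gagliardo n s p univ φ < ⊤) :
    Integrable fun z : Rn n × Rn n => Φ (u z.1 - u z.2) * K z.1 z.2 * (φ z.1 - φ z.2) := by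
  refine ⟨((measurable_flux hK hΦ hu).mul (by fun_prop)).aestronglyMeasurable, ?_⟩
  rw [gagliardo_univ_eq hu] at hgu
  rw [gagliardo_univ_eq hφ] at hgφ
  rw [hasFiniteIntegral_iff_norm]
  calc _ ≤ ∫⁻ z : Rn n × Rn n, ENNReal.ofReal (Λ ^ 2) * (
      ENNReal.ofReal (|u z.1 - u z.2| ^ p * ‖z.1 - z.2‖ ^ (-((n : ℝ) + s * p))) +
      ENNReal.ofReal (|φ z.1 - φ z.2| ^ p * ‖z.1 - z.2‖ ^ (-((n : ℝ) + s * p)))) := by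
        refine lintegral_mono fun z => ?_
        rw [← ENNReal.ofReal_add (by positivity) (by positivity),
          ← ENNReal.ofReal_mul (by positivity)]
        exact ENNReal.ofReal_le_ofReal (abs_form_integrand_le hK hΦ hΛ hp u _ _ _)
    _ < ⊤ := by
        rw [lintegral_const_mul' _ _ (by simp), lintegral_add_left (by fun_prop)]
        exact ENNReal.mul_lt_top (by simp) (ENNReal.add_lt_top.2 ⟨hgu, hgφ⟩)

lemma rpow_split {x : ℝ} (hx : 0 ≤ x) {a b c : ℝ} (ha : a + b ≠ 0) (h : a + b = c) :
    x ^ c = x ^ a * x ^ b := by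
  rw [← h, Real.rpow_add' hx ha]

lemma continuous_translated_form (hK : KernelBounds n Λ s p K) (hΦ : PhiBounds Λ p Φ)
    (hΛ : 1 ≤ Λ) (hp : 1 < p) (hs : 0 < s) (hu : Measurable u) (hφ : Measurable φ)
    (hgu : gagliardo n s p univ u < ⊤) (hgφ : gagliardo n s p univ φ < ⊤) :
    Continuous fun h : Rn n => ∫ z : Rn n × Rn n,
      Φ (u z.1 - u z.2) * K z.1 z.2 * (φ (z.1 - h) - φ (z.2 - h)) := by
  have hp0 : 0 < p := by linarith
  have hsp : 0 < s * p := by positivity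
  set e : ℝ := (n : ℝ) + s * p with he
  have he0 : 0 < e := by positivity
  have hpq := Real.HolderConjugate.conjExponent hp
  set q := p.conjExponent
  have hq0 : 0 < q := hpq.symm.pos
  have hH : MemLp (fun z : Rn n × Rn n => (φ z.1 - φ z.2) * ‖z.1 - z.2‖ ^ (-(e / p)))
      (ENNReal.ofReal p) volume := by
    refine ⟨Measurable.aestronglyMeasurable (by fun_prop), ?_⟩
    rw [eLpNorm_lt_top_iff_lintegral_rpow_enorm_lt_top (by simpa using hp0) (by simp),
      ENNReal.toReal_ofReal hp0.le]
    rw [gagliardo_univ_eq hφ] at hgφ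
    refine lt_of_eq_of_lt (lintegral_congr fun z => ?_) hgφ
    rw [Real.enorm_eq_ofReal_abs, ENNReal.ofReal_rpow_of_nonneg (abs_nonneg _) hp0.le, abs_mul,
      Real.mul_rpow (abs_nonneg _) (abs_nonneg _), abs_of_nonneg (Real.rpow_nonneg (norm_nonneg _) _),
      ← Real.rpow_mul (norm_nonneg _)]
    congr 4
    field_simp
    rw [he]
    ring
  have hG : MemLp (fun z : Rn n × Rn n => Φ (u z.1 - u z.2) * K z.1 z.2 * ‖z.1 - z.2‖ ^ (e / p))
      (ENNReal.ofReal q) volume := by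
    refine ⟨((measurable_flux hK hΦ hu).mul (by fun_prop)).aestronglyMeasurable, ?_⟩
    rw [eLpNorm_lt_top_iff_lintegral_rpow_enorm_lt_top (by simpa using hq0) (by simp),
      ENNReal.toReal_ofReal hq0.le]
    rw [gagliardo_univ_eq hu] at hgu
    have hlt : ∫⁻ z : Rn n × Rn n, ENNReal.ofReal ((Λ ^ 2) ^ q) *
        ENNReal.ofReal (|u z.1 - u z.2| ^ p * ‖z.1 - z.2‖ ^ (-e)) < ⊤ := by
      rw [lintegral_const_mul' _ _ (by simp)]
      exact ENNReal.mul_lt_top (by simp) hgu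
    refine lt_of_le_of_lt (lintegral_mono fun z => ?_) hlt
    rw [Real.enorm_eq_ofReal_abs, ENNReal.ofReal_rpow_of_nonneg (abs_nonneg _) hq0.le, 
      ← ENNReal.ofReal_mul (by positivity)]
    refine ENNReal.ofReal_le_ofReal ?_
    have h1 : |Φ (u z.1 - u z.2) * K z.1 z.2 * ‖z.1 - z.2‖ ^ (e / p)| ≤
        Λ ^ 2 * |u z.1 - u z.2| ^ (p - 1) * ‖z.1 - z.2‖ ^ (-e / q) := by
      have hc : -e / q = -e + e / p := by
        have : q⁻¹ = 1 - p⁻¹ := by linarith [hpq.inv_add_inv_eq_one]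
        rw [div_eq_mul_inv, this]
        ring
      rw [abs_mul, abs_of_nonneg (Real.rpow_nonneg (norm_nonneg _) _),
        rpow_split (norm_nonneg _) (c := -e / q) (a := -e) (b := e / p) (by
          rw [← hc]; exact div_ne_zero (neg_ne_zero.2 he0.ne') hq0.ne') hc.symm, ← mul_assoc]
      gcongr
      exact abs_flux_le hK hΦ hΛ u _ _
    calc _ ≤ (Λ ^ 2 * |u z.1 - u z.2| ^ (p - 1) * ‖z.1 - z.2‖ ^ (-e / q)) ^ q := by
          gcongr
      _ = _ := by
        rw [Real.mul_rpow (by positivity) (by positivity),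
          Real.mul_rpow (by positivity) (by positivity), ← Real.rpow_mul (by positivity),
          ← Real.rpow_mul (by positivity) (-e / q), hpq.sub_one_mul_conj, mul_assoc]
        congr 3
        field_simp
  refine (continuous_integral_mul_translate hpq hG hH).congr fun h => ?_
  refine integral_congr_ae (Eventually.of_forall fun z => ?_)
  simp only [sub_sub_sub_cancel_right]
  rcases eq_or_ne z.1 z.2 with hz | hz
  · simp [hz]
  · have : 0 < ‖z.1 - z.2‖ := norm_pos_iff.2 (sub_ne_zero.2 hz)
    rw [Real.rpow_neg this.le]
    field_simp

end form

section form

variable {n : ℕ} {s p Λ : ℝ} {Φ : ℝ → ℝ} {K : Rn n → Rn n → ℝ} {u φ : Rn n → ℝ} {Ω S : Set (Rn n)}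

lemma isTestFun_convolution {δ : ℝ} (hS : IsCompact S) (hδ : cthickening δ S ⊆ Ω)
    (hφ0 : ∀ x ∉ S, φ x = 0) (hφi : Integrable φ) (b : ContDiffBump (0 : Rn n))
    (hb : b.rOut ≤ δ) :
    IsTestFun n Ω (convolution (b.normed volume) φ (ContinuousLinearMap.lsmul ℝ ℝ) volume) := by
  have h0 : ∀ x ∉ cthickening δ S,
      convolution (b.normed volume) φ (ContinuousLinearMap.lsmul ℝ ℝ) volume x = 0 := by
    intro x hx
    refine integral_eq_zero_of_ae (Eventually.of_forall fun t => ?_)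
    by_cases ht : t ∈ Function.support (b.normed volume)
    · rw [b.support_normed_eq] at ht
      have : φ (x - t) = 0 := by
        refine hφ0 _ fun hxt => hx ?_
        refine mem_cthickening_of_dist_le x (x - t) δ S hxt ?_
        have : ‖t‖ < b.rOut := by simpa using ht
        simpa [dist_eq_norm] using this.le.trans hb
      simp [this]
    · have : b.normed volume t = 0 := by simpa using ht
      simp [this]
  refine ⟨?_, ?_, ?_⟩
  · exact b.hasCompactSupport_normed.contDiff_convolution_left _ b.contDiff_normed
      hφi.locallyIntegrable
  · exact HasCompactSupport.intro hS.cthickening h0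
  · refine Subset.trans (closure_minimal (fun x hx => ?_) isClosed_cthickening) hδ
    by_contra h
    exact hx (h0 x h)

lemma integrable_mollified_form (hK : KernelBounds n Λ s p K) (hΦ : PhiBounds Λ p Φ)
    (hΛ : 1 ≤ Λ) (hp : 1 < p) (hu : Measurable u) (hφ : Measurable φ)
    (hgu : gagliardo n s p univ u < ⊤) (hgφ : gagliardo n s p univ φ < ⊤)
    {ρ : Rn n → ℝ} (hρ : Continuous ρ) (hρc : HasCompactSupport ρ) (hρ0 : ∀ x, 0 ≤ ρ x) :
    Integrable (fun w : (Rn n × Rn n) × Rn n => ρ w.2 *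
      (Φ (u w.1.1 - u w.1.2) * K w.1.1 w.1.2 * (φ (w.1.1 - w.2) - φ (w.1.2 - w.2))))
      ((volume : Measure (Rn n × Rn n)).prod volume) := by
  have hm1 : Measurable fun w : (Rn n × Rn n) × Rn n => Φ (u w.1.1 - u w.1.2) * K w.1.1 w.1.2 :=
    (measurable_flux hK hΦ hu).comp measurable_fst
  refine ⟨((hρ.measurable.comp measurable_snd).mul (hm1.mul (by fun_prop))).aestronglyMeasurable,
    ?_⟩
  rw [gagliardo_univ_eq hu] at hgu
  rw [gagliardo_univ_eq hφ] at hgφ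
  rw [hasFiniteIntegral_iff_norm]
  have hρi : ∫⁻ h, ENNReal.ofReal (ρ h) < ⊤ := by
    have := (hρ.integrable_of_hasCompactSupport (μ := volume) hρc).2
    rwa [hasFiniteIntegral_iff_ofReal (Eventually.of_forall hρ0)] at this
  set A : ℝ≥0∞ := ∫⁻ z : Rn n × Rn n,
      ENNReal.ofReal (|u z.1 - u z.2| ^ p * ‖z.1 - z.2‖ ^ (-((n : ℝ) + s * p)))
  set B : ℝ≥0∞ := ∫⁻ z : Rn n × Rn n,
      ENNReal.ofReal (|φ z.1 - φ z.2| ^ p * ‖z.1 - z.2‖ ^ (-((n : ℝ) + s * p)))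
  have hB : ∀ h : Rn n, ∫⁻ z : Rn n × Rn n, ENNReal.ofReal
      (|φ (z.1 - h) - φ (z.2 - h)| ^ p * ‖z.1 - z.2‖ ^ (-((n : ℝ) + s * p))) = B := by
    intro h
    have hg : MeasurePreserving (fun z : Rn n × Rn n => (z.1 - h, z.2 - h)) volume volume :=
      (measurePreserving_sub_right volume h).prod (measurePreserving_sub_right volume h)
    have h1 := hg.lintegral_comp (f := fun z : Rn n × Rn n =>
      ENNReal.ofReal (|φ z.1 - φ z.2| ^ p * ‖z.1 - z.2‖ ^ (-((n : ℝ) + s * p)))) (by fun_prop)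
    simpa only [sub_sub_sub_cancel_right] using h1
  calc _ ≤ ∫⁻ w : (Rn n × Rn n) × Rn n, ENNReal.ofReal (ρ w.2) * (ENNReal.ofReal (Λ ^ 2) * (
      ENNReal.ofReal (|u w.1.1 - u w.1.2| ^ p * ‖w.1.1 - w.1.2‖ ^ (-((n : ℝ) + s * p))) +
      ENNReal.ofReal (|φ (w.1.1 - w.2) - φ (w.1.2 - w.2)| ^ p *
        ‖w.1.1 - w.1.2‖ ^ (-((n : ℝ) + s * p))))) ∂(volume.prod volume) := by
        refine lintegral_mono fun w => ?_
        rw [← ENNReal.ofReal_add (by positivity) (by positivity),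
          ← ENNReal.ofReal_mul (by positivity), norm_mul, Real.norm_of_nonneg (hρ0 _),
          ENNReal.ofReal_mul (hρ0 _)]
        gcongr
        exact abs_form_integrand_le hK hΦ hΛ hp u _ _ _
    _ = ∫⁻ h, ENNReal.ofReal (ρ h) * (ENNReal.ofReal (Λ ^ 2) * (A + B)) := by
        rw [lintegral_prod_symm' _ (by fun_prop)]
        refine lintegral_congr fun h => ?_
        dsimp only
        rw [lintegral_const_mul' _ _ (by simp), lintegral_const_mul' _ _ (by simp),
          lintegral_add_left (by fun_prop), hB h]
    _ < ⊤ := by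
        rw [lintegral_mul_const' _ _
          (ENNReal.mul_lt_top (by simp) (ENNReal.add_lt_top.2 ⟨hgu, hgφ⟩)).ne]
        exact ENNReal.mul_lt_top hρi
          (ENNReal.mul_lt_top (by simp) (ENNReal.add_lt_top.2 ⟨hgu, hgφ⟩))

/-- The weak formulation extends from smooth test functions to compactly supported functions with
finite Gagliardo seminorm. -/
lemma form_eq_zero_of_gagliardo_lt_top (hK : KernelBounds n Λ s p K) (hΦ : PhiBounds Λ p Φ)
    (hΛ : 1 ≤ Λ) (hp : 1 < p) (hs : 0 < s) (hu : Measurable u) (hφ : Measurable φ)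
    (hgu : gagliardo n s p univ u < ⊤) (hgφ : gagliardo n s p univ φ < ⊤)
    (hsol : ∀ ψ, IsTestFun n Ω ψ → nonlocalForm n Φ K u ψ = 0)
    (hΩ : IsOpen Ω) (hS : IsCompact S) (hSΩ : S ⊆ Ω) (hφ0 : ∀ x ∉ S, φ x = 0)
    (hφi : Integrable φ) :
    ∫ z : Rn n × Rn n, Φ (u z.1 - u z.2) * K z.1 z.2 * (φ z.1 - φ z.2) = 0 := by
  obtain ⟨δ, hδ0, hδ⟩ := hS.exists_cthickening_subset_open hΩ hSΩ
  set I : Rn n → ℝ := fun h => ∫ z : Rn n × Rn n,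
      Φ (u z.1 - u z.2) * K z.1 z.2 * (φ (z.1 - h) - φ (z.2 - h)) with hI
  have hIc : Continuous I := continuous_translated_form hK hΦ hΛ hp hs hu hφ hgu hgφ
  have key : ∀ b : ContDiffBump (0 : Rn n), b.rOut ≤ δ →
      ∫ h, b.normed volume h * I h = 0 := by
    intro b hb
    have hint := integrable_mollified_form hK hΦ hΛ hp hu hφ hgu hgφ
      (b.contDiff_normed (n := 0) (μ := volume)).continuous b.hasCompactSupport_normed
      b.nonneg_normed
    rw [← hsol _ (isTestFun_convolution hS hδ hφ0 hφi b hb)]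
    have h1 : ∀ x y, Φ (u x - u y) *
        (convolution (b.normed volume) φ (ContinuousLinearMap.lsmul ℝ ℝ) volume x -
         convolution (b.normed volume) φ (ContinuousLinearMap.lsmul ℝ ℝ) volume y) * K x y =
        ∫ h, b.normed volume h * (Φ (u x - u y) * K x y * (φ (x - h) - φ (y - h))) := by
      intro x y
      have hce : ConvolutionExists (b.normed volume) φ (ContinuousLinearMap.lsmul ℝ ℝ) volume :=
        b.hasCompactSupport_normed.convolutionExists_left _
          (b.contDiff_normed (n := 0)).continuous hφi.locallyIntegrable
      have hx := hce x
      have hy := hce y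
      simp only [ConvolutionExistsAt, ContinuousLinearMap.lsmul_apply, smul_eq_mul] at hx hy
      simp only [convolution, ContinuousLinearMap.lsmul_apply, smul_eq_mul]
      rw [← integral_sub hx hy, mul_right_comm, ← integral_const_mul]
      congr 1
      ext h
      ring
    have h2 := integral_integral_swap (f := fun (z : Rn n × Rn n) h => b.normed volume h *
      (Φ (u z.1 - u z.2) * K z.1 z.2 * (φ (z.1 - h) - φ (z.2 - h)))) hint
    have h3 := integral_prod _ (by simpa only [Measure.volume_eq_prod] using hint.integral_prod_left)
    simp only [nonlocalForm, h1]
    rw [← Measure.volume_eq_prod] at h3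
    rw [← h3, h2]
    simp only [hI, integral_const_mul]
  have hI0 : I 0 = 0 := by
    by_contra hne
    have hpos : 0 < |I 0| / 2 := by positivity
    obtain ⟨ε, hε, hε'⟩ := Metric.continuousAt_iff.1 hIc.continuousAt _ hpos
    let m := min δ ε
    have hm : 0 < m := lt_min hδ0 hε
    let b : ContDiffBump (0 : Rn n) := ⟨m / 2, m, by positivity, by linarith⟩
    have h := b.dist_normed_convolution_le (μ := volume) (g := fun h => I (-h)) (x₀ := 0)
      (ε := |I 0| / 2) (hIc.comp continuous_neg).aestronglyMeasurable (fun x hx => by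
        have : dist (-x) 0 < ε := by
          rw [dist_zero_right, norm_neg, ← dist_zero_right]
          exact lt_of_lt_of_le hx (min_le_right _ _)
        simpa using (hε' this).le)
    have hk := key b (min_le_left _ _)
    simp only [convolution, ContinuousLinearMap.lsmul_apply, smul_eq_mul, zero_sub, neg_neg, hk,
      neg_zero] at h
    rw [dist_zero_left, Real.norm_eq_abs] at h
    have : 0 < |I 0| := abs_pos.2 hne
    linarith
  simpa [hI] using hI0

end form

lemma add_rpow_le_two_rpow_mul {a b p : ℝ} (ha : 0 ≤ a) (hb : 0 ≤ b) (hp : 0 ≤ p) :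
    (a + b) ^ p ≤ 2 ^ p * (a ^ p + b ^ p) := by
  have h : (max a b) ^ p ≤ a ^ p + b ^ p := by
    rcases max_choice a b with h | h <;> rw [h]
    · exact le_add_of_nonneg_right (by positivity)
    · exact le_add_of_nonneg_left (by positivity)
  calc (a + b) ^ p ≤ (2 * max a b) ^ p := by
        gcongr; linarith [le_max_left a b, le_max_right a b]
    _ = 2 ^ p * (max a b) ^ p := Real.mul_rpow (by norm_num) (le_max_of_le_left ha)
    _ ≤ _ := by gcongr

lemma rpow_sub_rpow_le {a b p : ℝ} (ha : 0 ≤ a) (hb : 0 < b) (hp : 1 ≤ p) :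
    b ^ p - a ^ p ≤ p * b ^ (p - 1) * (b - a) := by
  have h := one_add_mul_self_le_rpow_one_add (s := a / b - 1) (by
    have : 0 ≤ a / b := by positivity
    linarith) hp
  rw [add_sub_cancel, Real.div_rpow ha hb.le, le_div_iff₀ (by positivity)] at h
  have h2 : b ^ p = b ^ (p - 1) * b := by
    rw [← Real.rpow_add_one hb.ne']; ring_nf
  have h3 : (1 + p * (a / b - 1)) * b ^ p = b ^ p + p * b ^ (p - 1) * (a - b) := by
    rw [add_mul, one_mul, h2]; field_simp
  rw [h3] at h
  linarith

/-- Radial Lipschitz cutoff, equal to `1` on `ball z R₁` and vanishing off `ball z ((R₁ + R₂) / 2)`. -/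
def radialCutoff {n : ℕ} (z : Rn n) (R₁ R₂ : ℝ) (x : Rn n) : ℝ :=
  max 0 (min 1 (((R₁ + R₂) / 2 - ‖x - z‖) * (2 / (R₂ - R₁))))

section cutoff

variable {n : ℕ} {z : Rn n} {R₁ R₂ : ℝ}

lemma radialCutoff_nonneg (x : Rn n) : 0 ≤ radialCutoff z R₁ R₂ x := le_max_left _ _

lemma radialCutoff_le_one (x : Rn n) : radialCutoff z R₁ R₂ x ≤ 1 :=
  max_le zero_le_one (min_le_left _ _)

lemma radialCutoff_eq_one (h : R₁ < R₂) {x : Rn n} (hx : x ∈ ball z R₁) :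
    radialCutoff z R₁ R₂ x = 1 := by
  have h0 : 0 < R₂ - R₁ := sub_pos.2 h
  rw [mem_ball_iff_norm] at hx
  have : 1 ≤ ((R₁ + R₂) / 2 - ‖x - z‖) * (2 / (R₂ - R₁)) := by
    rw [mul_div_assoc', le_div_iff₀ h0]
    linarith
  rw [radialCutoff, min_eq_left this, max_eq_right zero_le_one]

lemma radialCutoff_eq_zero (h : R₁ < R₂) {x : Rn n} (hx : x ∉ ball z ((R₁ + R₂) / 2)) :
    radialCutoff z R₁ R₂ x = 0 := by
  have h0 : 0 < R₂ - R₁ := sub_pos.2 h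
  rw [mem_ball_iff_norm, not_lt] at hx
  have : ((R₁ + R₂) / 2 - ‖x - z‖) * (2 / (R₂ - R₁)) ≤ 0 :=
    mul_nonpos_of_nonpos_of_nonneg (by linarith) (by positivity)
  exact max_eq_left ((min_le_right _ _).trans this)

lemma abs_radialCutoff_sub_le (h : R₁ < R₂) (x y : Rn n) :
    |radialCutoff z R₁ R₂ x - radialCutoff z R₁ R₂ y| ≤ 2 / (R₂ - R₁) * ‖x - y‖ := by
  have h0 : 0 < R₂ - R₁ := sub_pos.2 h
  refine (abs_max_sub_max_le_max _ _ _ _).trans ?_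
  rw [sub_self, abs_zero, max_eq_right (abs_nonneg _)]
  refine (abs_min_sub_min_le_max _ _ _ _).trans ?_
  rw [sub_self, abs_zero, max_eq_right (abs_nonneg _), ← sub_mul, abs_mul,
    abs_of_nonneg (by positivity : 0 ≤ 2 / (R₂ - R₁)), mul_comm]
  gcongr
  rw [sub_sub_sub_cancel_left]
  refine (abs_norm_sub_norm_le _ _).trans ?_
  rw [sub_sub_sub_cancel_right, norm_sub_rev]

lemma measurable_radialCutoff : Measurable (radialCutoff z R₁ R₂) := by
  unfold radialCutoff; fun_prop

lemma abs_radialCutoff_rpow_sub_le {p : ℝ} (hp : 1 ≤ p) (h : R₁ < R₂) (x y : Rn n) :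
    |radialCutoff z R₁ R₂ x ^ p - radialCutoff z R₁ R₂ y ^ p| ≤
      p * (2 / (R₂ - R₁)) * ‖x - y‖ := by
  have key : ∀ a b : ℝ, 0 ≤ a → a ≤ b → b ≤ 1 → |a ^ p - b ^ p| ≤ p * |a - b| := by
    intro a b ha hab hb1
    rw [abs_sub_comm, abs_sub_comm a, abs_of_nonneg (sub_nonneg.2 (by gcongr)),
      abs_of_nonneg (sub_nonneg.2 hab)]
    rcases (ha.trans hab).eq_or_lt with h0 | h0
    · have : a = 0 := le_antisymm (hab.trans h0.symm.le) ha
      subst this; rw [← h0]; simp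
    · refine (rpow_sub_rpow_le ha h0 hp).trans ?_
      have : b ^ (p - 1) ≤ 1 := Real.rpow_le_one h0.le hb1 (by linarith)
      have h2 : 0 ≤ b - a := sub_nonneg.2 hab
      calc p * b ^ (p - 1) * (b - a) ≤ p * 1 * (b - a) := by gcongr
        _ = _ := by ring
  have h1 : |radialCutoff z R₁ R₂ x ^ p - radialCutoff z R₁ R₂ y ^ p| ≤
      p * |radialCutoff z R₁ R₂ x - radialCutoff z R₁ R₂ y| := by
    rcases le_total (radialCutoff z R₁ R₂ x) (radialCutoff z R₁ R₂ y) with hle | hle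
    · exact key _ _ (radialCutoff_nonneg x) hle (radialCutoff_le_one y)
    · rw [abs_sub_comm, abs_sub_comm (radialCutoff z R₁ R₂ x)]
      exact key _ _ (radialCutoff_nonneg y) hle (radialCutoff_le_one x)
  refine h1.trans ?_
  rw [mul_assoc]
  have := abs_radialCutoff_sub_le h x y (z := z)
  gcongr

end cutoff

section testfunction

variable {n : ℕ} {s p : ℝ} {u ζ : Rn n → ℝ} {z : Rn n} {ρ L : ℝ}

lemma lintegral_min_one_rpow_mul_kernel_lt_top (hn : 2 ≤ n) (hs : 0 < s) (hs1 : s < 1)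
    (hp : 1 < p) (hL : 0 ≤ L) : ∃ C : ℝ≥0∞, C < ⊤ ∧ ∀ x : Rn n,
      ∫⁻ y, ENNReal.ofReal (min 1 (L * ‖y - x‖) ^ p * ‖y - x‖ ^ (-((n : ℝ) + s * p))) ≤ C := by
  obtain ⟨C1, -, h1⟩ := exists_tail_kernel_bound n hs hp
  obtain ⟨C2, -, h2⟩ := exists_ball_kernel_bound hn hs1 hp
  have hp0 : 0 < p := by linarith
  refine ⟨ENNReal.ofReal (L ^ p) * ENNReal.ofReal (C2 * 1 ^ (p - s * p)) +
    ENNReal.ofReal (C1 * 1 ^ (-(s * p))), by finiteness, fun x => ?_⟩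
  rw [← lintegral_add_compl _ (measurableSet_ball (x := x) (ε := 1))]
  gcongr
  · refine le_trans ?_ (mul_le_mul_right (h2 x 1 one_pos) _)
    rw [← lintegral_const_mul' _ _ (by simp)]
    refine lintegral_mono fun y => ?_
    rw [← ENNReal.ofReal_mul (by positivity)]
    refine ENNReal.ofReal_le_ofReal ?_
    rcases (norm_nonneg (y - x)).eq_or_lt with h0 | h0
    · rw [← h0, mul_zero, min_eq_right zero_le_one, Real.zero_rpow hp0.ne', zero_mul]
      positivity
    · calc _ ≤ (L * ‖y - x‖) ^ p * ‖y - x‖ ^ (-((n : ℝ) + s * p)) := by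
            gcongr; exact min_le_right _ _
        _ = L ^ p * ‖y - x‖ ^ (p - ((n : ℝ) + s * p)) := by
          rw [Real.mul_rpow hL h0.le, mul_assoc, ← Real.rpow_add h0, sub_eq_add_neg p]
  · refine le_trans (lintegral_mono fun y => ?_) (h1 x 1 one_pos)
    refine ENNReal.ofReal_le_ofReal (mul_le_of_le_one_left (by positivity) ?_)
    exact Real.rpow_le_one (le_min zero_le_one (by positivity)) (min_le_left _ _) hp0.le

lemma lintegral_ball_pos_part_rpow_lt_top (hp : 1 < p)
    (hu : ∫⁻ x, ENNReal.ofReal (|u x| ^ p) < ⊤) (k : ℝ) (hum : Measurable u) :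
    ∫⁻ x in ball z ρ, ENNReal.ofReal (max (u x - k) 0 ^ p) < ⊤ := by
  have hp0 : 0 < p := by linarith
  have hb : ∀ x, ENNReal.ofReal (max (u x - k) 0 ^ p) ≤
      ENNReal.ofReal (2 ^ p) * (ENNReal.ofReal (|u x| ^ p) + ENNReal.ofReal (|k| ^ p)) := by
    intro x
    rw [← ENNReal.ofReal_add (by positivity) (by positivity), ← ENNReal.ofReal_mul (by positivity)]
    refine ENNReal.ofReal_le_ofReal ?_
    refine le_trans ?_ (add_rpow_le_two_rpow_mul (abs_nonneg _) (abs_nonneg _) hp0.le)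
    gcongr
    refine max_le ?_ (by positivity)
    linarith [le_abs_self (u x), neg_abs_le k]
  refine lt_of_le_of_lt (lintegral_mono hb) ?_
  rw [lintegral_const_mul' _ _ (by simp), lintegral_add_left (by fun_prop), lintegral_const]
  refine ENNReal.mul_lt_top (by simp) (ENNReal.add_lt_top.2 ⟨?_, ?_⟩)
  · exact lt_of_le_of_lt (lintegral_mono' Measure.restrict_le_self le_rfl) hu
  · rw [Measure.restrict_apply MeasurableSet.univ, univ_inter]
    exact ENNReal.mul_lt_top (by simp) measure_ball_lt_top

lemma gagliardo_pos_part_mul_lt_top (hn : 2 ≤ n) (hs : 0 < s) (hs1 : s < 1) (hp : 1 < p)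
    (hum : Measurable u) (hu : ∫⁻ x, ENNReal.ofReal (|u x| ^ p) < ⊤)
    (hgu : gagliardo n s p univ u < ⊤) (k : ℝ) (hζm : Measurable ζ) (hζ0 : ∀ x, 0 ≤ ζ x)
    (hζ1 : ∀ x, ζ x ≤ 1) (hL : 0 ≤ L) (hζL : ∀ x y, |ζ x - ζ y| ≤ L * ‖x - y‖)
    (hζs : ∀ x ∉ ball z ρ, ζ x = 0) :
    gagliardo n s p univ (fun x => max (u x - k) 0 * ζ x) < ⊤ := by
  have hp0 : 0 < p := by linarith
  obtain ⟨C, hC, hCk⟩ := lintegral_min_one_rpow_mul_kernel_lt_top hn hs hs1 hp hL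
  have hw := lintegral_ball_pos_part_rpow_lt_top (z := z) (ρ := ρ) hp hu k hum
  rw [gagliardo_univ_eq hum] at hgu
  rw [gagliardo_univ_eq (by fun_prop)]
  set w : Rn n → ℝ := fun x => max (u x - k) 0 with hwdef
  have hwm : Measurable w := by fun_prop
  have hw0 : ∀ x, 0 ≤ w x := fun x => le_max_right _ _
  set W : Rn n → ℝ := (ball z ρ).indicator w with hWdef
  have hWm : Measurable W := hwm.indicator measurableSet_ball
  have hW0 : ∀ x, 0 ≤ W x := indicator_nonneg fun x _ => hw0 x
  have hWp : ∫⁻ x, ENNReal.ofReal (W x ^ p) < ⊤ := by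
    rw [← lintegral_indicator measurableSet_ball] at hw
    refine lt_of_eq_of_lt (lintegral_congr fun x => ?_) hw
    by_cases hx : x ∈ ball z ρ
    · simp [hWdef, hx, hwdef]
    · simp [hWdef, hx, Real.zero_rpow hp0.ne']
  set J : Rn n → Rn n → ℝ := fun x y =>
    min 1 (L * ‖y - x‖) ^ p * ‖y - x‖ ^ (-((n : ℝ) + s * p))
  have hmin : ∀ x y : Rn n, 0 ≤ min 1 (L * ‖x - y‖) := fun x y =>
    le_min zero_le_one (by positivity)
  have hζmin : ∀ x y, |ζ x - ζ y| ≤ min 1 (L * ‖x - y‖) := fun x y =>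
    le_min (abs_sub_le_of_nonneg_of_le (hζ0 x) (hζ1 x) (hζ0 y) (hζ1 y)) (hζL x y)
  have hd : ∀ x y, |w x * ζ x - w y * ζ y| ≤
      |u x - u y| + (W x + W y) * min 1 (L * ‖x - y‖) := by
    intro x y
    by_cases hy : y ∈ ball z ρ
    · have hWy : W y = w y := by simp [hWdef, hy]
      have e1 : w x * ζ x - w y * ζ y = ζ x * (w x - w y) + w y * (ζ x - ζ y) := by ring
      rw [e1, hWy]
      have e2 : |w x - w y| ≤ |u x - u y| := by
        refine (abs_max_sub_max_le_max _ _ _ _).trans ?_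
        rw [sub_self, abs_zero, max_eq_left (abs_nonneg _), sub_sub_sub_cancel_right]
      calc _ ≤ |ζ x * (w x - w y)| + |w y * (ζ x - ζ y)| := abs_add_le _ _
        _ = ζ x * |w x - w y| + w y * |ζ x - ζ y| := by
          rw [abs_mul, abs_mul, abs_of_nonneg (hζ0 x), abs_of_nonneg (hw0 y)]
        _ ≤ 1 * |u x - u y| + (W x + w y) * min 1 (L * ‖x - y‖) := by
          have := hW0 x
          have := hw0 y
          have := hmin x y
          have := hζmin x y
          gcongr
          · exact hζ1 x
          · linarith
        _ = _ := by ring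
    · by_cases hx : x ∈ ball z ρ
      · have hWx : W x = w x := by simp [hWdef, hx]
        have hWy : W y = 0 := by simp [hWdef, hy]
        have h1 := hζmin x y
        rw [hζs y hy, sub_zero] at h1
        rw [hζs y hy, mul_zero, sub_zero, abs_mul, abs_of_nonneg (hw0 x), hWx, hWy, add_zero]
        have := hw0 x
        have h2 : w x * |ζ x| ≤ w x * min 1 (L * ‖x - y‖) := by gcongr
        linarith [abs_nonneg (u x - u y)]
      · rw [hζs y hy, hζs x hx]
        have := hW0 x
        have := hW0 y
        have := hmin x y
        simp only [mul_zero, sub_self, abs_zero]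
        positivity
  have hpt : ∀ x y, |w x * ζ x - w y * ζ y| ^ p * ‖x - y‖ ^ (-((n : ℝ) + s * p)) ≤
      2 ^ p * 2 ^ p * (|u x - u y| ^ p * ‖x - y‖ ^ (-((n : ℝ) + s * p)) +
        W x ^ p * J x y + W y ^ p * J y x) := by
    intro x y
    have hJ : J x y = J y x := by simp only [J]; rw [norm_sub_rev]
    have hx := hW0 x
    have hy := hW0 y
    have hm := hmin x y
    have h2p : (1 : ℝ) ≤ 2 ^ p := Real.one_le_rpow (by norm_num) hp0.le
    have h1 : |w x * ζ x - w y * ζ y| ^ p ≤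
        2 ^ p * (|u x - u y| ^ p + 2 ^ p * (W x ^ p + W y ^ p) * min 1 (L * ‖x - y‖) ^ p) := by
      calc _ ≤ (|u x - u y| + (W x + W y) * min 1 (L * ‖x - y‖)) ^ p := by
            gcongr; exact hd x y
        _ ≤ 2 ^ p * (|u x - u y| ^ p + ((W x + W y) * min 1 (L * ‖x - y‖)) ^ p) :=
          add_rpow_le_two_rpow_mul (abs_nonneg _) (by positivity) hp0.le
        _ ≤ _ := by
          rw [Real.mul_rpow (by positivity) hm]
          gcongr
          exact add_rpow_le_two_rpow_mul hx hy hp0.le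
    have hJ' : J y x = min 1 (L * ‖x - y‖) ^ p * ‖x - y‖ ^ (-((n : ℝ) + s * p)) := rfl
    calc _ ≤ 2 ^ p * (|u x - u y| ^ p + 2 ^ p * (W x ^ p + W y ^ p) * min 1 (L * ‖x - y‖) ^ p) *
          ‖x - y‖ ^ (-((n : ℝ) + s * p)) := by gcongr
      _ = 2 ^ p * (1 * (|u x - u y| ^ p * ‖x - y‖ ^ (-((n : ℝ) + s * p))) +
          2 ^ p * (W x ^ p * J x y + W y ^ p * J y x)) := by rw [hJ, hJ']; ring
      _ ≤ 2 ^ p * (2 ^ p * (|u x - u y| ^ p * ‖x - y‖ ^ (-((n : ℝ) + s * p))) +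
          2 ^ p * (W x ^ p * J x y + W y ^ p * J y x)) := by gcongr
      _ = _ := by ring
  have hJm : Measurable (Function.uncurry J) := by
    simp only [J, Function.uncurry_def]; fun_prop
  have hJ0 : ∀ x y, 0 ≤ J x y := fun x y =>
    mul_nonneg (Real.rpow_nonneg (hmin _ _) _) (by positivity)
  have hWJ : ∫⁻ z : Rn n × Rn n, ENNReal.ofReal (W z.1 ^ p * J z.1 z.2) < ⊤ := by
    rw [Measure.volume_eq_prod, lintegral_prod _ (by fun_prop)]
    calc _ ≤ ∫⁻ x, ENNReal.ofReal (W x ^ p) * C := by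
          refine lintegral_mono fun x => ?_
          have := hW0 x
          dsimp only
          simp_rw [ENNReal.ofReal_mul (show 0 ≤ W x ^ p by positivity)]
          rw [lintegral_const_mul' _ _ (by simp)]
          gcongr
          exact hCk x
      _ < ⊤ := by
        rw [lintegral_mul_const' _ _ hC.ne]
        exact ENNReal.mul_lt_top hWp hC
  have hWJ' : ∫⁻ z : Rn n × Rn n, ENNReal.ofReal (W z.2 ^ p * J z.2 z.1) < ⊤ := by
    rw [Measure.volume_eq_prod, lintegral_prod_symm' _ (by fun_prop)]
    rwa [Measure.volume_eq_prod, lintegral_prod _ (by fun_prop)] at hWJ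
  refine lt_of_le_of_lt (lintegral_mono fun z => ENNReal.ofReal_le_ofReal (hpt z.1 z.2)) ?_
  have hx : ∀ x, 0 ≤ W x ^ p := fun x => Real.rpow_nonneg (hW0 x) _
  have hsplit : ∀ z : Rn n × Rn n, ENNReal.ofReal (2 ^ p * 2 ^ p *
      (|u z.1 - u z.2| ^ p * ‖z.1 - z.2‖ ^ (-((n : ℝ) + s * p)) +
        W z.1 ^ p * J z.1 z.2 + W z.2 ^ p * J z.2 z.1)) = ENNReal.ofReal (2 ^ p * 2 ^ p) *
      (ENNReal.ofReal (|u z.1 - u z.2| ^ p * ‖z.1 - z.2‖ ^ (-((n : ℝ) + s * p))) +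
       ENNReal.ofReal (W z.1 ^ p * J z.1 z.2) + ENNReal.ofReal (W z.2 ^ p * J z.2 z.1)) := by
    intro z
    have h1 := mul_nonneg (hx z.1) (hJ0 z.1 z.2)
    have h2 := mul_nonneg (hx z.2) (hJ0 z.2 z.1)
    rw [ENNReal.ofReal_mul (by positivity), ENNReal.ofReal_add (by positivity) h2,
      ENNReal.ofReal_add (by positivity) h1]
  simp_rw [hsplit]
  rw [lintegral_const_mul' _ _ (by simp), lintegral_add_left (by fun_prop),
    lintegral_add_left (by fun_prop)]
  exact ENNReal.mul_lt_top (by simp) (ENNReal.add_lt_top.2 ⟨ENNReal.add_lt_top.2 ⟨hgu, hWJ⟩, hWJ'⟩)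

lemma integrable_pos_part_mul (hp : 1 < p) (hum : Measurable u)
    (hu : ∫⁻ x, ENNReal.ofReal (|u x| ^ p) < ⊤) (k : ℝ) (hζm : Measurable ζ) (hζ0 : ∀ x, 0 ≤ ζ x)
    (hζ1 : ∀ x, ζ x ≤ 1) (hζs : ∀ x ∉ ball z ρ, ζ x = 0) :
    Integrable (fun x => max (u x - k) 0 * ζ x) := by
  refine ⟨Measurable.aestronglyMeasurable (by fun_prop), ?_⟩
  have hw := lintegral_ball_pos_part_rpow_lt_top (z := z) (ρ := ρ) hp hu k hum
  have h0 : ∀ x, 0 ≤ max (u x - k) 0 * ζ x := fun x => mul_nonneg (le_max_right _ _) (hζ0 x)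
  rw [hasFiniteIntegral_iff_ofReal (Eventually.of_forall h0)]
  have h1 : ∫⁻ x in ball z ρ, (1 + ENNReal.ofReal (max (u x - k) 0 ^ p)) < ⊤ := by
    rw [lintegral_add_left (by fun_prop), lintegral_one, Measure.restrict_apply MeasurableSet.univ,
      univ_inter]
    exact ENNReal.add_lt_top.2 ⟨measure_ball_lt_top, hw⟩
  rw [← lintegral_indicator measurableSet_ball] at h1
  refine lt_of_le_of_lt (lintegral_mono fun x => ?_) h1
  by_cases hx : x ∈ ball z ρ
  · rw [indicator_of_mem hx]
    set a := max (u x - k) 0 with ha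
    have ha0 : 0 ≤ a := le_max_right _ _
    rw [← ENNReal.ofReal_one, ← ENNReal.ofReal_add zero_le_one (by positivity)]
    refine ENNReal.ofReal_le_ofReal ((mul_le_of_le_one_right ha0 (hζ1 x)).trans ?_)
    rcases le_total a 1 with h | h
    · have : 0 ≤ a ^ p := by positivity
      linarith
    · have : a ≤ a ^ p := by simpa using Real.rpow_le_rpow_of_exponent_le h hp.le
      linarith
  · rw [hζs x hx]; simp

end testfunction

section pointwise

variable {p Λ : ℝ} {Φ : ℝ → ℝ}

lemma PhiBounds.reflect (hΦ : PhiBounds Λ p Φ) : PhiBounds Λ p (fun t => -Φ (-t)) := by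
  refine ⟨(hΦ.1.comp continuous_neg).neg, by simp [hΦ.2.1], fun t => ?_⟩
  have h := hΦ.2.2 (-t)
  rw [abs_neg] at h
  constructor <;> linarith [h.1, h.2]

lemma PhiBounds.nonneg (hΦ : PhiBounds Λ p Φ) (hΛ : 1 ≤ Λ) {t : ℝ} (ht : 0 ≤ t) : 0 ≤ Φ t := by
  rcases ht.eq_or_lt with rfl | ht
  · exact hΦ.2.1.ge
  · exact nonneg_of_mul_nonneg_left (le_trans (by positivity) (hΦ.2.2 t).1) ht

lemma PhiBounds.lower (hΦ : PhiBounds Λ p Φ) (hp : 1 < p) {t : ℝ} (ht : 0 ≤ t) :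
    Λ⁻¹ * t ^ (p - 1) ≤ Φ t := by
  rcases ht.eq_or_lt with rfl | ht
  · rw [hΦ.2.1, Real.zero_rpow (by linarith), mul_zero]
  · have h := (hΦ.2.2 t).1
    rw [abs_of_pos ht] at h
    rw [Real.rpow_sub_one ht.ne', mul_div_assoc', div_le_iff₀ ht]
    refine le_trans (le_of_eq ?_) h
    rw [div_eq_inv_mul]

lemma flux_cutoff_ge (hΦ : PhiBounds Λ p Φ) (hΛ : 1 ≤ Λ) (hp : 1 < p) (a b : ℝ) {e₁ e₂ : ℝ}
    (he₁ : 0 ≤ e₁) (he₂ : 0 ≤ e₂) :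
    -(Λ * p ^ p * ((max a 0 ^ p + max b 0 ^ p) * |e₁ - e₂| ^ p)) ≤
      Φ (a - b) * (max a 0 * e₁ ^ p - max b 0 * e₂ ^ p) := by
  have hp0 : 0 < p := by linarith
  wlog hab : b ≤ a generalizing a b e₁ e₂ Φ
  · have h := this hΦ.reflect b a he₂ he₁ (not_le.1 hab).le
    rw [neg_sub, abs_sub_comm, add_comm (max b 0 ^ p)] at h
    linarith
  set A := max a 0 with hA
  set B := max b 0 with hB
  have hA0 : 0 ≤ A := le_max_right _ _
  have hB0 : 0 ≤ B := le_max_right _ _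
  have hBA : B ≤ A := max_le_max hab le_rfl
  have hΦ0 : 0 ≤ Φ (a - b) := hΦ.nonneg hΛ (sub_nonneg.2 hab)
  rcases le_or_gt (B * e₂ ^ p) (A * e₁ ^ p) with h | h
  · refine le_trans ?_ (mul_nonneg hΦ0 (sub_nonneg.2 h))
    have : 0 ≤ Λ * p ^ p * ((A ^ p + B ^ p) * |e₁ - e₂| ^ p) := by positivity
    linarith
  have hBpos : 0 < B := by
    refine hB0.lt_of_ne fun h0 => ?_
    rw [← h0, zero_mul] at h
    exact absurd h (not_lt.2 (by positivity))
  have he12 : e₁ < e₂ := by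
    by_contra hle
    push Not at hle
    have : B * e₂ ^ p ≤ A * e₁ ^ p := by gcongr
    linarith
  have hb : b = B := by
    rcases max_choice b 0 with h' | h'
    · rw [hB, h']
    · rw [hB, h'] at hBpos; exact absurd hBpos (lt_irrefl _)
  have ha : a = A := by
    rw [hA, max_eq_left]; linarith
  have he2 : 0 < e₂ := lt_of_le_of_lt he₁ he12
  set t := A - B with ht
  have ht0 : 0 ≤ t := sub_nonneg.2 hBA
  have hΦu : Φ (a - b) ≤ Λ * t ^ (p - 1) := by
    have := hΦ.abs_le hΛ (a - b)
    rw [ha, hb, ← ht, abs_of_nonneg ht0] at this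
    rw [ha, hb]
    exact (le_abs_self _).trans this
  have h1 : B * e₂ ^ p - A * e₁ ^ p ≤ e₂ ^ (p - 1) * (p * (A * (e₂ - e₁)) - t * e₂) := by
    have h2 := rpow_sub_rpow_le he₁ he2 hp.le
    have h3 : e₂ ^ p = e₂ ^ (p - 1) * e₂ := by
      rw [← Real.rpow_add_one he2.ne']; ring_nf
    have h4 : A * (e₂ ^ p - e₁ ^ p) ≤ A * (p * e₂ ^ (p - 1) * (e₂ - e₁)) := by gcongr
    have h5 : B * e₂ ^ p = A * e₂ ^ p - t * (e₂ ^ (p - 1) * e₂) := by rw [← h3, ht]; ring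
    linarith
  set Y := A * (e₂ - e₁) with hY
  have hY0 : 0 ≤ Y := mul_nonneg hA0 (sub_nonneg.2 he12.le)
  have h6 : Φ (a - b) * (B * e₂ ^ p - A * e₁ ^ p) ≤ Λ * ((t * e₂) ^ (p - 1) * (p * Y - t * e₂)) := by
    calc _ ≤ (Λ * t ^ (p - 1)) * (B * e₂ ^ p - A * e₁ ^ p) := by
          gcongr
      _ ≤ (Λ * t ^ (p - 1)) * (e₂ ^ (p - 1) * (p * Y - t * e₂)) := by gcongr
      _ = _ := by rw [Real.mul_rpow ht0 he2.le]; ring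
  have h7 : (t * e₂) ^ (p - 1) * (p * Y - t * e₂) ≤ (p * Y) ^ p := by
    have hX : 0 ≤ t * e₂ := by positivity
    have hpY : 0 ≤ p * Y := by positivity
    rcases le_total (p * Y) (t * e₂) with h | h
    · refine le_trans (mul_nonpos_of_nonneg_of_nonpos (by positivity) (by linarith)) (by positivity)
    · calc _ ≤ (p * Y) ^ (p - 1) * (p * Y) := by
            gcongr
            linarith
        _ = _ := by rw [← Real.rpow_add_one' hpY (by linarith)]; ring_nf
  have h8 : (p * Y) ^ p ≤ p ^ p * ((A ^ p + B ^ p) * |e₁ - e₂| ^ p) := by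
    rw [Real.mul_rpow hp0.le hY0, hY, Real.mul_rpow hA0 (sub_nonneg.2 he12.le),
      abs_sub_comm, abs_of_nonneg (sub_nonneg.2 he12.le)]
    have : 0 ≤ e₂ - e₁ := sub_nonneg.2 he12.le
    gcongr
    exact le_add_of_nonneg_right (by positivity)
  have h9 : Λ * ((t * e₂) ^ (p - 1) * (p * Y - t * e₂)) ≤
      Λ * (p ^ p * ((A ^ p + B ^ p) * |e₁ - e₂| ^ p)) := by
    exact mul_le_mul_of_nonneg_left (h7.trans h8) (by linarith)
  linarith

lemma flux_coercive (hΦ : PhiBounds Λ p Φ) (hΛ : 1 ≤ Λ) (hp : 1 < p) (a b : ℝ) :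
    Λ⁻¹ / 2 * (|max a 0 - max b 0| ^ p + max a 0 * max (-b) 0 ^ (p - 1)) ≤
      Φ (a - b) * (max a 0 - max b 0) := by
  have hp0 : 0 < p := by linarith
  have hp1 : 0 < p - 1 := by linarith
  have hΛ0 : 0 < Λ := by linarith
  set A := max a 0 with hA
  set B := max b 0 with hB
  have hA0 : 0 ≤ A := le_max_right _ _
  have hB0 : 0 ≤ B := le_max_right _ _
  rcases le_total b a with hab | hab
  · have hBA : 0 ≤ A - B := sub_nonneg.2 (max_le_max hab le_rfl)
    have ht : 0 ≤ a - b := sub_nonneg.2 hab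
    have hle : A - B ≤ a - b := by
      rcases max_cases a 0 with h | h <;> rcases max_cases b 0 with h' | h' <;>
        rw [hA, hB] <;> linarith
    have h1 : (A - B) ^ p ≤ (a - b) ^ (p - 1) * (A - B) := by
      calc (A - B) ^ p = (A - B) ^ (p - 1) * (A - B) := by
            rw [← Real.rpow_add_one' hBA (by linarith)]; ring_nf
        _ ≤ _ := by gcongr
    have h2 : A * max (-b) 0 ^ (p - 1) ≤ (a - b) ^ (p - 1) * (A - B) := by
      rcases le_or_gt 0 b with hb | hb
      · rw [max_eq_right (by linarith), Real.zero_rpow hp1.ne', mul_zero]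
        positivity
      · have hB' : B = 0 := max_eq_right hb.le
        rw [hB', sub_zero, mul_comm, max_eq_left (by linarith)]
        rcases le_or_gt a 0 with ha | ha
        · have : A = 0 := max_eq_right ha
          rw [this]; simp
        · gcongr
          · linarith
          · linarith
    rw [abs_of_nonneg hBA]
    calc _ ≤ Λ⁻¹ / 2 * ((a - b) ^ (p - 1) * (A - B) + (a - b) ^ (p - 1) * (A - B)) := by gcongr
      _ = (Λ⁻¹ * (a - b) ^ (p - 1)) * (A - B) := by ring
      _ ≤ _ := by gcongr; exact hΦ.lower hp ht
  · have hBA : 0 ≤ B - A := sub_nonneg.2 (max_le_max hab le_rfl)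
    have ht : 0 ≤ b - a := sub_nonneg.2 hab
    have hle : B - A ≤ b - a := by
      rcases max_cases a 0 with h | h <;> rcases max_cases b 0 with h' | h' <;>
        rw [hA, hB] <;> linarith
    have h1 : (B - A) ^ p ≤ (b - a) ^ (p - 1) * (B - A) := by
      calc (B - A) ^ p = (B - A) ^ (p - 1) * (B - A) := by
            rw [← Real.rpow_add_one' hBA (by linarith)]; ring_nf
        _ ≤ _ := by gcongr
    have h2 : A * max (-b) 0 ^ (p - 1) = 0 := by
      rcases le_or_gt 0 b with hb | hb
      · rw [max_eq_right (by linarith), Real.zero_rpow hp1.ne', mul_zero]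
      · rw [hA, max_eq_right (by linarith), zero_mul]
    have h3 := hΦ.reflect.lower hp ht
    rw [neg_sub] at h3
    rw [h2, add_zero, abs_sub_comm, abs_of_nonneg hBA]
    have h4 : 0 ≤ (b - a) ^ (p - 1) * (B - A) := by positivity
    calc Λ⁻¹ / 2 * (B - A) ^ p ≤ Λ⁻¹ / 2 * ((b - a) ^ (p - 1) * (B - A)) := by gcongr
      _ ≤ Λ⁻¹ * ((b - a) ^ (p - 1) * (B - A)) := by
        gcongr; exact half_le_self (by positivity)
      _ = (Λ⁻¹ * (b - a) ^ (p - 1)) * (B - A) := by ring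
      _ ≤ -Φ (a - b) * (B - A) := by gcongr
      _ = _ := by ring

lemma flux_tail_ge (hΦ : PhiBounds Λ p Φ) (hΛ : 1 ≤ Λ) (hp : 1 < p) (a b : ℝ) {e : ℝ}
    (he : 0 ≤ e) (he1 : e ≤ 1) :
    -(Λ * (max a 0 * max b 0 ^ (p - 1))) ≤ Φ (a - b) * (max a 0 * e) := by
  have hp1 : 0 < p - 1 := by linarith
  have hA0 : 0 ≤ max a 0 := le_max_right _ _
  have hB0 : 0 ≤ max b 0 := le_max_right _ _
  have hneg : -(Λ * (max a 0 * max b 0 ^ (p - 1))) ≤ 0 := neg_nonpos.2 (by positivity)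
  rcases le_total b a with hab | hab
  · exact hneg.trans (mul_nonneg (hΦ.nonneg hΛ (sub_nonneg.2 hab)) (by positivity))
  rcases le_or_gt a 0 with ha | ha
  · rw [max_eq_right ha]; simp
  have h1 : |Φ (a - b)| ≤ Λ * max b 0 ^ (p - 1) := by
    refine (hΦ.abs_le hΛ _).trans ?_
    rw [abs_sub_comm, abs_of_nonneg (sub_nonneg.2 hab)]
    gcongr
    linarith [le_max_left b 0]
  have h2 := (abs_le.1 h1).1
  have h3 : 0 ≤ max a 0 * e := by positivity
  have h4 : max a 0 * e ≤ max a 0 := mul_le_of_le_one_right hA0 he1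
  have h5 : 0 ≤ Λ * max b 0 ^ (p - 1) := by positivity
  calc _ = -(Λ * max b 0 ^ (p - 1)) * max a 0 := by ring
    _ ≤ -(Λ * max b 0 ^ (p - 1)) * (max a 0 * e) := by
      rw [neg_mul, neg_mul, neg_le_neg_iff]; gcongr
    _ ≤ _ := by gcongr

end pointwise

/-- The fractional De Giorgi class: Caccioppoli inequalities with tail for all truncations
`(f - k)₊` on balls contained in `Ω`. -/
def DeGiorgiClass (n : ℕ) (s p C : ℝ) (Ω : Set (Rn n)) (f : Rn n → ℝ) : Prop :=
  ∀ (z : Rn n) (k R₁ R₂ : ℝ), 0 < R₁ → R₁ < R₂ → ball z R₂ ⊆ Ω →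
    ∫⁻ x in ball z R₁, ∫⁻ y in ball z R₁, ENNReal.ofReal
      ((|max (f x - k) 0 - max (f y - k) 0| ^ p + max (f x - k) 0 * max (k - f y) 0 ^ (p - 1)) *
        ‖x - y‖ ^ (-((n : ℝ) + s * p))) ≤
    ENNReal.ofReal (C * (R₂ / (R₂ - R₁)) ^ ((n : ℝ) + p)) *
      (ENNReal.ofReal (R₂ ^ (-(s * p))) * (∫⁻ x in ball z R₂, ENNReal.ofReal (max (f x - k) 0 ^ p)) +
        (∫⁻ x in ball z R₂, ENNReal.ofReal (max (f x - k) 0)) *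
          ∫⁻ y in (ball z R₂)ᶜ, ENNReal.ofReal
            (max (f y - k) 0 ^ (p - 1) * ‖y - z‖ ^ (-((n : ℝ) + s * p))))

lemma lintegral_ofReal_le_of_integral_eq_zero {α : Type*} [MeasurableSpace α] {μ : Measure α}
    {f P N : α → ℝ} (hf : Integrable f μ) (hf0 : ∫ x, f x ∂μ = 0) (hP : Measurable P)
    (hP0 : ∀ x, 0 ≤ P x) (hN0 : ∀ x, 0 ≤ N x) (hle : ∀ x, P x - N x ≤ f x) :
    ∫⁻ x, ENNReal.ofReal (P x) ∂μ ≤ ∫⁻ x, ENNReal.ofReal (N x) ∂μ := by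
  have h1 := integral_eq_lintegral_pos_part_sub_lintegral_neg_part hf
  have hpos : ∫⁻ x, ENNReal.ofReal (f x) ∂μ ≠ ⊤ :=
    (lt_of_le_of_lt (lintegral_mono fun x => Real.ofReal_le_enorm (f x)) hf.2).ne
  have hneg : ∫⁻ x, ENNReal.ofReal (-f x) ∂μ ≠ ⊤ :=
    (lt_of_le_of_lt (lintegral_mono fun x => Real.ofReal_le_enorm (-f x)) hf.neg.2).ne
  rw [hf0, eq_comm, sub_eq_zero, ENNReal.toReal_eq_toReal_iff' hpos hneg] at h1
  have h2 : ∫⁻ x, ENNReal.ofReal (P x) ∂μ + ∫⁻ x, ENNReal.ofReal (-f x) ∂μ ≤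
      ∫⁻ x, ENNReal.ofReal (N x) ∂μ + ∫⁻ x, ENNReal.ofReal (f x) ∂μ := by
    rw [← lintegral_add_left (by fun_prop), ← lintegral_add_right' _ (by
      exact hf.aestronglyMeasurable.aemeasurable.ennreal_ofReal)]
    refine lintegral_mono fun x => ?_
    have h := hle x
    have hN := hN0 x
    rcases le_total 0 (f x) with hx | hx
    · rw [ENNReal.ofReal_of_nonpos (by linarith : -f x ≤ 0), add_zero, ← ENNReal.ofReal_add hN hx]
      exact ENNReal.ofReal_le_ofReal (by linarith)
    · rw [ENNReal.ofReal_of_nonpos hx, add_zero]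
      rw [← ENNReal.ofReal_add (hP0 x) (by linarith)]
      exact ENNReal.ofReal_le_ofReal (by linarith)
  rw [h1] at h2
  exact (ENNReal.add_le_add_iff_right hneg).1 h2

section caccioppoli

variable {n : ℕ} {s p Λ : ℝ} {Φ : ℝ → ℝ} {K : Rn n → Rn n → ℝ} {u : Rn n → ℝ} {Ω : Set (Rn n)}

/-- Contribution to the right-hand side of the Caccioppoli inequality of pairs in a ball. -/
def caccLocal (s p : ℝ) (w η : Rn n → ℝ) (B : Set (Rn n)) (x y : Rn n) : ℝ :=
  B.indicator (fun x => w x ^ p) x *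
    (B.indicator 1 y * (|η x - η y| ^ p * ‖x - y‖ ^ (-((n : ℝ) + s * p))))

/-- Contribution to the right-hand side of the Caccioppoli inequality of distant pairs. -/
def caccTail (s p : ℝ) (w : Rn n → ℝ) (B' B : Set (Rn n)) (x y : Rn n) : ℝ :=
  B'.indicator w x *
    (Bᶜ.indicator 1 y * (w y ^ (p - 1) * ‖x - y‖ ^ (-((n : ℝ) + s * p))))

lemma caccLocal_nonneg {w η : Rn n → ℝ} (hw : ∀ x, 0 ≤ w x) (B : Set (Rn n)) (x y : Rn n) :
    0 ≤ caccLocal s p w η B x y := by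
  have h1 : 0 ≤ B.indicator (fun x => w x ^ p) x :=
    indicator_nonneg (fun x _ => Real.rpow_nonneg (hw x) _) x
  have h2 : 0 ≤ B.indicator (1 : Rn n → ℝ) y := indicator_nonneg (fun _ _ => zero_le_one) y
  unfold caccLocal
  positivity

lemma caccTail_nonneg {w : Rn n → ℝ} (hw : ∀ x, 0 ≤ w x) (B' B : Set (Rn n)) (x y : Rn n) :
    0 ≤ caccTail s p w B' B x y := by
  have h1 : 0 ≤ B'.indicator w x := indicator_nonneg (fun x _ => hw x) x
  have h2 : 0 ≤ Bᶜ.indicator (1 : Rn n → ℝ) y := indicator_nonneg (fun _ _ => zero_le_one) y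
  have := hw y
  unfold caccTail
  positivity

lemma lintegral_caccLocal_le {C₀ : ℝ} (hs : 0 < s) (hp : 1 < p) (hC₀ : 1 ≤ C₀)
    (hC : ∀ (z : Rn n) (R : ℝ), 0 < R → ∫⁻ y in ball z R,
      ENNReal.ofReal (‖y - z‖ ^ (p - ((n : ℝ) + s * p))) ≤ ENNReal.ofReal (C₀ * R ^ (p - s * p)))
    {w : Rn n → ℝ} (hwm : Measurable w) (hw : ∀ x, 0 ≤ w x) {z : Rn n} {R₁ R₂ : ℝ} (hR₁ : 0 < R₁)
    (hR : R₁ < R₂) :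
    ∫⁻ q : Rn n × Rn n, ENNReal.ofReal
        (caccLocal s p w (radialCutoff z R₁ R₂) (ball z R₂) q.1 q.2) ≤
      ENNReal.ofReal (4 ^ p * C₀ * (R₂ / (R₂ - R₁)) ^ p * R₂ ^ (-(s * p))) *
        ∫⁻ x in ball z R₂, ENNReal.ofReal (w x ^ p) := by
  have hηm : Measurable (radialCutoff z R₁ R₂) := measurable_radialCutoff
  have hp0 : 0 < p := by linarith
  have hR2 : 0 < R₂ := hR₁.trans hR
  have hd : 0 < R₂ - R₁ := sub_pos.2 hR
  have hm1 : Measurable ((ball z R₂).indicator (fun x => w x ^ p)) :=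
    Measurable.indicator (by fun_prop) measurableSet_ball
  have hm2 : Measurable ((ball z R₂).indicator (1 : Rn n → ℝ)) :=
    Measurable.indicator measurable_one measurableSet_ball
  have hi1 : ∀ x, 0 ≤ (ball z R₂).indicator (fun x => w x ^ p) x := fun x =>
    indicator_nonneg (fun x _ => Real.rpow_nonneg (hw x) _) x
  unfold caccLocal
  rw [Measure.volume_eq_prod, lintegral_prod _ (by fun_prop)]
  rw [← lintegral_indicator measurableSet_ball, mul_comm (ENNReal.ofReal _), ← lintegral_mul_const' _ _ (by simp)]
  refine lintegral_mono fun x => ?_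
  dsimp only
  simp_rw [ENNReal.ofReal_mul (hi1 x)]
  rw [lintegral_const_mul' _ _ (by simp)]
  by_cases hx : x ∈ ball z R₂
  · rw [indicator_of_mem hx, indicator_of_mem hx]
    gcongr
    have hsub : ball z R₂ ⊆ ball x (2 * R₂) := by
      intro y hy
      rw [mem_ball] at hx hy ⊢
      linarith [dist_triangle_right y x z]
    calc _ ≤ ∫⁻ y in ball x (2 * R₂), ENNReal.ofReal ((2 / (R₂ - R₁)) ^ p) *
          ENNReal.ofReal (‖y - x‖ ^ (p - ((n : ℝ) + s * p))) := by
          rw [← lintegral_indicator measurableSet_ball]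
          refine lintegral_mono fun y => ?_
          by_cases hy : y ∈ ball z R₂
          · rw [indicator_of_mem (hsub hy), indicator_of_mem hy, Pi.one_apply, one_mul,
              ← ENNReal.ofReal_mul (by positivity)]
            refine ENNReal.ofReal_le_ofReal ?_
            rcases (norm_nonneg (y - x)).eq_or_lt with h0 | h0
            · have : y = x := by simpa [sub_eq_zero] using h0.symm
              subst this
              rw [sub_self, abs_zero, Real.zero_rpow hp0.ne', zero_mul]
              positivity
            · calc _ ≤ (2 / (R₂ - R₁) * ‖y - x‖) ^ p * ‖y - x‖ ^ (-((n : ℝ) + s * p)) := by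
                    rw [norm_sub_rev x y]
                    gcongr
                    rw [norm_sub_rev]
                    exact abs_radialCutoff_sub_le hR x y
                _ = _ := by
                  rw [Real.mul_rpow (by positivity) h0.le, mul_assoc, ← Real.rpow_add h0,
                    sub_eq_add_neg p]
          · rw [indicator_of_notMem hy]; simp
      _ ≤ ENNReal.ofReal ((2 / (R₂ - R₁)) ^ p) * ENNReal.ofReal (C₀ * (2 * R₂) ^ (p - s * p)) := by
          rw [lintegral_const_mul' _ _ (by simp)]
          gcongr
          exact hC x _ (by positivity)
      _ ≤ _ := by
          rw [← ENNReal.ofReal_mul (by positivity)]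
          refine ENNReal.ofReal_le_ofReal ?_
          have h2 : (2 : ℝ) ^ (p - s * p) ≤ 2 ^ p := by
            refine Real.rpow_le_rpow_of_exponent_le (by norm_num) ?_
            have : 0 ≤ s * p := by positivity
            linarith
          have h3 : R₂ ^ (p - s * p) = R₂ ^ p * R₂ ^ (-(s * p)) := by
            rw [← Real.rpow_add hR2, sub_eq_add_neg]
          have h4 : (4 : ℝ) ^ p = 2 ^ p * 2 ^ p := by
            rw [← Real.mul_rpow (by norm_num) (by norm_num)]; norm_num
          rw [Real.div_rpow (by norm_num) hd.le, Real.mul_rpow (by norm_num) hR2.le, h3, h4,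
            Real.div_rpow hR2.le hd.le]
          calc _ = (2 ^ p * C₀ * (R₂ ^ p / (R₂ - R₁) ^ p) * R₂ ^ (-(s * p))) * 2 ^ (p - s * p) := by
                ring
            _ ≤ (2 ^ p * C₀ * (R₂ ^ p / (R₂ - R₁) ^ p) * R₂ ^ (-(s * p))) * 2 ^ p := by gcongr
            _ = _ := by ring
  · simp [hx]

lemma lintegral_caccTail_le (hs : 0 < s) (hp : 1 < p)
    {w : Rn n → ℝ} (hwm : Measurable w) (hw : ∀ x, 0 ≤ w x) {z : Rn n} {R₁ R₂ : ℝ} (hR₁ : 0 < R₁)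
    (hR : R₁ < R₂) :
    ∫⁻ q : Rn n × Rn n, ENNReal.ofReal
        (caccTail s p w (ball z ((R₁ + R₂) / 2)) (ball z R₂) q.1 q.2) ≤
      ENNReal.ofReal ((2 * (R₂ / (R₂ - R₁))) ^ ((n : ℝ) + s * p)) *
        ((∫⁻ x in ball z R₂, ENNReal.ofReal (w x)) *
          ∫⁻ y in (ball z R₂)ᶜ, ENNReal.ofReal
            (w y ^ (p - 1) * ‖y - z‖ ^ (-((n : ℝ) + s * p)))) := by
  have hp0 : 0 < p := by linarith
  have hsp : 0 < s * p := by positivity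
  have hR2 : 0 < R₂ := hR₁.trans hR
  have hd : 0 < R₂ - R₁ := sub_pos.2 hR
  have hm1 : Measurable ((ball z ((R₁ + R₂) / 2)).indicator w) :=
    Measurable.indicator hwm measurableSet_ball
  have hm2 : Measurable ((ball z R₂)ᶜ.indicator (1 : Rn n → ℝ)) :=
    Measurable.indicator measurable_one measurableSet_ball.compl
  have hi1 : ∀ x, 0 ≤ (ball z ((R₁ + R₂) / 2)).indicator w x := fun x =>
    indicator_nonneg (fun x _ => hw x) x
  unfold caccTail
  rw [Measure.volume_eq_prod, lintegral_prod _ (by fun_prop)]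
  set T := ∫⁻ y in (ball z R₂)ᶜ, ENNReal.ofReal
            (w y ^ (p - 1) * ‖y - z‖ ^ (-((n : ℝ) + s * p))) with hT
  rw [mul_left_comm, ← lintegral_indicator measurableSet_ball]
  rw [← lintegral_mul_const _ (Measurable.indicator (by fun_prop) measurableSet_ball)]
  refine lintegral_mono fun x => ?_
  dsimp only
  simp_rw [ENNReal.ofReal_mul (hi1 x)]
  rw [lintegral_const_mul' _ _ (by simp)]
  by_cases hx : x ∈ ball z ((R₁ + R₂) / 2)
  · have hx2 : x ∈ ball z R₂ := ball_subset_ball (by linarith) hx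
    rw [indicator_of_mem hx, indicator_of_mem hx2]
    gcongr
    rw [hT, ← lintegral_const_mul' _ _ (by simp), ← lintegral_indicator measurableSet_ball.compl]
    refine lintegral_mono fun y => ?_
    by_cases hy : y ∈ (ball z R₂)ᶜ
    · rw [indicator_of_mem hy, indicator_of_mem hy, Pi.one_apply, one_mul,
        ← ENNReal.ofReal_mul (by positivity)]
      refine ENNReal.ofReal_le_ofReal ?_
      rw [mem_ball_iff_norm] at hx
      rw [mem_compl_iff, mem_ball_iff_norm, not_lt] at hy
      have h1 : ‖y - z‖ - ‖x - z‖ ≤ ‖x - y‖ := by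
        have := norm_sub_norm_le (y - z) (x - z)
        rwa [sub_sub_sub_cancel_right, norm_sub_rev y x] at this
      have hyz : 0 < ‖y - z‖ := hR2.trans_le hy
      have h2 : (2 * (R₂ / (R₂ - R₁)))⁻¹ * ‖y - z‖ ≤ ‖x - y‖ := by
        refine le_trans ?_ h1
        have e1 : (2 * (R₂ / (R₂ - R₁)))⁻¹ = (R₂ - R₁) / (2 * R₂) := by
          field_simp
        rw [e1, div_mul_eq_mul_div, div_le_iff₀ (by positivity)]
        nlinarith
      have h3 : ‖x - y‖ ^ (-((n : ℝ) + s * p)) ≤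
          (2 * (R₂ / (R₂ - R₁))) ^ ((n : ℝ) + s * p) * ‖y - z‖ ^ (-((n : ℝ) + s * p)) := by
        calc _ ≤ ((2 * (R₂ / (R₂ - R₁)))⁻¹ * ‖y - z‖) ^ (-((n : ℝ) + s * p)) :=
              Real.rpow_le_rpow_of_nonpos (by positivity) h2 (by
                have : (0 : ℝ) ≤ n := by positivity
                linarith)
          _ = _ := by
            rw [Real.mul_rpow (by positivity) hyz.le, Real.inv_rpow (by positivity),
              Real.rpow_neg (by positivity), inv_inv]
      have := hw y
      calc _ ≤ w y ^ (p - 1) * ((2 * (R₂ / (R₂ - R₁))) ^ ((n : ℝ) + s * p) *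
            ‖y - z‖ ^ (-((n : ℝ) + s * p))) := by gcongr
        _ = _ := by ring
    · rw [indicator_of_notMem hy]; simp
  · simp [hx]

/-- The energy density controlled by the Caccioppoli inequality. -/
def caccEnergy (s p k : ℝ) (u : Rn n → ℝ) (x y : Rn n) : ℝ :=
  (|max (u x - k) 0 - max (u y - k) 0| ^ p + max (u x - k) 0 * max (k - u y) 0 ^ (p - 1)) *
    ‖x - y‖ ^ (-((n : ℝ) + s * p))

lemma caccEnergy_nonneg (k : ℝ) (u : Rn n → ℝ) (x y : Rn n) : 0 ≤ caccEnergy s p k u x y := by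
  have h1 : 0 ≤ max (u x - k) 0 := le_max_right _ _
  have h2 : 0 ≤ max (k - u y) 0 := le_max_right _ _
  unfold caccEnergy
  positivity

lemma form_integrand_ge (hK : KernelBounds n Λ s p K) (hΦ : PhiBounds Λ p Φ) (hΛ : 1 ≤ Λ)
    (hs : 0 < s) (hp : 1 < p) (k : ℝ) {z : Rn n} {R₁ R₂ : ℝ} (hR : R₁ < R₂)
    (x y : Rn n) :
    (ball z R₁ ×ˢ ball z R₁).indicator
        (fun q => (Λ ^ 2)⁻¹ / 2 * caccEnergy s p k u q.1 q.2) (x, y) -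
      Λ ^ 2 * p ^ p * (
        caccLocal s p (fun x => max (u x - k) 0) (radialCutoff z R₁ R₂) (ball z R₂) x y +
        caccLocal s p (fun x => max (u x - k) 0) (radialCutoff z R₁ R₂) (ball z R₂) y x +
        caccTail s p (fun x => max (u x - k) 0) (ball z ((R₁ + R₂) / 2)) (ball z R₂) x y +
        caccTail s p (fun x => max (u x - k) 0) (ball z ((R₁ + R₂) / 2)) (ball z R₂) y x) ≤
      Φ (u x - u y) * K x y * (max (u x - k) 0 * radialCutoff z R₁ R₂ x ^ p -
        max (u y - k) 0 * radialCutoff z R₁ R₂ y ^ p) := by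
  have hp0 : 0 < p := by linarith
  have hsp : 0 < s * p := by positivity
  have hpp : 1 ≤ p ^ p := Real.one_le_rpow hp.le hp0.le
  have he : -((n : ℝ) + s * p) ≠ 0 := by
    have : (0 : ℝ) ≤ n := by positivity
    linarith
  have hw0 : ∀ x, 0 ≤ max (u x - k) 0 := fun x => le_max_right _ _
  have hL1 := caccLocal_nonneg (s := s) (p := p) (η := radialCutoff z R₁ R₂) hw0 (ball z R₂) x y
  have hL2 := caccLocal_nonneg (s := s) (p := p) (η := radialCutoff z R₁ R₂) hw0 (ball z R₂) y x
  have hT1 := caccTail_nonneg (s := s) (p := p) hw0 (ball z ((R₁ + R₂) / 2)) (ball z R₂) x y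
  have hT2 := caccTail_nonneg (s := s) (p := p) hw0 (ball z ((R₁ + R₂) / 2)) (ball z R₂) y x
  rcases eq_or_ne x y with rfl | hxy
  · have h1 : (ball z R₁ ×ˢ ball z R₁).indicator
        (fun q => (Λ ^ 2)⁻¹ / 2 * caccEnergy s p k u q.1 q.2) (x, x) = 0 := by
      by_cases hx : (x, x) ∈ ball z R₁ ×ˢ ball z R₁
      · rw [indicator_of_mem hx, caccEnergy, sub_self x, norm_zero, Real.zero_rpow he]; simp
      · exact indicator_of_notMem hx _
    rw [h1, zero_sub, sub_self (max (u x - k) 0 * _), mul_zero]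
    exact neg_nonpos.2 (by positivity)
  obtain ⟨hK1, hK2⟩ := hK.le_and_le hxy
  set kk := ‖x - y‖ ^ (-((n : ℝ) + s * p)) with hkk
  have hkk0 : 0 ≤ kk := by positivity
  have hkk' : ‖y - x‖ ^ (-((n : ℝ) + s * p)) = kk := by rw [norm_sub_rev]
  have hK0 : 0 ≤ K x y := le_trans (by positivity) hK1
  have hred : ∀ X Y : ℝ, -(Λ * p ^ p * Y) ≤ X → 0 ≤ Y → -(Λ ^ 2 * p ^ p * (Y * kk)) ≤ K x y * X := by
    intro X Y hXY hY
    have h1 : K x y * (Λ * p ^ p * Y) ≤ Λ * kk * (Λ * p ^ p * Y) := by gcongr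
    have h2 : K x y * (-(Λ * p ^ p * Y)) ≤ K x y * X := by gcongr
    linarith
  have hab : u x - u y = (u x - k) - (u y - k) := by ring
  rw [hab]
  have hex := radialCutoff_nonneg (z := z) (R₁ := R₁) (R₂ := R₂) x
  have hey := radialCutoff_nonneg (z := z) (R₁ := R₁) (R₂ := R₂) y
  have hcom : ∀ X, Φ (u x - k - (u y - k)) * K x y * X = K x y * (Φ (u x - k - (u y - k)) * X) :=
    fun X => by ring
  by_cases h11 : (x, y) ∈ ball z R₁ ×ˢ ball z R₁
  · rw [indicator_of_mem h11, radialCutoff_eq_one hR h11.1, radialCutoff_eq_one hR h11.2,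
      Real.one_rpow, mul_one, mul_one, hcom]
    refine (sub_le_self _ (by positivity)).trans ?_
    have h1 := flux_coercive hΦ hΛ hp (u x - k) (u y - k)
    rw [neg_sub] at h1
    dsimp only
    rw [caccEnergy]
    have hb := hw0 x
    have h2 : 0 ≤ max (k - u y) 0 := le_max_right _ _
    calc _ = Λ⁻¹ * kk * (Λ⁻¹ / 2 * (|max (u x - k) 0 - max (u y - k) 0| ^ p +
          max (u x - k) 0 * max (k - u y) 0 ^ (p - 1))) := by rw [hkk, ← inv_pow]; ring
      _ ≤ K x y * (Λ⁻¹ / 2 * (|max (u x - k) 0 - max (u y - k) 0| ^ p +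
          max (u x - k) 0 * max (k - u y) 0 ^ (p - 1))) := by gcongr
      _ ≤ _ := by gcongr
  rw [indicator_of_notMem h11, zero_sub, hcom]
  have hsub : ball z ((R₁ + R₂) / 2) ⊆ ball z R₂ := ball_subset_ball (by linarith)
  by_cases hx : x ∈ ball z R₂ <;> by_cases hy : y ∈ ball z R₂
  · have h := hred _ _ (flux_cutoff_ge hΦ hΛ hp (u x - k) (u y - k) hex hey) (by
      have := hw0 x
      have := hw0 y
      positivity)
    refine le_trans ?_ h
    rw [neg_le_neg_iff]
    gcongr
    have e1 : caccLocal s p (fun x => max (u x - k) 0) (radialCutoff z R₁ R₂) (ball z R₂) x y =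
        max (u x - k) 0 ^ p * (|radialCutoff z R₁ R₂ x - radialCutoff z R₁ R₂ y| ^ p * kk) := by
      simp [caccLocal, hx, hy, hkk]
    have e2 : caccLocal s p (fun x => max (u x - k) 0) (radialCutoff z R₁ R₂) (ball z R₂) y x =
        max (u y - k) 0 ^ p * (|radialCutoff z R₁ R₂ x - radialCutoff z R₁ R₂ y| ^ p * kk) := by
      rw [abs_sub_comm, caccLocal, hkk']
      simp [hx, hy]
    rw [e1, e2]
    linarith
  · have hy' : radialCutoff z R₁ R₂ y = 0 := radialCutoff_eq_zero hR fun h => hy (hsub h)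
    rw [hy', Real.zero_rpow hp0.ne', mul_zero, sub_zero]
    by_cases hxr : x ∈ ball z ((R₁ + R₂) / 2)
    · have e1 : caccTail s p (fun x => max (u x - k) 0) (ball z ((R₁ + R₂) / 2)) (ball z R₂) x y =
          max (u x - k) 0 * (max (u y - k) 0 ^ (p - 1) * kk) := by
        simp [caccTail, hxr, hy, hkk]
      have hY : 0 ≤ max (u x - k) 0 * max (u y - k) 0 ^ (p - 1) := by
        have := hw0 x
        have := hw0 y
        positivity
      have h1 := flux_tail_ge hΦ hΛ hp (u x - k) (u y - k) (e := radialCutoff z R₁ R₂ x ^ p)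
        (by positivity) (Real.rpow_le_one hex (radialCutoff_le_one x) hp0.le)
      have h := hred (Φ (u x - k - (u y - k)) * (max (u x - k) 0 * radialCutoff z R₁ R₂ x ^ p))
        (max (u x - k) 0 * max (u y - k) 0 ^ (p - 1)) (by
          refine le_trans ?_ h1
          rw [neg_le_neg_iff]
          gcongr
          exact le_mul_of_one_le_right (by positivity) hpp) hY
      refine le_trans ?_ h
      rw [neg_le_neg_iff]
      gcongr
      linarith
    · rw [radialCutoff_eq_zero hR hxr, Real.zero_rpow hp0.ne']
      simp only [mul_zero]
      exact neg_nonpos.2 (by positivity)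
  · have hx' : radialCutoff z R₁ R₂ x = 0 := radialCutoff_eq_zero hR fun h => hx (hsub h)
    rw [hx', Real.zero_rpow hp0.ne', mul_zero, zero_sub]
    by_cases hyr : y ∈ ball z ((R₁ + R₂) / 2)
    · have e1 : caccTail s p (fun x => max (u x - k) 0) (ball z ((R₁ + R₂) / 2)) (ball z R₂) y x =
          max (u y - k) 0 * (max (u x - k) 0 ^ (p - 1) * kk) := by
        rw [caccTail, hkk']
        simp [hyr, hx]
      have hY : 0 ≤ max (u y - k) 0 * max (u x - k) 0 ^ (p - 1) := by
        have := hw0 x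
        have := hw0 y
        positivity
      have h1 := flux_tail_ge hΦ.reflect hΛ hp (u y - k) (u x - k)
        (e := radialCutoff z R₁ R₂ y ^ p)
        (by positivity) (Real.rpow_le_one hey (radialCutoff_le_one y) hp0.le)
      rw [neg_sub, neg_mul, ← mul_neg (Φ _)] at h1
      have h := hred (Φ (u x - k - (u y - k)) * -(max (u y - k) 0 * radialCutoff z R₁ R₂ y ^ p))
        (max (u y - k) 0 * max (u x - k) 0 ^ (p - 1)) (by
          refine le_trans ?_ h1
          rw [neg_le_neg_iff]
          gcongr
          exact le_mul_of_one_le_right (by positivity) hpp) hY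
      refine le_trans ?_ h
      rw [neg_le_neg_iff]
      gcongr
      linarith
    · rw [radialCutoff_eq_zero hR hyr, Real.zero_rpow hp0.ne']
      simp only [mul_zero, neg_zero]
      exact neg_nonpos.2 (by positivity)
  · have hx' : radialCutoff z R₁ R₂ x = 0 := radialCutoff_eq_zero hR fun h => hx (hsub h)
    have hy' : radialCutoff z R₁ R₂ y = 0 := radialCutoff_eq_zero hR fun h => hy (hsub h)
    rw [hx', hy', Real.zero_rpow hp0.ne']
    simp only [mul_zero, sub_zero]
    exact neg_nonpos.2 (by positivity)

/-- Caccioppoli inequality with tail: solutions belong to a De Giorgi class. -/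
theorem exists_deGiorgiClass (hn : 2 ≤ n) (hs : 0 < s) (hs1 : s < 1) (hp : 1 < p) (hΛ : 1 ≤ Λ) :
    ∃ C : ℝ, 1 ≤ C ∧ ∀ (Φ : ℝ → ℝ) (K : Rn n → Rn n → ℝ) (Ω : Set (Rn n)) (u : Rn n → ℝ),
      KernelBounds n Λ s p K → PhiBounds Λ p Φ → IsOpen Ω → Measurable u →
      ∫⁻ x, ENNReal.ofReal (|u x| ^ p) < ⊤ → gagliardo n s p univ u < ⊤ →
      (∀ ψ, IsTestFun n Ω ψ → nonlocalForm n Φ K u ψ = 0) → DeGiorgiClass n s p C Ω u := by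
  obtain ⟨C₀, hC₀, hC₀k⟩ := exists_ball_kernel_bound hn hs1 hp
  have hp0 : 0 < p := by linarith
  have hsp : 0 < s * p := by positivity
  have hpp : 1 ≤ p ^ p := Real.one_le_rpow hp.le hp0.le
  refine ⟨2 * Λ ^ 2 * (Λ ^ 2 * p ^ p) * (2 * (4 ^ p * C₀ + 2 ^ ((n : ℝ) + p))), ?_, ?_⟩
  · have h1 : (1 : ℝ) ≤ 4 ^ p := Real.one_le_rpow (by norm_num) hp0.le
    have h2 : (0 : ℝ) ≤ 2 ^ ((n : ℝ) + p) := by positivity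
    have h3 : 1 ≤ Λ ^ 2 := one_le_pow₀ hΛ
    have h4 : 1 ≤ 4 ^ p * C₀ := one_le_mul_of_one_le_of_one_le h1 hC₀
    have h5 : 1 ≤ Λ ^ 2 * p ^ p := one_le_mul_of_one_le_of_one_le h3 hpp
    exact one_le_mul_of_one_le_of_one_le (one_le_mul_of_one_le_of_one_le (by linarith) h5)
      (by linarith)
  intro Φ K Ω u hK hΦ hΩ hum hu hgu hsol z k R₁ R₂ hR₁ hR hball
  have hR2 : 0 < R₂ := hR₁.trans hR
  have hd : 0 < R₂ - R₁ := sub_pos.2 hR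
  set w : Rn n → ℝ := fun x => max (u x - k) 0 with hw
  have hwm : Measurable w := by fun_prop
  have hw0 : ∀ x, 0 ≤ w x := fun x => le_max_right _ _
  set η := radialCutoff z R₁ R₂ with hη
  have hηm : Measurable η := measurable_radialCutoff
  have hζ1 : ∀ x, η x ^ p ≤ 1 := fun x =>
    Real.rpow_le_one (radialCutoff_nonneg x) (radialCutoff_le_one x) hp0.le
  have hζ0 : ∀ x, 0 ≤ η x ^ p := fun x => Real.rpow_nonneg (radialCutoff_nonneg x) _
  have hζs : ∀ x ∉ ball z ((R₁ + R₂) / 2), η x ^ p = 0 := fun x hx => by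
    rw [hη, radialCutoff_eq_zero hR hx, Real.zero_rpow hp0.ne']
  have hgφ : gagliardo n s p univ (fun x => max (u x - k) 0 * η x ^ p) < ⊤ :=
    gagliardo_pos_part_mul_lt_top hn hs hs1 hp hum hu hgu k (by fun_prop) hζ0 hζ1
      (L := p * (2 / (R₂ - R₁))) (by positivity) (abs_radialCutoff_rpow_sub_le hp.le hR) hζs
  have hφm : Measurable fun x => max (u x - k) 0 * η x ^ p := by fun_prop
  have hf := integrable_form hK hΦ hΛ hp hum hφm hgu hgφ
  have hf0 := form_eq_zero_of_gagliardo_lt_top hK hΦ hΛ hp hs hum hφm hgu hgφ hsol hΩ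
    (isCompact_closedBall z ((R₁ + R₂) / 2))
    ((closedBall_subset_ball (by linarith)).trans hball)
    (fun x hx => by
      rw [hζs x fun h => hx (ball_subset_closedBall h), mul_zero])
    (integrable_pos_part_mul hp hum hu k (by fun_prop) hζ0 hζ1 hζs)
  have hEm : Measurable (fun q : Rn n × Rn n => caccEnergy s p k u q.1 q.2) := by
    unfold caccEnergy; fun_prop
  have hmI : Measurable ((ball z R₂).indicator (fun x => w x ^ p)) :=
    Measurable.indicator (by fun_prop) measurableSet_ball
  have hm2 : Measurable ((ball z R₂).indicator (1 : Rn n → ℝ)) :=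
    Measurable.indicator measurable_one measurableSet_ball
  have hm3 : Measurable ((ball z ((R₁ + R₂) / 2)).indicator w) :=
    Measurable.indicator hwm measurableSet_ball
  have hm4 : Measurable ((ball z R₂)ᶜ.indicator (1 : Rn n → ℝ)) :=
    Measurable.indicator measurable_one measurableSet_ball.compl
  have hLm : Measurable (fun q : Rn n × Rn n => caccLocal s p w η (ball z R₂) q.1 q.2) := by
    unfold caccLocal; fun_prop
  have hTm : Measurable (fun q : Rn n × Rn n =>
      caccTail s p w (ball z ((R₁ + R₂) / 2)) (ball z R₂) q.1 q.2) := by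
    unfold caccTail; fun_prop
  have hL0 := caccLocal_nonneg (s := s) (p := p) (η := η) hw0 (ball z R₂)
  have hT0 := caccTail_nonneg (s := s) (p := p) hw0 (ball z ((R₁ + R₂) / 2)) (ball z R₂)
  have hmain := lintegral_ofReal_le_of_integral_eq_zero hf hf0
    (P := (ball z R₁ ×ˢ ball z R₁).indicator
        (fun q => (Λ ^ 2)⁻¹ / 2 * caccEnergy s p k u q.1 q.2))
    (N := fun q => Λ ^ 2 * p ^ p * (
        caccLocal s p w η (ball z R₂) q.1 q.2 +
        caccLocal s p w η (ball z R₂) q.2 q.1 +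
        caccTail s p w (ball z ((R₁ + R₂) / 2)) (ball z R₂) q.1 q.2 +
        caccTail s p w (ball z ((R₁ + R₂) / 2)) (ball z R₂) q.2 q.1))
    (Measurable.indicator (by fun_prop) (measurableSet_ball.prod measurableSet_ball))
    (indicator_nonneg fun q _ => mul_nonneg (by positivity) (caccEnergy_nonneg k u q.1 q.2))
    (fun q => by
      have := hL0 q.1 q.2
      have := hL0 q.2 q.1
      have := hT0 q.1 q.2
      have := hT0 q.2 q.1
      positivity)
    (fun q => form_integrand_ge hK hΦ hΛ hs hp k hR q.1 q.2)
  have hlhs : ∫⁻ q, ENNReal.ofReal ((ball z R₁ ×ˢ ball z R₁).indicator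
        (fun q => (Λ ^ 2)⁻¹ / 2 * caccEnergy s p k u q.1 q.2) q) =
      ENNReal.ofReal ((Λ ^ 2)⁻¹ / 2) * ∫⁻ x in ball z R₁, ∫⁻ y in ball z R₁,
        ENNReal.ofReal (caccEnergy s p k u x y) := by
    rw [← lintegral_const_mul' _ _ (by simp), Measure.volume_eq_prod]
    have h1 : ∀ q, ENNReal.ofReal ((ball z R₁ ×ˢ ball z R₁).indicator
        (fun q => (Λ ^ 2)⁻¹ / 2 * caccEnergy s p k u q.1 q.2) q) =
        (ball z R₁ ×ˢ ball z R₁).indicator (fun q => ENNReal.ofReal ((Λ ^ 2)⁻¹ / 2) *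
          ENNReal.ofReal (caccEnergy s p k u q.1 q.2)) q := by
      intro q
      by_cases hq : q ∈ ball z R₁ ×ˢ ball z R₁
      · rw [indicator_of_mem hq, indicator_of_mem hq, ENNReal.ofReal_mul (by positivity)]
      · rw [indicator_of_notMem hq, indicator_of_notMem hq, ENNReal.ofReal_zero]
    simp_rw [h1]
    rw [lintegral_indicator (measurableSet_ball.prod measurableSet_ball), ← Measure.prod_restrict,
      lintegral_prod _ (by fun_prop)]
    refine lintegral_congr fun x => ?_
    rw [lintegral_const_mul' _ _ (by simp)]
  rw [hlhs] at hmain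
  set IL := ∫⁻ q : Rn n × Rn n, ENNReal.ofReal (caccLocal s p w η (ball z R₂) q.1 q.2) with hIL
  set IT := ∫⁻ q : Rn n × Rn n, ENNReal.ofReal
    (caccTail s p w (ball z ((R₁ + R₂) / 2)) (ball z R₂) q.1 q.2) with hIT
  have hrhs : ∫⁻ q : Rn n × Rn n, ENNReal.ofReal (Λ ^ 2 * p ^ p * (
        caccLocal s p w η (ball z R₂) q.1 q.2 +
        caccLocal s p w η (ball z R₂) q.2 q.1 +
        caccTail s p w (ball z ((R₁ + R₂) / 2)) (ball z R₂) q.1 q.2 +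
        caccTail s p w (ball z ((R₁ + R₂) / 2)) (ball z R₂) q.2 q.1)) =
      ENNReal.ofReal (Λ ^ 2 * p ^ p) * (2 * (IL + IT)) := by
    have h1 : ∀ q : Rn n × Rn n, ENNReal.ofReal (Λ ^ 2 * p ^ p * (
        caccLocal s p w η (ball z R₂) q.1 q.2 +
        caccLocal s p w η (ball z R₂) q.2 q.1 +
        caccTail s p w (ball z ((R₁ + R₂) / 2)) (ball z R₂) q.1 q.2 +
        caccTail s p w (ball z ((R₁ + R₂) / 2)) (ball z R₂) q.2 q.1)) =
        ENNReal.ofReal (Λ ^ 2 * p ^ p) * (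
        ENNReal.ofReal (caccLocal s p w η (ball z R₂) q.1 q.2) +
        ENNReal.ofReal (caccLocal s p w η (ball z R₂) q.2 q.1) +
        ENNReal.ofReal (caccTail s p w (ball z ((R₁ + R₂) / 2)) (ball z R₂) q.1 q.2) +
        ENNReal.ofReal (caccTail s p w (ball z ((R₁ + R₂) / 2)) (ball z R₂) q.2 q.1)) := by
      intro q
      have h1 := hL0 q.1 q.2
      have h2 := hL0 q.2 q.1
      have h3 := hT0 q.1 q.2
      have h4 := hT0 q.2 q.1
      rw [ENNReal.ofReal_mul (by positivity), ENNReal.ofReal_add (by positivity) h4,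
        ENNReal.ofReal_add (by positivity) h3, ENNReal.ofReal_add h1 h2]
    have hswap : ∀ F : Rn n × Rn n → ℝ≥0∞, Measurable F →
        ∫⁻ q : Rn n × Rn n, F (q.2, q.1) = ∫⁻ q, F q := fun F hF =>
      (Measure.measurePreserving_swap (μ := (volume : Measure (Rn n)))
        (ν := (volume : Measure (Rn n)))).lintegral_comp hF
    have hLs := hswap (fun q => ENNReal.ofReal (caccLocal s p w η (ball z R₂) q.1 q.2))
      (by fun_prop)
    have hTs := hswap (fun q => ENNReal.ofReal
      (caccTail s p w (ball z ((R₁ + R₂) / 2)) (ball z R₂) q.1 q.2)) (by fun_prop)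
    simp_rw [h1]
    have hLm' := hLm.comp measurable_swap
    have hTm' := hTm.comp measurable_swap
    simp only [Function.comp_def, Prod.fst_swap, Prod.snd_swap] at hLm' hTm'
    rw [lintegral_const_mul' _ _ (by simp), lintegral_add_left (by fun_prop),
      lintegral_add_left (by fun_prop), lintegral_add_left (by fun_prop)]
    simp only at hLs hTs
    rw [hLs, hTs]
    ring
  rw [hrhs] at hmain
  have hbL := lintegral_caccLocal_le hs hp hC₀ hC₀k hwm hw0 hR₁ hR (z := z)
  have hbT := lintegral_caccTail_le hs hp hwm hw0 hR₁ hR (z := z)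
  have hD : 1 ≤ R₂ / (R₂ - R₁) := by
    rw [one_le_div hd]; linarith
  set D := R₂ / (R₂ - R₁) with hDdef
  have hn0 : (0 : ℝ) ≤ n := by positivity
  set S1 := ENNReal.ofReal (R₂ ^ (-(s * p))) * ∫⁻ x in ball z R₂, ENNReal.ofReal (w x ^ p) with hS1
  set S2 := (∫⁻ x in ball z R₂, ENNReal.ofReal (w x)) *
          ∫⁻ y in (ball z R₂)ᶜ, ENNReal.ofReal
            (w y ^ (p - 1) * ‖y - z‖ ^ (-((n : ℝ) + s * p))) with hS2
  have hb : IL + IT ≤ ENNReal.ofReal ((4 ^ p * C₀ + 2 ^ ((n : ℝ) + p)) * D ^ ((n : ℝ) + p)) *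
      (S1 + S2) := by
    have hb1 : IL ≤ ENNReal.ofReal ((4 ^ p * C₀ + 2 ^ ((n : ℝ) + p)) * D ^ ((n : ℝ) + p)) * S1 := by
      refine hbL.trans ?_
      rw [hS1, ← mul_assoc, ← ENNReal.ofReal_mul (by positivity)]
      gcongr ENNReal.ofReal (?_ * _) * _
      have : D ^ p ≤ D ^ ((n : ℝ) + p) := Real.rpow_le_rpow_of_exponent_le hD (by linarith)
      gcongr
      exact le_add_of_nonneg_right (by positivity)
    have hb2 : IT ≤ ENNReal.ofReal ((4 ^ p * C₀ + 2 ^ ((n : ℝ) + p)) * D ^ ((n : ℝ) + p)) * S2 := by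
      refine hbT.trans ?_
      gcongr ENNReal.ofReal ?_ * _
      calc (2 * D) ^ ((n : ℝ) + s * p) ≤ (2 * D) ^ ((n : ℝ) + p) := by
            refine Real.rpow_le_rpow_of_exponent_le (by linarith) ?_
            have : s * p ≤ 1 * p := by gcongr
            linarith
        _ = 2 ^ ((n : ℝ) + p) * D ^ ((n : ℝ) + p) := Real.mul_rpow (by norm_num) (by linarith)
        _ ≤ _ := by
          gcongr
          exact le_add_of_nonneg_left (by positivity)
    rw [mul_add]
    exact add_le_add hb1 hb2
  have hΛ2 : 0 < Λ ^ 2 := by positivity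
  have hfin : ∫⁻ x in ball z R₁, ∫⁻ y in ball z R₁, ENNReal.ofReal (caccEnergy s p k u x y) =
      ENNReal.ofReal (2 * Λ ^ 2) * (ENNReal.ofReal ((Λ ^ 2)⁻¹ / 2) *
        ∫⁻ x in ball z R₁, ∫⁻ y in ball z R₁, ENNReal.ofReal (caccEnergy s p k u x y)) := by
    rw [← mul_assoc, ← ENNReal.ofReal_mul (by positivity)]
    have : 2 * Λ ^ 2 * ((Λ ^ 2)⁻¹ / 2) = 1 := by field_simp
    rw [this, ENNReal.ofReal_one, one_mul]
  change ∫⁻ x in ball z R₁, ∫⁻ y in ball z R₁, ENNReal.ofReal (caccEnergy s p k u x y) ≤ _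
  rw [hfin]
  calc _ ≤ ENNReal.ofReal (2 * Λ ^ 2) * (ENNReal.ofReal (Λ ^ 2 * p ^ p) * (2 *
      (ENNReal.ofReal ((4 ^ p * C₀ + 2 ^ ((n : ℝ) + p)) * D ^ ((n : ℝ) + p)) * (S1 + S2)))) := by
        gcongr ENNReal.ofReal _ * ?_
        exact hmain.trans (by gcongr)
    _ = _ := by
      have h2 : (2 : ℝ≥0∞) = ENNReal.ofReal 2 := by simp
      rw [h2, ← mul_assoc, ← mul_assoc, ← mul_assoc, ← ENNReal.ofReal_mul (by positivity),
        ← ENNReal.ofReal_mul (by positivity), ← ENNReal.ofReal_mul (by positivity)]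
      congr 2
      ring

end caccioppoli

section iteration

variable {n : ℕ} {s p : ℝ}

/-- Fractional Faber–Krahn inequality on balls. -/
lemma exists_faberKrahn (hn : 2 ≤ n) (hs : 0 < s) (hp : 1 < p) : ∃ C : ℝ, 1 ≤ C ∧
    ∀ (w : Rn n → ℝ) (z : Rn n) (R₁ R₂ m : ℝ), Measurable w → (∀ x, 0 ≤ w x) → 0 < R₁ → R₁ < R₂ →
      0 < m → volume ({x | 0 < w x} ∩ ball z R₂) ≤ ENNReal.ofReal m →
      ∫⁻ x in ball z R₁, ENNReal.ofReal (w x ^ p) ≤ ENNReal.ofReal (C * m ^ (s * p / n)) *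
        ((∫⁻ x in ball z R₂, ∫⁻ y in ball z R₂, ENNReal.ofReal
            (|w x - w y| ^ p * ‖x - y‖ ^ (-((n : ℝ) + s * p)))) +
          ENNReal.ofReal ((R₂ - R₁) ^ (-(s * p))) *
            ∫⁻ x in ball z R₂, ENNReal.ofReal (w x ^ p)) := by
  have hp0 : 0 < p := by linarith
  have hsp : 0 < s * p := by positivity
  have hn0 : (0 : ℝ) < n := by positivity
  set ω := (volume (ball (0 : Rn n) 1)).toReal with hω
  have hω0 : 0 < ω := unit_ball_pos n
  have hC0 : 0 < (2 / ω) ^ (1 + s * p / n) := by positivity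
  have hC1 : 0 < (2 / ω) ^ (s * p / n) := by positivity
  refine ⟨(2 / ω) ^ (1 + s * p / n) + (2 / ω) ^ (s * p / n) + 1, by linarith, ?_⟩
  intro w z R₁ R₂ m hwm hw hR₁ hR hm hvol
  have hd : 0 < R₂ - R₁ := sub_pos.2 hR
  set r := (2 * m / ω) ^ (1 / (n : ℝ)) with hr
  have hr0 : 0 < r := by positivity
  have hrn : r ^ (n : ℝ) = 2 * m / ω := by
    rw [hr, ← Real.rpow_mul (by positivity), one_div_mul_cancel hn0.ne', Real.rpow_one]
  have hrsp : r ^ (s * p) = (2 * m / ω) ^ (s * p / n) := by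
    rw [hr, ← Real.rpow_mul (by positivity)]; congr 1; ring
  have hm2 : (2 * m / ω) ^ (s * p / n) = (2 / ω) ^ (s * p / n) * m ^ (s * p / n) := by
    rw [← Real.mul_rpow (by positivity) hm.le]; congr 1; ring
  set C := (2 / ω) ^ (1 + s * p / n) + (2 / ω) ^ (s * p / n) + 1 with hC
  rcases le_or_gt r (R₂ - R₁) with hrR | hrR
  · refine le_trans ?_ (mul_le_mul_right le_self_add _)
    rw [← lintegral_const_mul' _ _ (by simp)]
    refine le_trans ?_ (lintegral_mono_set (ball_subset_ball hR.le))
    refine setLIntegral_mono' measurableSet_ball fun x hx => ?_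
    rcases (hw x).eq_or_lt with h0 | h0
    · rw [← h0, Real.zero_rpow hp0.ne', ENNReal.ofReal_zero]; exact zero_le
    have hsub : ball x r ⊆ ball z R₂ := by
      intro y hy
      rw [mem_ball] at hx hy ⊢
      linarith [dist_triangle y x z]
    set A := ball x r \ ({x | 0 < w x} ∩ ball z R₂) with hA
    have hAm : MeasurableSet A := measurableSet_ball.diff
      ((measurableSet_lt measurable_const hwm).inter measurableSet_ball)
    have hvA : ENNReal.ofReal m ≤ volume A := by
      have h1 := le_measure_sdiff (μ := (volume : Measure (Rn n)))
        (s₁ := ball x r) (s₂ := {x | 0 < w x} ∩ ball z R₂)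
      refine le_trans ?_ h1
      rw [volume_ball_eq hn x hr0, hrn, ← hω, div_mul_cancel₀ _ hω0.ne']
      refine ENNReal.le_sub_of_add_le_right (by finiteness) ?_
      rw [two_mul, ENNReal.ofReal_add hm.le hm.le]
      gcongr
    have hlow : ENNReal.ofReal (w x ^ p * r ^ (-((n : ℝ) + s * p))) * ENNReal.ofReal m ≤
        ∫⁻ y in ball z R₂, ENNReal.ofReal
            (|w x - w y| ^ p * ‖x - y‖ ^ (-((n : ℝ) + s * p))) := by
      calc _ ≤ ENNReal.ofReal (w x ^ p * r ^ (-((n : ℝ) + s * p))) * volume A := by gcongr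
        _ = ∫⁻ y in A, ENNReal.ofReal (w x ^ p * r ^ (-((n : ℝ) + s * p))) := by
          rw [setLIntegral_const]
        _ ≤ ∫⁻ y in A, ENNReal.ofReal
            (|w x - w y| ^ p * ‖x - y‖ ^ (-((n : ℝ) + s * p))) := by
          refine setLIntegral_mono' hAm fun y hy => ENNReal.ofReal_le_ofReal ?_
          have hy0 : w y = 0 := by
            by_contra hne
            exact hy.2 ⟨(hw y).lt_of_ne' hne, hsub hy.1⟩
          rw [hy0, sub_zero, abs_of_pos h0]
          gcongr ?_ * ?_
          refine Real.rpow_le_rpow_of_nonpos ?_ ?_ (by linarith)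
          · refine norm_pos_iff.2 (sub_ne_zero.2 fun h => ?_)
            rw [h, hy0] at h0; exact lt_irrefl _ h0
          · have := hy.1
            rw [mem_ball_iff_norm'] at this
            exact this.le
        _ ≤ _ := lintegral_mono_set (sdiff_subset.trans hsub)
    refine le_trans ?_ (mul_le_mul_right hlow _)
    rw [← ENNReal.ofReal_mul (by positivity), ← ENNReal.ofReal_mul (by positivity)]
    refine ENNReal.ofReal_le_ofReal ?_
    have h1 : r ^ (-((n : ℝ) + s * p)) * ((2 / ω) ^ (1 + s * p / n) * m ^ (s * p / n)) * m = 1 := by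
      rw [Real.rpow_neg hr0.le, Real.rpow_add hr0, hrn, hrsp, hm2, Real.rpow_add (by positivity),
        Real.rpow_one]
      field_simp
    have hwp : 0 ≤ w x ^ p := by positivity
    calc w x ^ p = w x ^ p *
          (r ^ (-((n : ℝ) + s * p)) * ((2 / ω) ^ (1 + s * p / n) * m ^ (s * p / n)) * m) := by
          rw [h1, mul_one]
      _ = (2 / ω) ^ (1 + s * p / n) * m ^ (s * p / n) *
          (w x ^ p * r ^ (-((n : ℝ) + s * p)) * m) := by ring
      _ ≤ C * m ^ (s * p / n) * (w x ^ p * r ^ (-((n : ℝ) + s * p)) * m) := by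
          gcongr; linarith
  · refine le_trans ?_ (mul_le_mul_right le_add_self _)
    rw [← mul_assoc, ← ENNReal.ofReal_mul (by positivity)]
    calc _ ≤ 1 * ∫⁻ x in ball z R₂, ENNReal.ofReal (w x ^ p) := by
          rw [one_mul]; exact lintegral_mono_set (ball_subset_ball hR.le)
      _ ≤ _ := by
        gcongr
        rw [← ENNReal.ofReal_one]
        refine ENNReal.ofReal_le_ofReal ?_
        have h1 : 1 = (R₂ - R₁) ^ (s * p) * (R₂ - R₁) ^ (-(s * p)) := by
          rw [← Real.rpow_add hd, add_neg_cancel, Real.rpow_zero]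
        rw [h1]
        gcongr
        calc (R₂ - R₁) ^ (s * p) ≤ r ^ (s * p) := by gcongr
          _ = (2 / ω) ^ (s * p / n) * m ^ (s * p / n) := by rw [hrsp, hm2]
          _ ≤ _ := by gcongr; linarith

/-- One step of the De Giorgi iteration. -/
lemma exists_deGiorgi_step (hn : 2 ≤ n) (hs : 0 < s) (hs1 : s < 1) (hp : 1 < p) {C₀ : ℝ}
    (hC₀ : 1 ≤ C₀) : ∃ C : ℝ, 1 ≤ C ∧
    ∀ (Ω : Set (Rn n)) (f : Rn n → ℝ) (z : Rn n) (k h R₁ R₂ a T : ℝ), Measurable f →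
      DeGiorgiClass n s p C₀ Ω f → 0 < R₁ → R₁ < R₂ → ball z R₂ ⊆ Ω → 0 < h → 0 < a → 0 ≤ T →
      ∫⁻ x in ball z R₂, ENNReal.ofReal (max (f x - k) 0 ^ p) ≤ ENNReal.ofReal a →
      ∫⁻ y in (ball z R₂)ᶜ, ENNReal.ofReal
        (max (f y - k) 0 ^ (p - 1) * ‖y - z‖ ^ (-((n : ℝ) + s * p))) ≤ ENNReal.ofReal T →
      ∫⁻ x in ball z R₁, ENNReal.ofReal (max (f x - (k + h)) 0 ^ p) ≤
        ENNReal.ofReal (C * (a / h ^ p) ^ (s * p / n) * (R₂ / (R₂ - R₁)) ^ ((n : ℝ) + p) *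
          (R₂ ^ (-(s * p)) + h ^ (1 - p) * T) * a) := by
  have hp0 : 0 < p := by linarith
  have hsp : 0 < s * p := by positivity
  have hn0 : (0 : ℝ) < n := by positivity
  obtain ⟨C₁, hC₁, hFK⟩ := exists_faberKrahn hn hs hp
  refine ⟨C₁ * ((C₀ + 1) * 2 ^ ((n : ℝ) + p)), ?_, ?_⟩
  · have : (1 : ℝ) ≤ 2 ^ ((n : ℝ) + p) := Real.one_le_rpow (by norm_num) (by positivity)
    exact one_le_mul_of_one_le_of_one_le hC₁ (one_le_mul_of_one_le_of_one_le (by linarith) this)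
  intro Ω f z k h R₁ R₂ a T hfm hf hR₁ hR hball hh ha hT hY htail
  have hR2 : 0 < R₂ := hR₁.trans hR
  have hd : 0 < R₂ - R₁ := sub_pos.2 hR
  set Rm := (R₁ + R₂) / 2 with hRm
  have hRm1 : R₁ < Rm := by rw [hRm]; linarith
  have hRm2 : Rm < R₂ := by rw [hRm]; linarith
  have hRm0 : 0 < Rm := hR₁.trans hRm1
  set D := R₂ / (R₂ - R₁) with hD
  have hD1 : 1 ≤ D := by rw [hD, one_le_div hd]; linarith
  have hD2 : R₂ / (R₂ - Rm) = 2 * D := by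
    have : R₂ - Rm = (R₂ - R₁) / 2 := by rw [hRm]; ring
    rw [this, hD]; field_simp
  have hm1 : ∀ x, max (f x - (k + h)) 0 ≤ max (f x - k) 0 := fun x =>
    max_le_max (by linarith) le_rfl
  have hm0 : ∀ x, 0 ≤ max (f x - (k + h)) 0 := fun x => le_max_right _ _
  have hm2 : ∀ x, max (f x - (k + h)) 0 ≤ h ^ (1 - p) * max (f x - k) 0 ^ p := by
    intro x
    rcases le_or_gt (f x) (k + h) with hx | hx
    · rw [max_eq_right (by linarith)]
      have : 0 ≤ max (f x - k) 0 := le_max_right _ _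
      positivity
    · have h1 : max (f x - k) 0 = f x - k := max_eq_left (by linarith)
      rw [h1]
      have h2 : 0 < f x - k := by linarith
      have h3 : (f x - k) ^ p = (f x - k) ^ (p - 1) * (f x - k) := by
        rw [← Real.rpow_add_one h2.ne']; ring_nf
      have h4 : 1 ≤ h ^ (1 - p) * (f x - k) ^ (p - 1) := by
        have e : 1 = h ^ (1 - p) * h ^ (p - 1) := by
          rw [← Real.rpow_add hh]; simp
        calc 1 = h ^ (1 - p) * h ^ (p - 1) := e
          _ ≤ h ^ (1 - p) * (f x - k) ^ (p - 1) := by gcongr; linarith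
      refine (hm1 x).trans ?_
      rw [h1, h3, ← mul_assoc]
      exact le_mul_of_one_le_left h2.le h4
  have hm3 : ∀ x, max (f x - (k + h)) 0 ^ p ≤ max (f x - k) 0 ^ p := fun x => by
    have := hm0 x
    have := hm1 x
    gcongr
  have hI1 : ∫⁻ x in ball z R₂, ENNReal.ofReal (max (f x - (k + h)) 0 ^ p) ≤ ENNReal.ofReal a :=
    (lintegral_mono fun x => ENNReal.ofReal_le_ofReal (hm3 x)).trans hY
  have hI2 : ∫⁻ x in ball z R₂, ENNReal.ofReal (max (f x - (k + h)) 0) ≤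
      ENNReal.ofReal (h ^ (1 - p) * a) := by
    rw [ENNReal.ofReal_mul (by positivity)]
    refine le_trans ?_ (mul_le_mul_right hY _)
    rw [← lintegral_const_mul' _ _ (by simp)]
    refine lintegral_mono fun x => ?_
    rw [← ENNReal.ofReal_mul (by positivity)]
    exact ENNReal.ofReal_le_ofReal (hm2 x)
  have hI3 : ∫⁻ y in (ball z R₂)ᶜ, ENNReal.ofReal
        (max (f y - (k + h)) 0 ^ (p - 1) * ‖y - z‖ ^ (-((n : ℝ) + s * p))) ≤ ENNReal.ofReal T := by
    refine le_trans (lintegral_mono fun y => ENNReal.ofReal_le_ofReal ?_) htail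
    have := hm0 y
    have := hm1 y
    gcongr
  have hDG := hf z (k + h) Rm R₂ hRm0 hRm2 hball
  rw [hD2] at hDG
  have hvol : volume ({x | 0 < max (f x - (k + h)) 0} ∩ ball z Rm) ≤ ENNReal.ofReal (a / h ^ p) := by
    rw [ENNReal.ofReal_div_of_pos (by positivity),
      ENNReal.le_div_iff_mul_le (Or.inl (by simp; positivity)) (Or.inl (by simp)), mul_comm]
    have hms : MeasurableSet ({x | 0 < max (f x - (k + h)) 0} ∩ ball z Rm) :=
      (measurableSet_lt measurable_const (by fun_prop)).inter measurableSet_ball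
    calc _ = ∫⁻ x in {x | 0 < max (f x - (k + h)) 0} ∩ ball z Rm, ENNReal.ofReal (h ^ p) := by
          rw [setLIntegral_const]
      _ ≤ ∫⁻ x in {x | 0 < max (f x - (k + h)) 0} ∩ ball z Rm,
          ENNReal.ofReal (max (f x - k) 0 ^ p) := by
          refine setLIntegral_mono' hms fun x hx => ENNReal.ofReal_le_ofReal ?_
          have h1 : 0 < f x - (k + h) := by simpa using hx.1
          gcongr
          exact le_max_of_le_left (by linarith)
      _ ≤ ∫⁻ x in ball z R₂, ENNReal.ofReal (max (f x - k) 0 ^ p) :=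
          lintegral_mono_set (inter_subset_right.trans (ball_subset_ball hRm2.le))
      _ ≤ _ := hY
  have hfk := hFK (fun x => max (f x - (k + h)) 0) z R₁ Rm (a / h ^ p) (by fun_prop) hm0 hR₁ hRm1
    (by positivity) hvol
  refine hfk.trans ?_
  set P := 2 ^ ((n : ℝ) + p) * D ^ ((n : ℝ) + p) with hP
  have hP' : (2 * D) ^ ((n : ℝ) + p) = P := Real.mul_rpow (by norm_num) (by linarith)
  have hb1 : ∫⁻ x in ball z Rm, ∫⁻ y in ball z Rm, ENNReal.ofReal
      (|max (f x - (k + h)) 0 - max (f y - (k + h)) 0| ^ p * ‖x - y‖ ^ (-((n : ℝ) + s * p))) ≤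
      ENNReal.ofReal (C₀ * P * (R₂ ^ (-(s * p)) + h ^ (1 - p) * T) * a) := by
    refine le_trans (lintegral_mono fun x => lintegral_mono fun y => ?_) (hDG.trans ?_)
    · refine ENNReal.ofReal_le_ofReal (mul_le_mul_of_nonneg_right ?_ (by positivity))
      have := hm0 x
      have h2 : 0 ≤ max (k + h - f y) 0 := le_max_right _ _
      exact le_add_of_nonneg_right (by positivity)
    · rw [hP', mul_assoc (C₀ * P), ENNReal.ofReal_mul (p := C₀ * P) (by positivity)]
      refine mul_le_mul_right ?_ _
      calc _ ≤ ENNReal.ofReal (R₂ ^ (-(s * p))) * ENNReal.ofReal a +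
            ENNReal.ofReal (h ^ (1 - p) * a) * ENNReal.ofReal T := by gcongr
        _ = _ := by
          rw [← ENNReal.ofReal_mul (by positivity), ← ENNReal.ofReal_mul (by positivity),
            ← ENNReal.ofReal_add (by positivity) (by positivity)]
          congr 1; ring
  have hb2 : ENNReal.ofReal ((Rm - R₁) ^ (-(s * p))) *
      ∫⁻ x in ball z Rm, ENNReal.ofReal (max (f x - (k + h)) 0 ^ p) ≤
      ENNReal.ofReal (P * (R₂ ^ (-(s * p)) + h ^ (1 - p) * T) * a) := by
    rw [ENNReal.ofReal_mul (by positivity)]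
    gcongr ENNReal.ofReal ?_ * ?_
    · have h1 : Rm - R₁ = (2 * D)⁻¹ * R₂ := by
        rw [hRm, hD]; field_simp; ring
      rw [h1, Real.mul_rpow (by positivity) hR2.le, Real.inv_rpow (by positivity),
        Real.rpow_neg (by positivity : 0 ≤ 2 * D), inv_inv, ← hP']
      gcongr ?_ * ?_
      · refine Real.rpow_le_rpow_of_exponent_le (by linarith) ?_
        have : s * p ≤ 1 * p := by gcongr
        linarith
      · exact le_add_of_nonneg_right (by positivity)
    · exact (lintegral_mono_set (ball_subset_ball hRm2.le)).trans hI1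
  calc _ ≤ ENNReal.ofReal (C₁ * (a / h ^ p) ^ (s * p / n)) *
        (ENNReal.ofReal (C₀ * P * (R₂ ^ (-(s * p)) + h ^ (1 - p) * T) * a) +
          ENNReal.ofReal (P * (R₂ ^ (-(s * p)) + h ^ (1 - p) * T) * a)) := by gcongr
    _ = _ := by
      rw [← ENNReal.ofReal_add (by positivity) (by positivity), ← ENNReal.ofReal_mul (by positivity)]
      congr 1; rw [hP]; ring

end iteration

section supremum

variable {n : ℕ} {s p : ℝ}

/-- The scalar estimate behind the De Giorgi iteration. -/
lemma exists_iteration_constants {N s p C τ : ℝ} (hN : 0 < N) (hs : 0 < s) (hs1 : s < 1)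
    (hp : 1 < p) (hC : 1 ≤ C) (hτ : 0 ≤ τ) : ∃ ν q : ℝ, 0 < ν ∧ 0 < q ∧ q < 1 ∧
    ∀ (R k : ℝ) (j : ℕ), 0 < R → 0 < k →
      C * (ν * k ^ p * R ^ N * q ^ j / (k * (1 / 2) ^ j / 2) ^ p) ^ (s * p / N) *
        (R / 2 * (1 + (1 / 2) ^ j) /
          (R / 2 * (1 + (1 / 2) ^ j) - R / 2 * (1 + (1 / 2) ^ (j + 1)))) ^ (N + p) *
        ((R / 2 * (1 + (1 / 2) ^ j)) ^ (-(s * p)) +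
          (k * (1 / 2) ^ j / 2) ^ (1 - p) * (τ * k ^ (p - 1) * R ^ (-(s * p)))) ≤ q := by
  have hp0 : 0 < p := by linarith
  have hsp : 0 < s * p := by positivity
  set β := s * p / N with hβ
  have hβ0 : 0 < β := by positivity
  set m := p * β + (N + p) + p with hm
  have hm0 : 0 < m := by positivity
  set q := (2 : ℝ) ^ (-(m / β)) with hq
  have hq0 : 0 < q := by positivity
  have hqβ : q ^ β = ((2 : ℝ) ^ m)⁻¹ := by
    rw [hq, ← Real.rpow_mul (by norm_num), neg_mul, div_mul_cancel₀ _ hβ0.ne',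
      Real.rpow_neg (by norm_num)]
  set G := C * (1 + τ) * 4 ^ m with hG
  have hG0 : 0 < G := by positivity
  refine ⟨(q / G) ^ (1 / β), q, by positivity, hq0,
    Real.rpow_lt_one_of_one_lt_of_neg (by norm_num) (by simpa using by positivity), ?_⟩
  intro R k j hR hk
  set ν := (q / G) ^ (1 / β) with hν
  have hν0 : 0 < ν := by positivity
  have hνβ : ν ^ β = q / G := by
    rw [hν, ← Real.rpow_mul (by positivity), one_div_mul_cancel hβ0.ne', Real.rpow_one]
  set t : ℝ := (1 / 2) ^ j with ht
  have ht0 : 0 < t := by positivity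
  have ht1 : t ≤ 1 := pow_le_one₀ (by norm_num) (by norm_num)
  set X := 4 / t with hX
  have hX0 : 0 < X := by positivity
  have hX4 : 4 ≤ X := by rw [hX, le_div_iff₀ ht0]; linarith
  have e1 : (ν * k ^ p * R ^ N * q ^ j / (k * t / 2) ^ p) ^ β ≤
      ν ^ β * R ^ (s * p) * (q ^ j) ^ β * X ^ (p * β) := by
    have h1 : ν * k ^ p * R ^ N * q ^ j / (k * t / 2) ^ p = ν * R ^ N * q ^ j * (2 / t) ^ p := by
      have : k * t / 2 = k * (2 / t)⁻¹ := by field_simp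
      rw [this, Real.mul_rpow hk.le (by positivity), Real.inv_rpow (by positivity)]
      field_simp
    rw [h1, Real.mul_rpow (by positivity) (by positivity),
      Real.mul_rpow (by positivity) (by positivity), Real.mul_rpow (by positivity) (by positivity),
      ← Real.rpow_mul hR.le, ← Real.rpow_mul (by positivity : 0 ≤ 2 / t), hβ,
      mul_div_cancel₀ _ hN.ne']
    gcongr
    rw [hX]; gcongr; norm_num
  have e2 : (R / 2 * (1 + t) / (R / 2 * (1 + t) - R / 2 * (1 + (1 / 2) ^ (j + 1)))) ≤ X := by
    have : R / 2 * (1 + t) - R / 2 * (1 + (1 / 2) ^ (j + 1)) = R * t / 4 := by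
      rw [pow_succ, ← ht]; ring
    rw [this, hX, div_le_div_iff₀ (by positivity) ht0]
    nlinarith [mul_pos hR ht0]
  have e2' : 0 ≤ (R / 2 * (1 + t) / (R / 2 * (1 + t) - R / 2 * (1 + (1 / 2) ^ (j + 1)))) := by
    have : R / 2 * (1 + t) - R / 2 * (1 + (1 / 2) ^ (j + 1)) = R * t / 4 := by
      rw [pow_succ, ← ht]; ring
    rw [this]; positivity
  have e3 : (R / 2 * (1 + t)) ^ (-(s * p)) ≤ X ^ p * R ^ (-(s * p)) := by
    have h1 : (R / 2 * (1 + t)) ^ (-(s * p)) ≤ (R / 2) ^ (-(s * p)) := by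
      refine Real.rpow_le_rpow_of_nonpos (by positivity) ?_ (by linarith)
      nlinarith
    refine h1.trans ?_
    rw [div_eq_inv_mul, Real.mul_rpow (by norm_num) hR.le, Real.inv_rpow (by norm_num),
      Real.rpow_neg (by norm_num : (0 : ℝ) ≤ 2), inv_inv]
    gcongr
    calc (2 : ℝ) ^ (s * p) ≤ 2 ^ p :=
          Real.rpow_le_rpow_of_exponent_le (by norm_num) (by nlinarith)
      _ ≤ X ^ p := by gcongr; linarith
  have e4 : (k * t / 2) ^ (1 - p) * (τ * k ^ (p - 1) * R ^ (-(s * p))) ≤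
      τ * X ^ p * R ^ (-(s * p)) := by
    have h1 : k * t / 2 = k * (2 / t)⁻¹ := by field_simp
    have h2 : k ^ (1 - p) * k ^ (p - 1) = 1 := by rw [← Real.rpow_add hk]; simp
    rw [h1, Real.mul_rpow hk.le (by positivity), Real.inv_rpow (by positivity),
      ← Real.rpow_neg (by positivity)]
    calc _ = (k ^ (1 - p) * k ^ (p - 1)) * (τ * (2 / t) ^ (-(1 - p)) * R ^ (-(s * p))) := by ring
      _ ≤ _ := by
        rw [h2, one_mul]
        gcongr
        calc (2 / t) ^ (-(1 - p)) ≤ X ^ (-(1 - p)) := by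
              rw [hX]; gcongr ?_ ^ _
              · linarith
              · gcongr; norm_num
          _ ≤ X ^ p := Real.rpow_le_rpow_of_exponent_le (by linarith) (by linarith)
  calc _ ≤ C * (ν ^ β * R ^ (s * p) * (q ^ j) ^ β * X ^ (p * β)) * X ^ (N + p) *
        (X ^ p * R ^ (-(s * p)) + τ * X ^ p * R ^ (-(s * p))) := by gcongr
    _ = C * (1 + τ) * ν ^ β * (q ^ j) ^ β * (X ^ (p * β) * X ^ (N + p) * X ^ p) *
        (R ^ (s * p) * R ^ (-(s * p))) := by ring
    _ = C * (1 + τ) * ν ^ β * (q ^ j) ^ β * X ^ m := by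
        rw [← Real.rpow_add hR, add_neg_cancel, Real.rpow_zero, mul_one,
          ← Real.rpow_add hX0, ← Real.rpow_add hX0]
    _ = q := by
        have h1 : (q ^ j) ^ β = (((2 : ℝ) ^ m)⁻¹) ^ j := by
          rw [← Real.rpow_natCast, ← Real.rpow_mul hq0.le, mul_comm (j : ℝ), Real.rpow_mul hq0.le,
            hqβ, Real.rpow_natCast]
        have h2 : X = 4 * 2 ^ j := by
          rw [hX, ht, one_div, inv_pow, div_inv_eq_mul]
        have h3 : X ^ m = 4 ^ m * ((2 : ℝ) ^ m) ^ j := by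
          rw [h2, Real.mul_rpow (by norm_num) (by positivity)]
          congr 1
          rw [← Real.rpow_natCast, ← Real.rpow_mul (by norm_num), mul_comm (j : ℝ),
            Real.rpow_mul (by norm_num), Real.rpow_natCast]
        rw [h1, h3, hνβ, hG, inv_pow]
        field_simp

/-- De Giorgi's local boundedness lemma. -/
lemma exists_sup_bound (hn : 2 ≤ n) (hs : 0 < s) (hs1 : s < 1) (hp : 1 < p) {C₀ τ : ℝ}
    (hC₀ : 1 ≤ C₀) (hτ : 0 ≤ τ) : ∃ ν : ℝ, 0 < ν ∧
    ∀ (Ω : Set (Rn n)) (f : Rn n → ℝ) (z : Rn n) (k₀ k R : ℝ), Measurable f →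
      DeGiorgiClass n s p C₀ Ω f → 0 < R → ball z R ⊆ Ω → 0 < k →
      ∫⁻ x in ball z R, ENNReal.ofReal (max (f x - k₀) 0 ^ p) ≤
        ENNReal.ofReal (ν * k ^ p * R ^ (n : ℝ)) →
      ∫⁻ y in (ball z (R / 2))ᶜ, ENNReal.ofReal
        (max (f y - k₀) 0 ^ (p - 1) * ‖y - z‖ ^ (-((n : ℝ) + s * p))) ≤
          ENNReal.ofReal (τ * k ^ (p - 1) * R ^ (-(s * p))) →
      ∀ᵐ x, x ∈ ball z (R / 2) → f x ≤ k₀ + k := by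
  have hn0 : (0 : ℝ) < n := by positivity
  have hp0 : 0 < p := by linarith
  obtain ⟨C, hC, hstep⟩ := exists_deGiorgi_step hn hs hs1 hp hC₀
  obtain ⟨ν, q, hν, hq0, hq1, hνq⟩ := exists_iteration_constants hn0 hs hs1 hp hC hτ
  refine ⟨ν, hν, ?_⟩
  intro Ω f z k₀ k R hfm hf hR hball hk hY htail
  have hmono : ∀ {k' x}, k₀ ≤ k' → max (f x - k') 0 ≤ max (f x - k₀) 0 := fun {k' x} h =>
    max_le_max (by linarith) le_rfl
  have key : ∀ j : ℕ, ∫⁻ x in ball z (R / 2 * (1 + (1 / 2) ^ j)),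
      ENNReal.ofReal (max (f x - (k₀ + k * (1 - (1 / 2) ^ j))) 0 ^ p) ≤
        ENNReal.ofReal (ν * k ^ p * R ^ (n : ℝ) * q ^ j) := by
    intro j
    induction j with
    | zero =>
      have : R / 2 * (1 + (1 / 2) ^ 0) = R := by ring
      rw [this]
      simpa using hY
    | succ j ih =>
      have ht0 : (0 : ℝ) < (1 / 2) ^ j := by positivity
      have ht1 : (1 / 2 : ℝ) ^ j ≤ 1 := pow_le_one₀ (by norm_num) (by norm_num)
      have hk1 : k₀ + k * (1 - (1 / 2) ^ (j + 1)) =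
          k₀ + k * (1 - (1 / 2) ^ j) + k * (1 / 2) ^ j / 2 := by rw [pow_succ]; ring
      rw [hk1]
      refine (hstep Ω f z (k₀ + k * (1 - (1 / 2) ^ j)) (k * (1 / 2) ^ j / 2)
        (R / 2 * (1 + (1 / 2) ^ (j + 1))) (R / 2 * (1 + (1 / 2) ^ j))
        (ν * k ^ p * R ^ (n : ℝ) * q ^ j) (τ * k ^ (p - 1) * R ^ (-(s * p))) hfm hf (by positivity)
        ?_ ?_ (by positivity) (by positivity) (by positivity) ih ?_).trans ?_
      · rw [pow_succ]; gcongr; linarith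
      · refine (ball_subset_ball ?_).trans hball
        nlinarith
      · refine le_trans (le_trans (lintegral_mono fun y => ENNReal.ofReal_le_ofReal ?_)
          (lintegral_mono_set (compl_subset_compl.2 (ball_subset_ball ?_)))) htail
        · have h1 : max (f y - (k₀ + k * (1 - (1 / 2) ^ j))) 0 ≤ max (f y - k₀) 0 :=
            hmono (by nlinarith)
          have h2 : 0 ≤ max (f y - (k₀ + k * (1 - (1 / 2) ^ j))) 0 := le_max_right _ _
          gcongr
        · nlinarith
      · refine ENNReal.ofReal_le_ofReal ?_
        have e : ν * k ^ p * R ^ (n : ℝ) * q ^ (j + 1) = q * (ν * k ^ p * R ^ (n : ℝ) * q ^ j) := by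
          ring
        rw [e]
        exact mul_le_mul_of_nonneg_right (hνq R k j hR hk) (by positivity)
  have hzero : ∫⁻ x in ball z (R / 2), ENNReal.ofReal (max (f x - (k₀ + k)) 0 ^ p) = 0 := by
    refine le_antisymm (ge_of_tendsto' (x := atTop)
      (f := fun j : ℕ => ENNReal.ofReal (ν * k ^ p * R ^ (n : ℝ) * q ^ j)) ?_ fun j => ?_) zero_le
    · rw [← ENNReal.ofReal_zero]
      refine ENNReal.tendsto_ofReal ?_
      simpa using (tendsto_pow_atTop_nhds_zero_of_lt_one hq0.le hq1).const_mul
        (ν * k ^ p * R ^ (n : ℝ))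
    · have ht0 : (0 : ℝ) < (1 / 2) ^ j := by positivity
      refine le_trans ?_ (key j)
      refine (lintegral_mono_set (ball_subset_ball (by nlinarith))).trans
        (lintegral_mono fun x => ENNReal.ofReal_le_ofReal ?_)
      gcongr
      nlinarith
  rw [lintegral_eq_zero_iff (by fun_prop)] at hzero
  rw [← ae_restrict_iff' measurableSet_ball]
  filter_upwards [hzero] with x hx
  by_contra! hlt
  have h1 : 0 < max (f x - (k₀ + k)) 0 := lt_max_of_lt_left (by linarith)
  have h2 : 0 < max (f x - (k₀ + k)) 0 ^ p := by positivity
  exact absurd (ENNReal.ofReal_eq_zero.1 hx) (not_le.2 h2)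

end supremum

section localBound

variable {n : ℕ} {s p : ℝ}

lemma ae_ball_of_forall_ball {x₀ : Rn n} {R δ : ℝ} (hδ : 0 < δ) {P : Rn n → Prop}
    (h : ∀ z ∈ ball x₀ R, ∀ᵐ x, x ∈ ball z δ → P x) : ∀ᵐ x, x ∈ ball x₀ R → P x := by
  rw [ae_iff]
  refine measure_null_of_locally_null _ fun x hx => ?_
  have hxb : x ∈ ball x₀ R := by
    by_contra hc
    exact hx fun h' => absurd h' hc
  refine ⟨{y | ¬ (y ∈ ball x δ → P y)} , ?_, ae_iff.1 (h x hxb)⟩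
  refine mem_nhdsWithin.2 ⟨ball x δ, isOpen_ball, mem_ball_self hδ, ?_⟩
  rintro y ⟨hy1, hy2⟩ hy3
  exact hy2 fun _ => hy3 hy1

lemma one_le_qStar (p : ℝ) : 1 ≤ qStar p := le_max_left _ _

lemma sub_one_le_qStar (p : ℝ) : p - 1 ≤ qStar p := le_max_right _ _

lemma qStar_lt (hp : 1 < p) : qStar p < p := max_lt hp (by linarith)

/-- Tail estimate with respect to a shifted centre. -/
lemma lintegral_tail_shift_le {w : Rn n → ℝ} {x₀ z : Rn n} {r d σ c₁ Q : ℝ} (hn : 2 ≤ n)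
    (hs : 0 < s) (hp : 1 < p) (hw : ∀ x, 0 ≤ w x) (hr : 0 < r) (hd : 0 < d)
    (hdσ : d + σ ≤ 1) (hz : z ∈ ball x₀ (σ * r)) (hc₁ : 0 ≤ c₁) (hQ : 0 < Q)
    (h1 : ∫⁻ x in ball x₀ r, ENNReal.ofReal (w x ^ qStar p) ≤
      ENNReal.ofReal (c₁ * Q ^ qStar p * r ^ (n : ℝ)))
    (h2 : ∫⁻ x in (ball x₀ r)ᶜ, ENNReal.ofReal
      (w x ^ (p - 1) * ‖x - x₀‖ ^ (-((n : ℝ) + s * p))) ≤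
        ENNReal.ofReal (Q ^ (p - 1) * r ^ (-(s * p)))) :
    ∫⁻ y in (ball z (d * r / 2))ᶜ, ENNReal.ofReal
      (w y ^ (p - 1) * ‖y - z‖ ^ (-((n : ℝ) + s * p))) ≤
      ENNReal.ofReal ((((volume (ball (0 : Rn n) 1)).toReal + c₁) * 2 ^ ((n : ℝ) + s * p) + 1) *
        d ^ (-((n : ℝ) + s * p)) * Q ^ (p - 1) * r ^ (-(s * p))) := by
  have hsp : 0 < s * p := mul_pos hs (by linarith)
  set ω := (volume (ball (0 : Rn n) 1)).toReal with hω
  have hω0 : 0 < ω := unit_ball_pos n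
  set e := (n : ℝ) + s * p with he
  have he0 : 0 < e := by positivity
  set q := qStar p with hq
  have hq1 : 1 ≤ q := one_le_qStar p
  have hzr : ‖z - x₀‖ < σ * r := by simpa [dist_eq_norm] using hz
  have hpt : ∀ x, w x ^ (p - 1) ≤ Q ^ (p - 1) * (1 + w x ^ q * Q ^ (-q)) := by
    intro x
    have e1 : w x ^ q * Q ^ (-q) = (w x / Q) ^ q := by
      rw [Real.div_rpow (hw x) hQ.le, Real.rpow_neg hQ.le, div_eq_mul_inv]
    have e2 : w x ^ (p - 1) = Q ^ (p - 1) * (w x / Q) ^ (p - 1) := by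
      rw [← Real.mul_rpow hQ.le (div_nonneg (hw x) hQ.le), mul_div_cancel₀ _ hQ.ne']
    have h0 : 0 ≤ w x / Q := div_nonneg (hw x) hQ.le
    rw [e1, e2]
    gcongr
    rcases le_total (w x / Q) 1 with h | h
    · have := Real.rpow_le_one h0 h (by linarith : 0 ≤ p - 1)
      have : 0 ≤ (w x / Q) ^ q := by positivity
      linarith
    · have := Real.rpow_le_rpow_of_exponent_le h (sub_one_le_qStar p)
      linarith
  have hin : ∫⁻ y in (ball z (d * r / 2))ᶜ ∩ ball x₀ r, ENNReal.ofReal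
      (w y ^ (p - 1) * ‖y - z‖ ^ (-e)) ≤
      ENNReal.ofReal (Q ^ (p - 1) * (ω + c₁) * r ^ (n : ℝ) * (d * r / 2) ^ (-e)) := by
    calc _ ≤ ∫⁻ y in (ball z (d * r / 2))ᶜ ∩ ball x₀ r,
          ENNReal.ofReal (Q ^ (p - 1) * (d * r / 2) ^ (-e)) *
            (1 + ENNReal.ofReal (w y ^ q) * ENNReal.ofReal (Q ^ (-q))) := by
          refine setLIntegral_mono' (measurableSet_ball.compl.inter measurableSet_ball) fun y hy => ?_
          have hyz : d * r / 2 ≤ ‖y - z‖ := by simpa [dist_eq_norm] using hy.1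
          have := hw y
          rw [← ENNReal.ofReal_one, ← ENNReal.ofReal_mul (by positivity),
            ← ENNReal.ofReal_add (by positivity) (by positivity),
            ← ENNReal.ofReal_mul (by positivity)]
          refine ENNReal.ofReal_le_ofReal ?_
          calc _ ≤ Q ^ (p - 1) * (1 + w y ^ q * Q ^ (-q)) * (d * r / 2) ^ (-e) := by
                gcongr ?_ * ?_
                · exact hpt y
                · exact Real.rpow_le_rpow_of_nonpos (by positivity) hyz (by linarith)
            _ = _ := by ring
      _ ≤ ∫⁻ y in ball x₀ r,
          ENNReal.ofReal (Q ^ (p - 1) * (d * r / 2) ^ (-e)) *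
            (1 + ENNReal.ofReal (w y ^ q) * ENNReal.ofReal (Q ^ (-q))) :=
          lintegral_mono_set inter_subset_right
      _ = ENNReal.ofReal (Q ^ (p - 1) * (d * r / 2) ^ (-e)) * (volume (ball x₀ r) +
            (∫⁻ y in ball x₀ r, ENNReal.ofReal (w y ^ q)) * ENNReal.ofReal (Q ^ (-q))) := by
          rw [lintegral_const_mul' _ _ (by simp), lintegral_add_left measurable_const,
            lintegral_mul_const' _ _ (by simp)]
          simp
      _ ≤ ENNReal.ofReal (Q ^ (p - 1) * (d * r / 2) ^ (-e)) * (ENNReal.ofReal (r ^ (n : ℝ) * ω) +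
            ENNReal.ofReal (c₁ * Q ^ q * r ^ (n : ℝ)) * ENNReal.ofReal (Q ^ (-q))) := by
          rw [volume_ball_eq hn x₀ hr]
          gcongr
      _ = _ := by
          rw [← ENNReal.ofReal_mul (by positivity),
            ← ENNReal.ofReal_add (by positivity) (by positivity),
            ← ENNReal.ofReal_mul (by positivity)]
          congr 1
          have : Q ^ q * Q ^ (-q) = 1 := by rw [← Real.rpow_add hQ]; simp
          linear_combination Q ^ (p - 1) * (d * r / 2) ^ (-e) * c₁ * r ^ (n : ℝ) * this
  have hout : ∫⁻ y in (ball z (d * r / 2))ᶜ ∩ (ball x₀ r)ᶜ, ENNReal.ofReal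
      (w y ^ (p - 1) * ‖y - z‖ ^ (-e)) ≤
      ENNReal.ofReal (d ^ (-e) * (Q ^ (p - 1) * r ^ (-(s * p)))) := by
    rw [ENNReal.ofReal_mul (by positivity)]
    refine le_trans ?_ (mul_le_mul_right h2 _)
    rw [← lintegral_const_mul' _ _ (by simp)]
    refine (lintegral_mono_set inter_subset_right).trans
      (setLIntegral_mono' measurableSet_ball.compl fun y hy => ?_)
    rw [← ENNReal.ofReal_mul (by positivity)]
    refine ENNReal.ofReal_le_ofReal ?_
    have hy' : r ≤ ‖y - x₀‖ := by simpa [dist_eq_norm] using hy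
    have h3 : d * ‖y - x₀‖ ≤ ‖y - z‖ := by
      have h4 : ‖y - x₀‖ ≤ ‖y - z‖ + ‖z - x₀‖ := by
        simpa using norm_add_le (y - z) (z - x₀)
      have hσ : 0 < σ := by
        by_contra! hc
        have := norm_nonneg (z - x₀)
        nlinarith
      nlinarith
    have h5 : 0 < ‖y - x₀‖ := hr.trans_le hy'
    calc w y ^ (p - 1) * ‖y - z‖ ^ (-e) ≤ w y ^ (p - 1) * (d * ‖y - x₀‖) ^ (-e) := by
          have := hw y
          gcongr ?_ * ?_
          exact Real.rpow_le_rpow_of_nonpos (by positivity) h3 (by linarith)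
      _ = _ := by rw [Real.mul_rpow hd.le h5.le]; ring
  calc _ = (∫⁻ y in (ball z (d * r / 2))ᶜ ∩ ball x₀ r, ENNReal.ofReal
        (w y ^ (p - 1) * ‖y - z‖ ^ (-e))) + ∫⁻ y in (ball z (d * r / 2))ᶜ ∩ (ball x₀ r)ᶜ,
          ENNReal.ofReal (w y ^ (p - 1) * ‖y - z‖ ^ (-e)) := by
        rw [← lintegral_inter_add_sdiff _ _ (measurableSet_ball (x := x₀) (ε := r)), sdiff_eq]
    _ ≤ _ := add_le_add hin hout
    _ = _ := by
        rw [← ENNReal.ofReal_add (by positivity) (by positivity)]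
        congr 1
        have h6 : r ^ (n : ℝ) * (d * r / 2) ^ (-e) = 2 ^ e * d ^ (-e) * r ^ (-(s * p)) := by
          rw [div_eq_mul_inv, Real.mul_rpow (by positivity) (by positivity),
            Real.mul_rpow hd.le hr.le, Real.inv_rpow (by norm_num),
            Real.rpow_neg (by norm_num : (0 : ℝ) ≤ 2), inv_inv]
          have h7 : r ^ (n : ℝ) * r ^ (-e) = r ^ (-(s * p)) := by
            rw [← Real.rpow_add hr, he]; ring_nf
          linear_combination 2 ^ e * d ^ (-e) * h7
        linear_combination Q ^ (p - 1) * (ω + c₁) * h6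

lemma exists_local_bound_step (hn : 2 ≤ n) (hs : 0 < s) (hs1 : s < 1) (hp : 1 < p) {C₀ c₁ : ℝ}
    (hC₀ : 1 ≤ C₀) (hc₁ : 0 ≤ c₁) : ∃ ν C : ℝ, 0 < ν ∧ 1 ≤ C ∧
    ∀ (Ω : Set (Rn n)) (f : Rn n → ℝ) (x₀ : Rn n) (k₀ k r σ σ' Q : ℝ), Measurable f →
      DeGiorgiClass n s p C₀ Ω f → 0 < r → ball x₀ r ⊆ Ω → σ' < σ → σ ≤ 1 → 0 < Q → 0 < k →
      0 < σ' →
      ∫⁻ x in ball x₀ r, ENNReal.ofReal (max (f x - k₀) 0 ^ qStar p) ≤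
        ENNReal.ofReal (c₁ * Q ^ qStar p * r ^ (n : ℝ)) →
      ∫⁻ x in (ball x₀ r)ᶜ, ENNReal.ofReal
        (max (f x - k₀) 0 ^ (p - 1) * ‖x - x₀‖ ^ (-((n : ℝ) + s * p))) ≤
          ENNReal.ofReal (Q ^ (p - 1) * r ^ (-(s * p))) →
      ∫⁻ x in ball x₀ (σ * r), ENNReal.ofReal (max (f x - k₀) 0 ^ p) ≤
        ENNReal.ofReal (ν * k ^ p * ((σ - σ') * r) ^ (n : ℝ)) →
      C * (σ - σ') ^ (-((n : ℝ) + s * p)) * Q ^ (p - 1) ≤ k ^ (p - 1) →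
      ∀ᵐ x, x ∈ ball x₀ (σ' * r) → f x ≤ k₀ + k := by
  have hsp : 0 < s * p := mul_pos hs (by linarith)
  obtain ⟨ν, hν, hsup⟩ := exists_sup_bound hn hs hs1 hp hC₀ (zero_le_one (α := ℝ))
  refine ⟨ν, ((volume (ball (0 : Rn n) 1)).toReal + c₁) * 2 ^ ((n : ℝ) + s * p) + 1, hν, ?_, ?_⟩
  · have := unit_ball_pos n
    have : 0 ≤ ((volume (ball (0 : Rn n) 1)).toReal + c₁) * 2 ^ ((n : ℝ) + s * p) := by positivity
    linarith
  intro Ω f x₀ k₀ k r σ σ' Q hfm hf hr hball hσ hσ1 hQ hk hσ0 h1 h2 h3 h4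
  have hd : 0 < σ - σ' := sub_pos.2 hσ
  refine ae_ball_of_forall_ball (δ := (σ - σ') * r / 2) (by positivity) fun z hz => ?_
  have hsub : ball z ((σ - σ') * r) ⊆ ball x₀ (σ * r) := by
    refine ball_subset_ball' ?_
    rw [mem_ball] at hz
    linarith
  refine hsup Ω f z k₀ k ((σ - σ') * r) hfm hf (by positivity)
    (hsub.trans ((ball_subset_ball (by nlinarith)).trans hball)) hk
    ((lintegral_mono_set hsub).trans h3) ?_
  refine (lintegral_tail_shift_le hn hs hp (fun x => le_max_right _ _) hr hd (by linarith) hz hc₁ hQ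
    h1 h2).trans (ENNReal.ofReal_le_ofReal ?_)
  have h5 : r ^ (-(s * p)) ≤ ((σ - σ') * r) ^ (-(s * p)) :=
    Real.rpow_le_rpow_of_nonpos (by positivity) (by nlinarith) (by linarith)
  have h6 : 0 ≤ k ^ (p - 1) := by positivity
  rw [one_mul]
  gcongr

lemma exists_local_bound_halving (hn : 2 ≤ n) (hs : 0 < s) (hs1 : s < 1) (hp : 1 < p) {C₀ c₁ : ℝ}
    (hC₀ : 1 ≤ C₀) (hc₁ : 0 ≤ c₁) : ∃ A N : ℝ, 1 ≤ A ∧ 0 < N ∧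
    ∀ (Ω : Set (Rn n)) (f : Rn n → ℝ) (x₀ : Rn n) (k₀ M r σ σ' Q : ℝ), Measurable f →
      DeGiorgiClass n s p C₀ Ω f → 0 < r → ball x₀ r ⊆ Ω → σ' < σ → σ ≤ 1 → 0 < Q → 0 ≤ M →
      0 < σ' →
      ∫⁻ x in ball x₀ r, ENNReal.ofReal (max (f x - k₀) 0 ^ qStar p) ≤
        ENNReal.ofReal (c₁ * Q ^ qStar p * r ^ (n : ℝ)) →
      ∫⁻ x in (ball x₀ r)ᶜ, ENNReal.ofReal
        (max (f x - k₀) 0 ^ (p - 1) * ‖x - x₀‖ ^ (-((n : ℝ) + s * p))) ≤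
          ENNReal.ofReal (Q ^ (p - 1) * r ^ (-(s * p))) →
      (∀ᵐ x, x ∈ ball x₀ (σ * r) → f x ≤ k₀ + M) →
      ∀ᵐ x, x ∈ ball x₀ (σ' * r) → f x ≤ k₀ + (M / 2 + A * (σ - σ') ^ (-N) * Q) := by
  have hsp : 0 < s * p := mul_pos hs (by linarith)
  obtain ⟨ν, C, hν, hC, hstep⟩ := exists_local_bound_step hn hs hs1 hp hC₀ hc₁
  set e := (n : ℝ) + s * p with he
  have he0 : 0 < e := by positivity
  set q := qStar p with hq
  have hq1 : 1 ≤ q := one_le_qStar p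
  have hqp : 0 < p - q := sub_pos.2 (qStar_lt hp)
  have hp1 : 0 < p - 1 := by linarith
  set A := max (max 1 (C ^ (1 / (p - 1)))) (c₁ * 2 ^ p / ν) with hA
  set N := max (n : ℝ) (e / (p - 1)) with hN
  have hA1 : 1 ≤ A := (le_max_left _ _).trans (le_max_left _ _)
  have hA0 : 0 < A := by linarith
  have hA2 : C ≤ A ^ (p - 1) := by
    calc C = (C ^ (1 / (p - 1))) ^ (p - 1) := by
          rw [← Real.rpow_mul (by linarith), one_div_mul_cancel hp1.ne', Real.rpow_one]
      _ ≤ A ^ (p - 1) := by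
          gcongr
          exact (le_max_right _ _).trans (le_max_left _ _)
  have hA3 : c₁ * 2 ^ p ≤ ν * A := by
    have : c₁ * 2 ^ p / ν ≤ A := le_max_right _ _
    rwa [div_le_iff₀' hν] at this
  have hN1 : (n : ℝ) ≤ N := le_max_left _ _
  have hN2 : e ≤ N * (p - 1) := by
    rw [← div_le_iff₀ hp1]; exact le_max_right _ _
  have hN0 : 0 < N := lt_max_of_lt_right (by positivity)
  refine ⟨A, N, hA1, hN0, ?_⟩
  intro Ω f x₀ k₀ M r σ σ' Q hfm hf hr hball hσ hσ1 hQ hM hσ0 h1 h2 h3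
  set d := σ - σ' with hd
  have hd0 : 0 < d := sub_pos.2 hσ
  have hd1 : d ≤ 1 := by linarith
  set k := M / 2 + A * d ^ (-N) * Q with hk
  have hk0 : 0 < k := by positivity
  have hkM : M / 2 ≤ k := by
    have : 0 < A * d ^ (-N) * Q := by positivity
    linarith
  have hkQ : A * d ^ (-N) * Q ≤ k := by linarith
  refine hstep Ω f x₀ k₀ k r σ σ' Q hfm hf hr hball hσ hσ1 hQ hk0 hσ0 h1 h2 ?_ ?_
  · have hpt : ∀ᵐ x, x ∈ ball x₀ (σ * r) → ENNReal.ofReal (max (f x - k₀) 0 ^ p) ≤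
        ENNReal.ofReal (M ^ (p - q)) * ENNReal.ofReal (max (f x - k₀) 0 ^ q) := by
      filter_upwards [h3] with x hx hxb
      have hw0 : 0 ≤ max (f x - k₀) 0 := le_max_right _ _
      have hw : max (f x - k₀) 0 ≤ M := max_le (by linarith [hx hxb]) hM
      rw [← ENNReal.ofReal_mul (by positivity)]
      refine ENNReal.ofReal_le_ofReal ?_
      rw [rpow_split hw0 (a := p - q) (b := q) (c := p) (by linarith) (by ring)]
      gcongr
    calc _ ≤ ∫⁻ x in ball x₀ (σ * r),
          ENNReal.ofReal (M ^ (p - q)) * ENNReal.ofReal (max (f x - k₀) 0 ^ q) :=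
          setLIntegral_mono_ae' measurableSet_ball hpt
      _ ≤ ENNReal.ofReal (M ^ (p - q)) *
          ∫⁻ x in ball x₀ r, ENNReal.ofReal (max (f x - k₀) 0 ^ q) := by
          rw [lintegral_const_mul' _ _ (by simp)]
          gcongr
          nlinarith
      _ ≤ ENNReal.ofReal (M ^ (p - q)) * ENNReal.ofReal (c₁ * Q ^ q * r ^ (n : ℝ)) := by gcongr
      _ ≤ _ := by
          rw [← ENNReal.ofReal_mul (by positivity)]
          refine ENNReal.ofReal_le_ofReal ?_
          have e1 : k ^ p = k ^ (p - q) * k ^ q := by rw [← Real.rpow_add hk0]; ring_nf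
          have e2 : M ^ (p - q) ≤ 2 ^ p * k ^ (p - q) := by
            calc M ^ (p - q) ≤ (2 * k) ^ (p - q) := by gcongr; linarith
              _ = 2 ^ (p - q) * k ^ (p - q) := Real.mul_rpow (by norm_num) hk0.le
              _ ≤ _ := by
                gcongr
                · norm_num
                · linarith
          have e3 : A * Q ^ q ≤ k ^ q * d ^ (n : ℝ) := by
            calc A * Q ^ q ≤ (A ^ q * (d ^ (-N)) ^ q * Q ^ q) * d ^ (n : ℝ) := by
                  have h5 : A ≤ A ^ q := Real.self_le_rpow_of_one_le hA1 hq1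
                  have h6 : 1 ≤ (d ^ (-N)) ^ q * d ^ (n : ℝ) := by
                    rw [← Real.rpow_mul hd0.le, ← Real.rpow_add hd0]
                    refine Real.one_le_rpow_of_pos_of_le_one_of_nonpos hd0 hd1 ?_
                    nlinarith
                  calc A * Q ^ q ≤ A ^ q * Q ^ q * 1 := by rw [mul_one]; gcongr
                    _ ≤ A ^ q * Q ^ q * ((d ^ (-N)) ^ q * d ^ (n : ℝ)) := by gcongr
                    _ = _ := by ring
              _ = (A * d ^ (-N) * Q) ^ q * d ^ (n : ℝ) := by
                  rw [Real.mul_rpow (by positivity) hQ.le, Real.mul_rpow hA0.le (by positivity)]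
              _ ≤ _ := by gcongr
          rw [Real.mul_rpow hd0.le hr.le, e1]
          calc M ^ (p - q) * (c₁ * Q ^ q * r ^ (n : ℝ)) ≤
                2 ^ p * k ^ (p - q) * (c₁ * Q ^ q * r ^ (n : ℝ)) := by gcongr
            _ = (c₁ * 2 ^ p) * (k ^ (p - q) * Q ^ q * r ^ (n : ℝ)) := by ring
            _ ≤ (ν * A) * (k ^ (p - q) * Q ^ q * r ^ (n : ℝ)) := by gcongr
            _ = ν * k ^ (p - q) * r ^ (n : ℝ) * (A * Q ^ q) := by ring
            _ ≤ ν * k ^ (p - q) * r ^ (n : ℝ) * (k ^ q * d ^ (n : ℝ)) := by gcongr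
            _ = _ := by ring
  · calc C * d ^ (-e) * Q ^ (p - 1) ≤ A ^ (p - 1) * (d ^ (-N)) ^ (p - 1) * Q ^ (p - 1) := by
          gcongr ?_ * ?_ * _
          · rw [← Real.rpow_mul hd0.le]
            exact Real.rpow_le_rpow_of_exponent_ge hd0 hd1 (by linarith)
      _ = (A * d ^ (-N) * Q) ^ (p - 1) := by
          rw [Real.mul_rpow (by positivity) hQ.le, Real.mul_rpow hA0.le (by positivity)]
      _ ≤ _ := by gcongr

/-- Local boundedness in terms of the `L^{q_*}`-norm and the tail. -/
lemma exists_local_bound (hn : 2 ≤ n) (hs : 0 < s) (hs1 : s < 1) (hp : 1 < p) {C₀ c₁ : ℝ}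
    (hC₀ : 1 ≤ C₀) (hc₁ : 0 ≤ c₁) : ∃ C : ℝ, 1 ≤ C ∧
    ∀ (Ω : Set (Rn n)) (f : Rn n → ℝ) (x₀ : Rn n) (k₀ r Q : ℝ), Measurable f →
      DeGiorgiClass n s p C₀ Ω f → 0 < r → ball x₀ r ⊆ Ω → 0 < Q →
      ∫⁻ x in ball x₀ r, ENNReal.ofReal (max (f x - k₀) 0 ^ qStar p) ≤
        ENNReal.ofReal (c₁ * Q ^ qStar p * r ^ (n : ℝ)) →
      ∫⁻ x in (ball x₀ r)ᶜ, ENNReal.ofReal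
        (max (f x - k₀) 0 ^ (p - 1) * ‖x - x₀‖ ^ (-((n : ℝ) + s * p))) ≤
          ENNReal.ofReal (Q ^ (p - 1) * r ^ (-(s * p))) →
      ∫⁻ x in ball x₀ r, ENNReal.ofReal (max (f x - k₀) 0 ^ p) < ⊤ →
      ∀ᵐ x, x ∈ ball x₀ (r / 2) → f x ≤ k₀ + C * Q := by
  have hsp : 0 < s * p := mul_pos hs (by linarith)
  have hp1 : 0 < p - 1 := by linarith
  obtain ⟨ν, C, hν, hC, hstep⟩ := exists_local_bound_step hn hs hs1 hp hC₀ hc₁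
  obtain ⟨A, N, hA, hN, hhalf⟩ := exists_local_bound_halving hn hs hs1 hp hC₀ hc₁
  set lam : ℝ := 1 - (3 / 2) ^ (-(1 / N)) with hlam
  have hl1 : (3 / 2 : ℝ) ^ (-(1 / N)) < 1 :=
    Real.rpow_lt_one_of_one_lt_of_neg (by norm_num) (by simpa using hN)
  have hl0 : 0 < lam := by linarith
  have hl2 : lam < 1 := by
    have : (0 : ℝ) < (3 / 2) ^ (-(1 / N)) := by positivity
    linarith
  have hl3 : (1 - lam) ^ (-N) = 3 / 2 := by
    rw [hlam, sub_sub_cancel, ← Real.rpow_mul (by norm_num), neg_mul_neg,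
      one_div_mul_cancel hN.ne', Real.rpow_one]
  set A' := A * lam ^ (-N) with hA'
  have hA'1 : 1 ≤ A' := one_le_mul_of_one_le_of_one_le hA
    (Real.one_le_rpow_of_pos_of_le_one_of_nonpos hl0 hl2.le (by linarith))
  refine ⟨4 * A' * 4 ^ N, ?_, ?_⟩
  · have : (1 : ℝ) ≤ 4 ^ N := Real.one_le_rpow (by norm_num) hN.le
    exact one_le_mul_of_one_le_of_one_le (by linarith) this
  intro Ω f x₀ k₀ r Q hfm hf hr hball hQ h1 h2 h3
  obtain ⟨M, hM, hbdd⟩ : ∃ M : ℝ, 0 < M ∧ ∀ᵐ x, x ∈ ball x₀ (3 / 4 * r) → f x ≤ k₀ + M := by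
    set I := (∫⁻ x in ball x₀ r, ENNReal.ofReal (max (f x - k₀) 0 ^ p)).toReal with hI
    have hI0 : 0 ≤ I := ENNReal.toReal_nonneg
    set k₁ := (I / (ν * ((1 - 3 / 4) * r) ^ (n : ℝ))) ^ (1 / p) with hk₁
    set k₂ := (C * (1 - 3 / 4) ^ (-((n : ℝ) + s * p)) * Q ^ (p - 1)) ^ (1 / (p - 1)) with hk₂
    have hk₁0 : 0 ≤ k₁ := by positivity
    have hk₂0 : 0 < k₂ := by positivity
    refine ⟨k₁ + k₂, by linarith, ?_⟩
    refine hstep Ω f x₀ k₀ (k₁ + k₂) r 1 (3 / 4) Q hfm hf hr hball (by norm_num) le_rfl hQ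
      (by linarith) (by norm_num) h1 h2 ?_ ?_
    · rw [one_mul, ← ENNReal.ofReal_toReal h3.ne, ← hI]
      refine ENNReal.ofReal_le_ofReal ?_
      calc I = ν * k₁ ^ p * ((1 - 3 / 4) * r) ^ (n : ℝ) := by
            rw [hk₁, ← Real.rpow_mul (by positivity), one_div_mul_cancel (by linarith),
              Real.rpow_one]
            field_simp
        _ ≤ _ := by gcongr; linarith
    · calc _ = k₂ ^ (p - 1) := by
            rw [hk₂, ← Real.rpow_mul (by positivity), one_div_mul_cancel hp1.ne', Real.rpow_one]
        _ ≤ _ := by gcongr; linarith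
  have key : ∀ i : ℕ, ∀ σ : ℝ, 1 / 2 ≤ σ → σ < 3 / 4 → ∀ᵐ x, x ∈ ball x₀ (σ * r) →
      f x ≤ k₀ + ((3 / 4) ^ i * M + 4 * A' * Q) * (3 / 4 - σ) ^ (-N) := by
    intro i
    induction i with
    | zero =>
      intro σ hσ hσ'
      filter_upwards [hbdd] with x hx hxb
      have h4 : 1 ≤ (3 / 4 - σ) ^ (-N) :=
        Real.one_le_rpow_of_pos_of_le_one_of_nonpos (by linarith) (by linarith) (by linarith)
      have h5 := hx (ball_subset_ball (by nlinarith) hxb)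
      have h6 : 0 ≤ 4 * A' * Q := by positivity
      rw [pow_zero, one_mul]
      nlinarith
    | succ i ih =>
      intro σ' hσ hσ'
      set δ := 3 / 4 - σ' with hδ
      have hδ0 : 0 < δ := by rw [hδ]; linarith
      set S := (3 / 4) ^ i * M + 4 * A' * Q with hS
      have hS0 : 0 ≤ S := by positivity
      have h4 : 3 / 4 - (σ' + lam * δ) = (1 - lam) * δ := by rw [hδ]; ring
      have h5 := ih (σ' + lam * δ) (by nlinarith) (by nlinarith)
      have h6 := hhalf Ω f x₀ k₀ (S * (3 / 4 - (σ' + lam * δ)) ^ (-N)) r (σ' + lam * δ) σ' Q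
        hfm hf hr hball (by nlinarith) (by nlinarith) hQ
        (mul_nonneg hS0 (by rw [h4]; exact Real.rpow_nonneg (by nlinarith) _)) (by linarith) h1 h2 h5
      filter_upwards [h6] with x hx hxb
      refine (hx hxb).trans (le_of_eq ?_)
      rw [h4, Real.mul_rpow (by linarith) hδ0.le, hl3, add_sub_cancel_left,
        Real.mul_rpow hl0.le hδ0.le, hS, hA', pow_succ]
      ring
  have hall := ae_all_iff.2 fun i : ℕ => key i (1 / 2) le_rfl (by norm_num)
  filter_upwards [hall] with x hx hxb
  have hxb' : x ∈ ball x₀ (1 / 2 * r) := by rwa [one_div_mul_eq_div]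
  refine ge_of_tendsto' (x := atTop)
    (f := fun i : ℕ => k₀ + ((3 / 4) ^ i * M + 4 * A' * Q) * (3 / 4 - 1 / 2) ^ (-N)) ?_
    fun i => hx i hxb'
  have h4 : (3 / 4 - 1 / 2 : ℝ) ^ (-N) = 4 ^ N := by
    rw [Real.rpow_neg (by norm_num), ← Real.inv_rpow (by norm_num)]; norm_num
  have h5 : k₀ + 4 * A' * 4 ^ N * Q =
      k₀ + (0 * M + 4 * A' * Q) * (3 / 4 - 1 / 2) ^ (-N) := by rw [h4]; ring
  rw [h5]
  exact ((((tendsto_pow_atTop_nhds_zero_of_lt_one (by norm_num) (by norm_num)).mul_const M).add_const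
    _).mul_const _).const_add _

end localBound

section oscillation

variable {n : ℕ} {s p : ℝ}

/-- Splitting of a tail integral for a function bounded on a larger ball. -/
lemma exists_tail_split (n : ℕ) (hs : 0 < s) (hp : 1 < p) : ∃ C : ℝ, 1 ≤ C ∧
    ∀ (w : Rn n → ℝ) (x₀ : Rn n) (ρ R b : ℝ), (∀ x, 0 ≤ w x) → 0 < ρ → 0 ≤ b →
      (∀ᵐ x, x ∈ ball x₀ R → w x ≤ b) →
      ∫⁻ y in (ball x₀ ρ)ᶜ, ENNReal.ofReal
        (w y ^ (p - 1) * ‖y - x₀‖ ^ (-((n : ℝ) + s * p))) ≤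
        ENNReal.ofReal (C * b ^ (p - 1) * ρ ^ (-(s * p))) +
          ∫⁻ y in (ball x₀ R)ᶜ, ENNReal.ofReal
            (w y ^ (p - 1) * ‖y - x₀‖ ^ (-((n : ℝ) + s * p))) := by
  obtain ⟨C, hC, hker⟩ := exists_tail_kernel_bound n hs hp
  refine ⟨C, hC, fun w x₀ ρ R b hw hρ hb h => ?_⟩
  have hp1 : 0 < p - 1 := by linarith
  rw [← lintegral_inter_add_sdiff _ ((ball x₀ ρ)ᶜ) (measurableSet_ball (x := x₀) (ε := R))]
  refine add_le_add ?_ (lintegral_mono_set fun y hy => hy.2)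
  calc _ ≤ ∫⁻ y in (ball x₀ ρ)ᶜ ∩ ball x₀ R, ENNReal.ofReal (b ^ (p - 1)) *
        ENNReal.ofReal (‖y - x₀‖ ^ (-((n : ℝ) + s * p))) := by
        refine setLIntegral_mono_ae' (measurableSet_ball.compl.inter measurableSet_ball) ?_
        filter_upwards [h] with y hy hyb
        have := hw y
        have := hy hyb.2
        rw [← ENNReal.ofReal_mul (by positivity)]
        refine ENNReal.ofReal_le_ofReal ?_
        gcongr
    _ ≤ ENNReal.ofReal (b ^ (p - 1)) *
        ∫⁻ y in (ball x₀ ρ)ᶜ, ENNReal.ofReal (‖y - x₀‖ ^ (-((n : ℝ) + s * p))) := by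
        rw [lintegral_const_mul' _ _ (by simp)]
        gcongr
        exact inter_subset_left
    _ ≤ ENNReal.ofReal (b ^ (p - 1)) * ENNReal.ofReal (C * ρ ^ (-(s * p))) := by
        gcongr; exact hker x₀ ρ hρ
    _ = _ := by
        rw [← ENNReal.ofReal_mul (by positivity)]; congr 1; ring

/-- Measure-theoretic lower bound for the mixed term in the Caccioppoli inequality. -/
lemma lintegral_mixed_ge {f : Rn n → ℝ} {x₀ : Rn n} {c ω ε R : ℝ} (hn : 2 ≤ n) (hs : 0 < s)
    (hp : 1 < p) (hfm : Measurable f) (hω : 0 < ω) (hε : ε ≤ 1 / 2) (hR : 0 < R)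
    (hden : volume (ball x₀ R) ≤ 2 * volume ({x | f x ≤ c} ∩ ball x₀ R)) :
    (∫⁻ x in ball x₀ R, ENNReal.ofReal (max (f x - (c + (1 - ε) * ω)) 0)) *
        ENNReal.ofReal (2 ^ (-((n : ℝ) + p)) * (volume (ball (0 : Rn n) 1)).toReal *
          ω ^ (p - 1) * (2 * R) ^ (-(s * p))) ≤
      ∫⁻ x in ball x₀ R, ∫⁻ y in ball x₀ R, ENNReal.ofReal
        ((|max (f x - (c + (1 - ε) * ω)) 0 - max (f y - (c + (1 - ε) * ω)) 0| ^ p +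
          max (f x - (c + (1 - ε) * ω)) 0 * max ((c + (1 - ε) * ω) - f y) 0 ^ (p - 1)) *
            ‖x - y‖ ^ (-((n : ℝ) + s * p))) := by
  have hsp : 0 < s * p := mul_pos hs (by linarith)
  set k := c + (1 - ε) * ω with hk
  set κ := (volume (ball (0 : Rn n) 1)).toReal with hκ
  have hκ0 : 0 < κ := unit_ball_pos n
  rw [← lintegral_mul_const' _ _ (by simp)]
  refine setLIntegral_mono' measurableSet_ball fun x hx => ?_
  have hA : MeasurableSet ({x | f x ≤ c} ∩ ball x₀ R) :=
    (measurableSet_le hfm measurable_const).inter measurableSet_ball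
  have hw0 : ∀ x, 0 ≤ max (f x - k) 0 := fun x => le_max_right _ _
  have hden' : ENNReal.ofReal (R ^ (n : ℝ) * κ / 2) ≤ volume ({x | f x ≤ c} ∩ ball x₀ R) := by
    rw [volume_ball_eq hn x₀ hR] at hden
    rw [ENNReal.ofReal_div_of_pos two_pos]
    refine ENNReal.div_le_of_le_mul' ?_
    simpa using hden
  rcases (hw0 x).eq_or_lt with h0 | h0
  · rw [← h0]; simp
  have hxk : k < f x := by
    by_contra! hc
    rw [max_eq_right (by linarith)] at h0
    exact lt_irrefl _ h0
  calc _ ≤ ENNReal.ofReal (max (f x - k) 0 * (ω / 2) ^ (p - 1) * (2 * R) ^ (-((n : ℝ) + s * p))) *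
        ENNReal.ofReal (R ^ (n : ℝ) * κ / 2) := by
        rw [← ENNReal.ofReal_mul (hw0 x), ← ENNReal.ofReal_mul (by positivity)]
        refine ENNReal.ofReal_le_ofReal (le_of_eq ?_)
        have e1 : (2 * R) ^ (-((n : ℝ) + s * p)) * R ^ (n : ℝ) =
            2 ^ (-(n : ℝ)) * (2 * R) ^ (-(s * p)) := by
          rw [neg_add, Real.rpow_add (by positivity), Real.mul_rpow (by norm_num) hR.le]
          have : R ^ (-(n : ℝ)) * R ^ (n : ℝ) = 1 := by rw [← Real.rpow_add hR]; simp
          linear_combination 2 ^ (-(n : ℝ)) * (2 * R) ^ (-(s * p)) * this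
        have e2 : (ω / 2) ^ (p - 1) = 2 * 2 ^ (-p) * ω ^ (p - 1) := by
          rw [div_eq_mul_inv, Real.mul_rpow hω.le (by norm_num), Real.inv_rpow (by norm_num),
            ← Real.rpow_neg (by norm_num), neg_sub]
          have : (2 : ℝ) ^ (1 - p) = 2 * 2 ^ (-p) := by
            rw [sub_eq_add_neg, Real.rpow_add (by norm_num), Real.rpow_one]
          rw [this]; ring
        rw [e2, neg_add, Real.rpow_add (by norm_num)]
        linear_combination -(max (f x - k) 0 * 2 ^ (-p) * ω ^ (p - 1) * κ) * e1
    _ ≤ ENNReal.ofReal (max (f x - k) 0 * (ω / 2) ^ (p - 1) * (2 * R) ^ (-((n : ℝ) + s * p))) *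
        volume ({x | f x ≤ c} ∩ ball x₀ R) := by gcongr
    _ = ∫⁻ y in {x | f x ≤ c} ∩ ball x₀ R,
        ENNReal.ofReal (max (f x - k) 0 * (ω / 2) ^ (p - 1) * (2 * R) ^ (-((n : ℝ) + s * p))) := by
        rw [setLIntegral_const]
    _ ≤ ∫⁻ y in {x | f x ≤ c} ∩ ball x₀ R, ENNReal.ofReal
        ((|max (f x - k) 0 - max (f y - k) 0| ^ p +
          max (f x - k) 0 * max (k - f y) 0 ^ (p - 1)) * ‖x - y‖ ^ (-((n : ℝ) + s * p))) := by
        refine setLIntegral_mono' hA fun y hy => ENNReal.ofReal_le_ofReal ?_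
        have hy1 : f y ≤ c := hy.1
        have h1 : ω / 2 ≤ max (k - f y) 0 := by
          refine le_max_of_le_left ?_
          rw [hk]; nlinarith
        have h2 : 0 < ‖x - y‖ := by
          refine norm_pos_iff.2 (sub_ne_zero.2 fun h => ?_)
          rw [h] at hxk
          have : 0 < (1 - ε) * ω := mul_pos (by linarith) hω
          rw [hk] at hxk
          linarith
        have h3 : ‖x - y‖ ≤ 2 * R := by
          rw [← dist_eq_norm]
          have := dist_triangle_right x y x₀
          have h4 := mem_ball.1 hx
          have h5 := mem_ball.1 hy.2
          linarith
        have h6 : 0 ≤ |max (f x - k) 0 - max (f y - k) 0| ^ p := by positivity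
        gcongr ?_ * ?_
        · calc _ ≤ max (f x - k) 0 * max (k - f y) 0 ^ (p - 1) := by gcongr
            _ ≤ _ := by linarith
        · exact Real.rpow_le_rpow_of_nonpos h2 h3 (by linarith)
    _ ≤ _ := lintegral_mono_set inter_subset_right

/-- If `f` lies below the middle level on half of a small ball, its upper bound improves there. -/
lemma exists_growth (hn : 2 ≤ n) (hs : 0 < s) (hs1 : s < 1) (hp : 1 < p) {C₀ : ℝ}
    (hC₀ : 1 ≤ C₀) : ∃ ε : ℝ, 0 < ε ∧ ε ≤ 1 / 2 ∧
    ∀ (Ω : Set (Rn n)) (f : Rn n → ℝ) (x₀ : Rn n) (c ω R θ CT : ℝ), Measurable f →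
      DeGiorgiClass n s p C₀ Ω f → 0 < R → ball x₀ R ⊆ Ω → 0 < ω → 0 ≤ CT → 0 < θ → θ ≤ 1 / 4 →
      CT * (4 * θ) ^ (s * p) ≤ ε ^ (p - 1) →
      (∀ᵐ x, x ∈ ball x₀ R → f x ≤ c + ω) →
      ∫⁻ y in (ball x₀ R)ᶜ, ENNReal.ofReal
        (max (f y - c) 0 ^ (p - 1) * ‖y - x₀‖ ^ (-((n : ℝ) + s * p))) ≤
          ENNReal.ofReal (CT * ω ^ (p - 1) * R ^ (-(s * p))) →
      volume (ball x₀ (2 * θ * R)) ≤ 2 * volume ({x | f x ≤ c} ∩ ball x₀ (2 * θ * R)) →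
      ∀ᵐ x, x ∈ ball x₀ (θ * R) → f x ≤ c + (1 - ε / 2) * ω := by
  have hsp : 0 < s * p := mul_pos hs (by linarith)
  have hp1 : 0 < p - 1 := by linarith
  have hp0 : 0 < p := by linarith
  obtain ⟨C₁, hC₁, hsplit⟩ := exists_tail_split n hs hp
  set τ := (C₁ + 1) * 2 ^ (p - 1) * 2 ^ (s * p) with hτ
  have hτ0 : 0 ≤ τ := by positivity
  obtain ⟨ν, hν, hsup⟩ := exists_sup_bound hn hs hs1 hp hC₀ hτ0
  set C₂ := C₀ * 4 ^ ((n : ℝ) + p) * 2 ^ (n : ℝ) * (C₁ + 2) with hC₂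
  have hC₂0 : 0 < C₂ := by positivity
  set ε := min (1 / 2) ((ν * 2 ^ (-p) / C₂) ^ (1 / (p - 1))) with hε
  have hε0 : 0 < ε := lt_min (by norm_num) (by positivity)
  have hε1 : ε ≤ 1 / 2 := min_le_left _ _
  have hε2 : C₂ * ε ^ (p - 1) ≤ ν * 2 ^ (-p) := by
    rw [← le_div_iff₀' hC₂0]
    calc ε ^ (p - 1) ≤ ((ν * 2 ^ (-p) / C₂) ^ (1 / (p - 1))) ^ (p - 1) := by
          gcongr; exact min_le_right _ _
      _ = _ := by
          rw [← Real.rpow_mul (by positivity), one_div_mul_cancel hp1.ne', Real.rpow_one]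
  refine ⟨ε, hε0, hε1, ?_⟩
  intro Ω f x₀ c ω R θ CT hfm hf hR hball hω hCT hθ hθ1 hCTε hup htail hden
  set ρ := 2 * θ * R with hρ
  have hρ0 : 0 < ρ := by positivity
  have hρR : 2 * ρ ≤ R := by rw [hρ]; nlinarith
  set k := c + (1 - ε) * ω with hk
  have hw0 : ∀ x, 0 ≤ max (f x - k) 0 := fun x => le_max_right _ _
  have hεω : 0 < ε * ω := by positivity
  have hwb : ∀ᵐ x, x ∈ ball x₀ R → max (f x - k) 0 ≤ ε * ω := by
    filter_upwards [hup] with x hx hxb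
    refine max_le ?_ hεω.le
    have := hx hxb
    rw [hk]; linarith
  set κ := (volume (ball (0 : Rn n) 1)).toReal with hκ
  have hκ0 : 0 < κ := unit_ball_pos n
  have hwtail : ∀ r, 0 < r → r ≤ 2 * ρ → ∫⁻ y in (ball x₀ r)ᶜ, ENNReal.ofReal
      (max (f y - k) 0 ^ (p - 1) * ‖y - x₀‖ ^ (-((n : ℝ) + s * p))) ≤
        ENNReal.ofReal ((C₁ + 1) * (ε * ω) ^ (p - 1) * r ^ (-(s * p))) := by
    intro r hr hrρ
    refine (hsplit (fun x => max (f x - k) 0) x₀ r R (ε * ω) hw0 hr hεω.le hwb).trans ?_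
    have h1 : ∫⁻ y in (ball x₀ R)ᶜ, ENNReal.ofReal
        (max (f y - k) 0 ^ (p - 1) * ‖y - x₀‖ ^ (-((n : ℝ) + s * p))) ≤
          ENNReal.ofReal ((ε * ω) ^ (p - 1) * r ^ (-(s * p))) := by
      refine le_trans (lintegral_mono fun y => ENNReal.ofReal_le_ofReal ?_)
        (htail.trans (ENNReal.ofReal_le_ofReal ?_))
      · have h2 : max (f y - k) 0 ≤ max (f y - c) 0 := by
          refine max_le_max ?_ le_rfl
          have : 0 < (1 - ε) * ω := mul_pos (by linarith) hω
          rw [hk]; linarith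
        have := hw0 y
        gcongr
      · have h2 : R ^ (-(s * p)) = (4 * θ) ^ (s * p) * (2 * ρ) ^ (-(s * p)) := by
          have : 2 * ρ = 4 * θ * R := by rw [hρ]; ring
          rw [this, Real.mul_rpow (by positivity) hR.le, ← mul_assoc,
            ← Real.rpow_add (by positivity)]
          simp
        have h3 : (2 * ρ) ^ (-(s * p)) ≤ r ^ (-(s * p)) :=
          Real.rpow_le_rpow_of_nonpos hr hrρ (by linarith)
        rw [h2, Real.mul_rpow hε0.le hω.le]
        calc _ = (CT * (4 * θ) ^ (s * p)) * ω ^ (p - 1) * (2 * ρ) ^ (-(s * p)) := by ring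
          _ ≤ _ := by gcongr
    refine (add_le_add le_rfl h1).trans (le_of_eq ?_)
    rw [← ENNReal.ofReal_add (by positivity) (by positivity)]
    congr 1; ring
  have hwint : ∀ a : ℝ, 0 ≤ a → ∫⁻ x in ball x₀ (2 * ρ), ENNReal.ofReal (max (f x - k) 0 ^ a) ≤
      ENNReal.ofReal ((ε * ω) ^ a * ((2 * ρ) ^ (n : ℝ) * κ)) := by
    intro a ha
    rw [ENNReal.ofReal_mul (by positivity), ← volume_ball_eq hn x₀ (by positivity),
      ← setLIntegral_const]
    refine setLIntegral_mono_ae' measurableSet_ball ?_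
    filter_upwards [hwb] with x hx hxb
    have := hw0 x
    have := hx (ball_subset_ball hρR hxb)
    gcongr
  have hDG := hf x₀ k ρ (2 * ρ) hρ0 (by linarith) ((ball_subset_ball hρR).trans hball)
  have hmix := (lintegral_mixed_ge hn hs hp hfm hω hε1 hρ0 hden).trans hDG
  have h2 : 2 * ρ / (2 * ρ - ρ) = 2 := by field_simp; norm_num
  rw [h2, ← hκ, ← hk] at hmix
  have hI : ∫⁻ x in ball x₀ ρ, ENNReal.ofReal (max (f x - k) 0) ≤
      ENNReal.ofReal (C₂ * ε ^ (p - 1) * (ε * ω) * ρ ^ (n : ℝ)) := by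
    have hL : 0 < 2 ^ (-((n : ℝ) + p)) * κ * ω ^ (p - 1) * (2 * ρ) ^ (-(s * p)) := by positivity
    have h3 : ∫⁻ x in ball x₀ (2 * ρ), ENNReal.ofReal (max (f x - k) 0) ≤
        ENNReal.ofReal ((ε * ω) * ((2 * ρ) ^ (n : ℝ) * κ)) := by
      simpa using hwint 1 zero_le_one
    refine ((ENNReal.le_div_iff_mul_le (Or.inl (by simpa using hL)) (Or.inl (by simp))).2
      (hmix.trans (mul_le_mul_right (add_le_add (mul_le_mul_right (hwint p hp0.le) _)
        (mul_le_mul' h3 (hwtail (2 * ρ) (by positivity) le_rfl))) _))).trans (le_of_eq ?_)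
    rw [← ENNReal.ofReal_mul (by positivity), ← ENNReal.ofReal_mul (by positivity),
      ← ENNReal.ofReal_add (by positivity) (by positivity), ← ENNReal.ofReal_mul (by positivity),
      ← ENNReal.ofReal_div_of_pos hL]
    congr 1
    have e1 : (ε * ω) ^ p = (ε * ω) ^ (p - 1) * (ε * ω) := by
      rw [← Real.rpow_add_one hεω.ne']; ring_nf
    have e2 : (2 : ℝ) ^ (-((n : ℝ) + p)) * 4 ^ ((n : ℝ) + p) = 2 ^ ((n : ℝ) + p) := by
      have : (4 : ℝ) = 2 * 2 := by norm_num
      rw [this, Real.mul_rpow (by norm_num) (by norm_num), ← mul_assoc,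
        ← Real.rpow_add (by norm_num)]
      simp
    rw [div_eq_iff hL.ne', e1, Real.mul_rpow hε0.le hω.le,
      Real.mul_rpow (z := (n : ℝ)) (by norm_num) hρ0.le, hC₂]
    linear_combination -(C₀ * 2 ^ (n : ℝ) * (C₁ + 2) * ε ^ (p - 1) * (ε * ω) * ρ ^ (n : ℝ) * κ *
      ω ^ (p - 1) * (2 * ρ) ^ (-(s * p))) * e2
  have hfin := hsup Ω f x₀ k (ε * ω / 2) ρ hfm hf hρ0
    ((ball_subset_ball (by linarith)).trans hball) (by positivity) ?_ ?_
  · have h4 : ρ / 2 = θ * R := by rw [hρ]; ring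
    rw [h4] at hfin
    filter_upwards [hfin] with x hx hxb
    refine (hx hxb).trans (le_of_eq ?_)
    rw [hk]; ring
  · calc _ ≤ ∫⁻ x in ball x₀ ρ, ENNReal.ofReal ((ε * ω) ^ (p - 1)) *
          ENNReal.ofReal (max (f x - k) 0) := by
          refine setLIntegral_mono_ae' measurableSet_ball ?_
          filter_upwards [hwb] with x hx hxb
          rw [← ENNReal.ofReal_mul (by positivity)]
          refine ENNReal.ofReal_le_ofReal ?_
          have h5 := hx (ball_subset_ball (by linarith) hxb)
          have h6 := hw0 x
          rw [rpow_split h6 (a := p - 1) (b := 1) (c := p) (by linarith) (by ring), Real.rpow_one]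
          gcongr
      _ ≤ ENNReal.ofReal ((ε * ω) ^ (p - 1)) *
          ENNReal.ofReal (C₂ * ε ^ (p - 1) * (ε * ω) * ρ ^ (n : ℝ)) := by
          rw [lintegral_const_mul' _ _ (by simp)]
          gcongr
      _ ≤ _ := by
          rw [← ENNReal.ofReal_mul (by positivity)]
          refine ENNReal.ofReal_le_ofReal ?_
          have e1 : (ε * ω / 2) ^ p = (ε * ω) ^ (p - 1) * (ε * ω) * 2 ^ (-p) := by
            rw [div_eq_mul_inv, Real.mul_rpow hεω.le (by norm_num), Real.inv_rpow (by norm_num),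
              ← Real.rpow_neg (by norm_num), ← Real.rpow_add_one hεω.ne']
            ring_nf
          rw [e1]
          calc _ = (C₂ * ε ^ (p - 1)) * ((ε * ω) ^ (p - 1) * (ε * ω) * ρ ^ (n : ℝ)) := by ring
            _ ≤ (ν * 2 ^ (-p)) * ((ε * ω) ^ (p - 1) * (ε * ω) * ρ ^ (n : ℝ)) := by gcongr
            _ = _ := by ring
  · refine (hwtail (ρ / 2) (by positivity) (by linarith)).trans
      (ENNReal.ofReal_le_ofReal (le_of_eq ?_))
    have e1 : (ε * ω / 2) ^ (p - 1) * 2 ^ (p - 1) = (ε * ω) ^ (p - 1) := by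
      rw [← Real.mul_rpow (by positivity) (by norm_num), div_mul_cancel₀ _ two_ne_zero]
    have e2 : (ρ / 2) ^ (-(s * p)) = 2 ^ (s * p) * ρ ^ (-(s * p)) := by
      rw [div_eq_mul_inv, Real.mul_rpow hρ0.le (by norm_num), Real.inv_rpow (by norm_num),
        Real.rpow_neg (by norm_num : (0 : ℝ) ≤ 2), inv_inv]
      ring
    rw [e2, hτ, ← e1]; ring

/-- `u` stays within `ω` of `c` on `B_R(x₀)`, with matching control of the tail. -/
def OscBound (n : ℕ) (s p CT : ℝ) (u : Rn n → ℝ) (x₀ : Rn n) (c ω R : ℝ) : Prop :=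
  (∀ᵐ x, x ∈ ball x₀ R → |u x - c| ≤ ω) ∧
    ∫⁻ y in (ball x₀ R)ᶜ, ENNReal.ofReal
      (|u y - c| ^ (p - 1) * ‖y - x₀‖ ^ (-((n : ℝ) + s * p))) ≤
        ENNReal.ofReal (CT * ω ^ (p - 1) * R ^ (-(s * p)))

lemma exists_tail_step (n : ℕ) (hs : 0 < s) (hp : 1 < p) : ∃ CT : ℝ, 1 ≤ CT ∧
    ∀ (u : Rn n → ℝ) (x₀ : Rn n) (c c' ω R θ κ : ℝ), 0 < R → 0 < ω → 0 < θ →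
      θ ^ (s * p) ≤ 4 ^ (-p) → 0 ≤ κ → κ ≤ 1 / 2 → |c - c'| ≤ ω →
      OscBound n s p CT u x₀ c ω R →
      ∫⁻ y in (ball x₀ (θ * R))ᶜ, ENNReal.ofReal
        (|u y - c'| ^ (p - 1) * ‖y - x₀‖ ^ (-((n : ℝ) + s * p))) ≤
          ENNReal.ofReal (CT * ((1 - κ) * ω) ^ (p - 1) * (θ * R) ^ (-(s * p))) := by
  have hsp : 0 < s * p := mul_pos hs (by linarith)
  have hp1 : 0 < p - 1 := by linarith
  obtain ⟨C₁, hC₁, hsplit⟩ := exists_tail_split n hs hp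
  obtain ⟨C₃, hC₃, hker⟩ := exists_tail_kernel_bound n hs hp
  have h4p : (1 : ℝ) ≤ 4 ^ p := Real.one_le_rpow (by norm_num) (by linarith)
  refine ⟨4 ^ p * (C₁ + C₃), one_le_mul_of_one_le_of_one_le h4p (by linarith), ?_⟩
  intro u x₀ c c' ω R θ κ hR hω hθ hθp hκ hκ1 hcc ⟨hosc, htail⟩
  set CT := 4 ^ p * (C₁ + C₃) with hCT
  have hCT0 : 0 < CT := by positivity
  have habs : ∀ x, |u x - c'| ≤ |u x - c| + ω := fun x => by
    have := abs_add_le (u x - c) (c - c')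
    rw [sub_add_sub_cancel] at this
    linarith
  have h1 := hsplit (fun x => |u x - c'|) x₀ (θ * R) R (2 * ω) (fun x => abs_nonneg _)
    (by positivity) (by positivity) (by
      filter_upwards [hosc] with x hx hxb
      linarith [habs x, hx hxb])
  have h2 : ∫⁻ y in (ball x₀ R)ᶜ, ENNReal.ofReal
      (|u y - c'| ^ (p - 1) * ‖y - x₀‖ ^ (-((n : ℝ) + s * p))) ≤
        ENNReal.ofReal (2 ^ (p - 1) * ((CT + C₃) * ω ^ (p - 1) * R ^ (-(s * p)))) := by
    calc _ ≤ ∫⁻ y in (ball x₀ R)ᶜ, ENNReal.ofReal (2 ^ (p - 1)) * (ENNReal.ofReal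
          (|u y - c| ^ (p - 1) * ‖y - x₀‖ ^ (-((n : ℝ) + s * p))) +
          ENNReal.ofReal (ω ^ (p - 1)) * ENNReal.ofReal (‖y - x₀‖ ^ (-((n : ℝ) + s * p)))) := by
          refine lintegral_mono fun y => ?_
          rw [← ENNReal.ofReal_mul (by positivity),
            ← ENNReal.ofReal_add (by positivity) (by positivity),
            ← ENNReal.ofReal_mul (by positivity)]
          refine ENNReal.ofReal_le_ofReal ?_
          calc _ ≤ (|u y - c| + ω) ^ (p - 1) * ‖y - x₀‖ ^ (-((n : ℝ) + s * p)) := by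
                gcongr; exact habs y
            _ ≤ (2 ^ (p - 1) * (|u y - c| ^ (p - 1) + ω ^ (p - 1))) *
                ‖y - x₀‖ ^ (-((n : ℝ) + s * p)) := by
                gcongr
                exact add_rpow_le_two_rpow_mul (abs_nonneg _) hω.le hp1.le
            _ = _ := by ring
      _ = ENNReal.ofReal (2 ^ (p - 1)) * ((∫⁻ y in (ball x₀ R)ᶜ, ENNReal.ofReal
          (|u y - c| ^ (p - 1) * ‖y - x₀‖ ^ (-((n : ℝ) + s * p)))) +
          ENNReal.ofReal (ω ^ (p - 1)) *
            ∫⁻ y in (ball x₀ R)ᶜ, ENNReal.ofReal (‖y - x₀‖ ^ (-((n : ℝ) + s * p)))) := by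
          rw [lintegral_const_mul' _ _ (by simp), lintegral_add_right _ (by fun_prop),
            lintegral_const_mul' _ _ (by simp)]
      _ ≤ ENNReal.ofReal (2 ^ (p - 1)) * (ENNReal.ofReal (CT * ω ^ (p - 1) * R ^ (-(s * p))) +
          ENNReal.ofReal (ω ^ (p - 1)) * ENNReal.ofReal (C₃ * R ^ (-(s * p)))) := by
          gcongr
          exact hker x₀ R hR
      _ = _ := by
          rw [← ENNReal.ofReal_mul (by positivity),
            ← ENNReal.ofReal_add (by positivity) (by positivity),
            ← ENNReal.ofReal_mul (by positivity)]
          congr 1; ring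
  refine (h1.trans (add_le_add le_rfl h2)).trans ?_
  rw [← ENNReal.ofReal_add (by positivity) (by positivity)]
  refine ENNReal.ofReal_le_ofReal ?_
  have e1 : R ^ (-(s * p)) = θ ^ (s * p) * (θ * R) ^ (-(s * p)) := by
    rw [Real.mul_rpow hθ.le hR.le, ← mul_assoc, ← Real.rpow_add hθ]; simp
  have e2 : θ ^ (s * p) * 4 ^ p ≤ 1 := by
    calc θ ^ (s * p) * 4 ^ p ≤ 4 ^ (-p) * 4 ^ p := by gcongr
      _ = 1 := by rw [← Real.rpow_add (by norm_num)]; simp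
  have e3 : θ ^ (s * p) ≤ 1 := by
    have : 0 < θ ^ (s * p) := by positivity
    nlinarith
  have e4 : ω ^ (p - 1) ≤ 2 ^ (p - 1) * ((1 - κ) * ω) ^ (p - 1) := by
    rw [← Real.mul_rpow (by norm_num) (mul_nonneg (by linarith) hω.le)]
    gcongr
    nlinarith
  have e5 : (2 : ℝ) ^ (p - 1) * (2 ^ (p - 1) * 4) = 4 ^ p := by
    have h42 : (4 : ℝ) = 2 * 2 := by norm_num
    have h43 : (2 : ℝ) ^ p = 2 ^ (p - 1) * 2 := by
      rw [← Real.rpow_add_one (by norm_num)]; ring_nf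
    rw [h42, Real.mul_rpow (by norm_num) (by norm_num), h43]; ring
  have e6 : θ ^ (s * p) * (CT + C₃) ≤ C₁ + 2 * C₃ := by
    rw [hCT]; nlinarith
  have hκω : 0 ≤ ((1 - κ) * ω) ^ (p - 1) := Real.rpow_nonneg (mul_nonneg (by linarith) hω.le) _
  rw [e1, Real.mul_rpow (by norm_num) hω.le]
  calc _ = 2 ^ (p - 1) * (C₁ + θ ^ (s * p) * (CT + C₃)) * ω ^ (p - 1) * (θ * R) ^ (-(s * p)) := by
        ring
    _ ≤ 2 ^ (p - 1) * (4 * (C₁ + C₃)) * (2 ^ (p - 1) * ((1 - κ) * ω) ^ (p - 1)) *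
        (θ * R) ^ (-(s * p)) := by
        gcongr
        linarith
    _ = (2 ^ (p - 1) * (2 ^ (p - 1) * 4)) * (C₁ + C₃) * ((1 - κ) * ω) ^ (p - 1) *
        (θ * R) ^ (-(s * p)) := by ring
    _ = _ := by rw [e5]

/-- Reduction of oscillation. -/
lemma exists_osc_step (hn : 2 ≤ n) (hs : 0 < s) (hs1 : s < 1) (hp : 1 < p) {C₀ : ℝ}
    (hC₀ : 1 ≤ C₀) : ∃ θ κ CT : ℝ, 0 < θ ∧ θ ≤ 1 / 4 ∧ 0 < κ ∧ κ ≤ 1 / 2 ∧ 1 ≤ CT ∧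
    ∀ (Ω : Set (Rn n)) (u : Rn n → ℝ) (x₀ : Rn n) (c ω R : ℝ), Measurable u →
      DeGiorgiClass n s p C₀ Ω u → DeGiorgiClass n s p C₀ Ω (fun x => -u x) → 0 < R →
      ball x₀ R ⊆ Ω → 0 < ω → OscBound n s p CT u x₀ c ω R →
      ∃ c', OscBound n s p CT u x₀ c' ((1 - κ) * ω) (θ * R) := by
  have hsp : 0 < s * p := mul_pos hs (by linarith)
  have hp1 : 0 < p - 1 := by linarith
  obtain ⟨CT, hCT, htailstep⟩ := exists_tail_step n hs hp
  obtain ⟨ε, hε, hε1, hgrowth⟩ := exists_growth hn hs hs1 hp hC₀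
  set t := min ((4 : ℝ) ^ (-p)) (ε ^ (p - 1) / CT) with ht
  have ht0 : 0 < t := lt_min (by positivity) (by positivity)
  have ht1 : t ≤ 1 := (min_le_left _ _).trans
    (Real.rpow_le_one_of_one_le_of_nonpos (by norm_num) (by linarith))
  set θ := t ^ (1 / (s * p)) / 4 with hθ
  have hθ0 : 0 < θ := by positivity
  have h4θ : (4 * θ) ^ (s * p) = t := by
    rw [hθ, mul_div_cancel₀ _ (by norm_num : (4 : ℝ) ≠ 0), ← Real.rpow_mul ht0.le,
      one_div_mul_cancel hsp.ne', Real.rpow_one]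
  have hθ1 : θ ≤ 1 / 4 := by
    rw [hθ]
    have : t ^ (1 / (s * p)) ≤ 1 := Real.rpow_le_one ht0.le ht1 (by positivity)
    linarith
  have hθp : θ ^ (s * p) ≤ 4 ^ (-p) := by
    calc θ ^ (s * p) ≤ (4 * θ) ^ (s * p) := by gcongr; linarith
      _ = t := h4θ
      _ ≤ _ := min_le_left _ _
  have hCTθ : CT * (4 * θ) ^ (s * p) ≤ ε ^ (p - 1) := by
    rw [h4θ, ← le_div_iff₀' (by linarith)]; exact min_le_right _ _
  refine ⟨θ, ε / 4, CT, hθ0, hθ1, by positivity, by linarith, hCT, ?_⟩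
  intro Ω u x₀ c ω R hum hu hu' hR hball hω hosc
  have hεω : 0 < ε * ω := by positivity
  have hcov : volume (ball x₀ (2 * θ * R)) ≤ volume ({x | u x ≤ c} ∩ ball x₀ (2 * θ * R)) +
      volume ({x | -u x ≤ -c} ∩ ball x₀ (2 * θ * R)) := by
    refine le_trans (measure_mono fun x hx => ?_) (measure_union_le _ _)
    rcases le_total (u x) c with h | h
    · exact Or.inl ⟨h, hx⟩
    · exact Or.inr ⟨neg_le_neg h, hx⟩
  have htail : ∀ g : Rn n → ℝ, (∀ y, 0 ≤ g y) → (∀ y, g y ≤ |u y - c|) →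
      ∫⁻ y in (ball x₀ R)ᶜ, ENNReal.ofReal (g y ^ (p - 1) * ‖y - x₀‖ ^ (-((n : ℝ) + s * p))) ≤
        ENNReal.ofReal (CT * ω ^ (p - 1) * R ^ (-(s * p))) := fun g hg0 hg =>
    (lintegral_mono fun y => ENNReal.ofReal_le_ofReal (by
      have := hg0 y
      have := hg y
      gcongr)).trans hosc.2
  rcases le_total (volume ({x | u x ≤ c} ∩ ball x₀ (2 * θ * R)))
    (volume ({x | -u x ≤ -c} ∩ ball x₀ (2 * θ * R))) with hle | hle
  · have hden : volume (ball x₀ (2 * θ * R)) ≤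
        2 * volume ({x | -u x ≤ -c} ∩ ball x₀ (2 * θ * R)) :=
      (hcov.trans (add_le_add hle le_rfl)).trans (two_mul _).ge
    have hg := hgrowth Ω (fun x => -u x) x₀ (-c) ω R θ CT hum.neg hu' hR hball hω (by linarith) hθ0
      hθ1 hCTθ (by
        filter_upwards [hosc.1] with x hx hxb
        linarith [neg_abs_le (u x - c), hx hxb])
      (htail _ (fun y => le_max_right _ _) fun y =>
        max_le (by linarith [neg_abs_le (u y - c)]) (abs_nonneg _)) hden
    refine ⟨c + ε / 4 * ω, ?_, htailstep u x₀ c _ ω R θ _ hR hω hθ0 hθp (by positivity)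
      (by linarith) (by rw [abs_le]; constructor <;> nlinarith) hosc⟩
    filter_upwards [hosc.1, hg] with x hx hx' hxb
    have h1 := abs_le.1 (hx (ball_subset_ball (by nlinarith) hxb))
    have h2 := hx' hxb
    rw [abs_le]
    constructor <;> nlinarith [h1.1, h1.2]
  · have hden : volume (ball x₀ (2 * θ * R)) ≤
        2 * volume ({x | u x ≤ c} ∩ ball x₀ (2 * θ * R)) :=
      (hcov.trans (add_le_add le_rfl hle)).trans (two_mul _).ge
    have hg := hgrowth Ω u x₀ c ω R θ CT hum hu hR hball hω (by linarith) hθ0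
      hθ1 hCTθ (by
        filter_upwards [hosc.1] with x hx hxb
        linarith [le_abs_self (u x - c), hx hxb])
      (htail _ (fun y => le_max_right _ _) fun y =>
        max_le (le_abs_self (u y - c)) (abs_nonneg _)) hden
    refine ⟨c - ε / 4 * ω, ?_, htailstep u x₀ c _ ω R θ _ hR hω hθ0 hθp (by positivity)
      (by linarith) (by rw [abs_le]; constructor <;> nlinarith) hosc⟩
    filter_upwards [hosc.1, hg] with x hx hx' hxb
    have h1 := abs_le.1 (hx (ball_subset_ball (by nlinarith) hxb))
    have h2 := hx' hxb
    rw [abs_le]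
    constructor <;> nlinarith [h1.1, h1.2]

end oscillation

section decay

variable {n : ℕ} {s p : ℝ}

lemma qStar_pos (p : ℝ) : 0 < qStar p := zero_lt_one.trans_le (one_le_qStar p)

lemma ofReal_rpow_rpow_inv {a q : ℝ} (ha : 0 ≤ a) (hq : 0 < q) :
    ENNReal.ofReal (a ^ q) ^ (1 / q) = ENNReal.ofReal a := by
  rw [ENNReal.ofReal_rpow_of_nonneg (by positivity) (by positivity), one_div,
    Real.rpow_rpow_inv ha hq.ne']

lemma integrableOn_ball_of_lintegral_rpow {u : Rn n → ℝ} (hp : 1 < p) (hum : Measurable u)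
    (hu : ∫⁻ x, ENNReal.ofReal (|u x| ^ p) < ⊤) (z : Rn n) (R : ℝ) :
    IntegrableOn u (ball z R) := by
  refine ⟨hum.aestronglyMeasurable, ?_⟩
  rw [hasFiniteIntegral_iff_norm]
  have h : ∀ x, ENNReal.ofReal ‖u x‖ ≤ 1 + ENNReal.ofReal (|u x| ^ p) := fun x => by
    rw [Real.norm_eq_abs]
    rcases le_total (|u x|) 1 with h | h
    · exact (ENNReal.ofReal_le_one.2 h).trans le_self_add
    · exact (ENNReal.ofReal_le_ofReal (Real.self_le_rpow_of_one_le h hp.le)).trans le_add_self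
  refine (lintegral_mono h).trans_lt ?_
  rw [lintegral_add_left measurable_const]
  exact ENNReal.add_lt_top.2 ⟨by simp [measure_ball_lt_top], (setLIntegral_le_lintegral _ _).trans_lt hu⟩

lemma locExcess_le_of_lintegral_le {v : Rn n → ℝ} {x₀ : Rn n} {ρ M : ℝ} (hM : 0 ≤ M)
    (h : ∫⁻ x in ball x₀ ρ, ENNReal.ofReal (|v x - ballAvg n v x₀ ρ| ^ qStar p) ≤
      ENNReal.ofReal (M ^ qStar p) * volume (ball x₀ ρ)) :
    locExcess n p v x₀ ρ ≤ ENNReal.ofReal M := by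
  have hq := qStar_pos p
  rw [locExcess, ← ofReal_rpow_rpow_inv hM hq]
  refine ENNReal.rpow_le_rpow ?_ (by positivity)
  rw [mul_comm, ← div_eq_mul_inv]
  exact ENNReal.div_le_of_le_mul h

lemma locExcess_le_of_ae_abs_sub_le {v : Rn n → ℝ} {x₀ : Rn n} {ρ ω c : ℝ} (hρ : 0 < ρ)
    (hω : 0 ≤ ω) (hv : IntegrableOn v (ball x₀ ρ))
    (h : ∀ᵐ x, x ∈ ball x₀ ρ → |v x - c| ≤ ω) :
    locExcess n p v x₀ ρ ≤ ENNReal.ofReal (2 * ω) := by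
  have hq := qStar_pos p
  have h' : ∀ᵐ x ∂volume.restrict (ball x₀ ρ), v x ∈ closedBall c ω := by
    rw [ae_restrict_iff' measurableSet_ball]
    filter_upwards [h] with x hx hxb
    rw [mem_closedBall, Real.dist_eq]; exact hx hxb
  have havg : ballAvg n v x₀ ρ ∈ closedBall c ω :=
    (convex_closedBall c ω).set_average_mem isClosed_closedBall
      (measure_ball_pos volume x₀ hρ).ne' measure_ball_lt_top.ne h' hv
  refine locExcess_le_of_lintegral_le (by linarith) ?_
  rw [← setLIntegral_const]
  refine lintegral_mono_ae ?_
  filter_upwards [h'] with x hx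
  rw [mem_closedBall, Real.dist_eq] at hx havg
  refine ENNReal.ofReal_le_ofReal (Real.rpow_le_rpow (abs_nonneg _) ?_ hq.le)
  have := abs_sub_le (v x) c (ballAvg n v x₀ ρ)
  rw [abs_sub_comm c] at this
  linarith

lemma convexOn_abs_sub_rpow {q : ℝ} (hq : 1 ≤ q) (c : ℝ) :
    ConvexOn ℝ univ fun t : ℝ => |t - c| ^ q := by
  refine ⟨convex_univ, fun x _ y _ a b ha hb hab => ?_⟩
  have h1 : |a • x + b • y - c| ≤ a • |x - c| + b • |y - c| := by
    have : a • x + b • y - c = a * (x - c) + b * (y - c) := by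
      simp only [smul_eq_mul]; linear_combination c * hab
    rw [this]
    refine (abs_add_le _ _).trans ?_
    rw [abs_mul, abs_mul, abs_of_nonneg ha, abs_of_nonneg hb, smul_eq_mul, smul_eq_mul]
  exact (Real.rpow_le_rpow (abs_nonneg _) h1 (by linarith)).trans
    ((convexOn_rpow hq).2 (mem_Ici.2 (abs_nonneg _)) (mem_Ici.2 (abs_nonneg _)) ha hb hab)

lemma exists_locExcess_le_of_le_four_mul (n : ℕ) (hn : 2 ≤ n) (p : ℝ) : ∃ M : ℝ, 1 ≤ M ∧
    ∀ (v : Rn n → ℝ) (x₀ : Rn n) (c Q r ρ : ℝ), Measurable v → 0 < r → r ≤ 4 * ρ → ρ ≤ r → 0 < Q →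
      IntegrableOn v (ball x₀ ρ) →
      (∫⁻ x in ball x₀ r, ENNReal.ofReal (|v x - c| ^ qStar p) ≤
        ENNReal.ofReal (Q ^ qStar p) * volume (ball x₀ r)) →
      locExcess n p v x₀ ρ ≤ ENNReal.ofReal (M * Q) := by
  have hq := qStar_pos p
  set q := qStar p with hqdef
  set N : ℝ := 2 ^ q * (2 * 4 ^ (n : ℝ)) with hN
  have hN1 : 1 ≤ N := by
    have h1 : (1 : ℝ) ≤ 2 ^ q := Real.one_le_rpow (by norm_num) hq.le
    have h2 : (1 : ℝ) ≤ 4 ^ (n : ℝ) := Real.one_le_rpow (by norm_num) (by positivity)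
    nlinarith
  refine ⟨N ^ (1 / q), Real.one_le_rpow hN1 (by positivity), ?_⟩
  intro v x₀ c Q r ρ hvm hr hρ4 hρr hQ hv h
  have hρ : 0 < ρ := by linarith
  have hvol0 : volume (ball x₀ ρ) ≠ 0 := (measure_ball_pos volume x₀ hρ).ne'
  have hvolt : volume (ball x₀ ρ) ≠ ⊤ := measure_ball_lt_top.ne
  have hvol : volume (ball x₀ r) ≤ ENNReal.ofReal (4 ^ (n : ℝ)) * volume (ball x₀ ρ) := by
    rw [volume_ball_eq hn x₀ hr, volume_ball_eq hn x₀ hρ, ← ENNReal.ofReal_mul (by positivity)]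
    refine ENNReal.ofReal_le_ofReal ?_
    rw [← mul_assoc, ← Real.mul_rpow (by norm_num) hρ.le]
    gcongr
  have h2 : ∫⁻ x in ball x₀ ρ, ENNReal.ofReal (|v x - c| ^ q) ≤
      ENNReal.ofReal (4 ^ (n : ℝ) * Q ^ q) * volume (ball x₀ ρ) := by
    refine (lintegral_mono_set (ball_subset_ball hρr)).trans (h.trans ?_)
    rw [mul_comm (4 ^ (n : ℝ)), ENNReal.ofReal_mul (by positivity), mul_assoc]
    gcongr
  have hint : IntegrableOn (fun x => |v x - c| ^ q) (ball x₀ ρ) := by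
    refine ⟨((hvm.sub_const c).abs.pow_const q).aestronglyMeasurable, ?_⟩
    rw [hasFiniteIntegral_iff_norm]
    refine lt_of_le_of_lt ?_ (h2.trans_lt (ENNReal.mul_lt_top ENNReal.ofReal_lt_top hvolt.lt_top))
    refine lintegral_mono fun x => ?_
    rw [Real.norm_of_nonneg (by positivity)]
  have havg : |ballAvg n v x₀ ρ - c| ^ q ≤ 4 ^ (n : ℝ) * Q ^ q := by
    have hj : |ballAvg n v x₀ ρ - c| ^ q ≤ ⨍ x in ball x₀ ρ, |v x - c| ^ q :=
      (convexOn_abs_sub_rpow (one_le_qStar p) c).map_set_average_le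
        (Continuous.continuousOn (by
          exact (continuous_id.sub continuous_const).abs.rpow_const fun _ => Or.inr hq.le))
        isClosed_univ hvol0 hvolt (Eventually.of_forall fun _ => mem_univ _) hv hint
    have hj' := ENNReal.ofReal_le_ofReal hj
    rw [ofReal_setAverage hint
      (Eventually.of_forall fun x => Real.rpow_nonneg (abs_nonneg (v x - c)) q)] at hj'
    exact (ENNReal.ofReal_le_ofReal_iff (mul_nonneg (by positivity) (Real.rpow_nonneg hQ.le q))).1
      (hj'.trans (ENNReal.div_le_of_le_mul h2))
  refine locExcess_le_of_lintegral_le (mul_nonneg (by positivity) hQ.le) ?_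
  rw [← hqdef, Real.mul_rpow (by positivity) hQ.le, one_div, Real.rpow_inv_rpow (by positivity) hq.ne']
  have hpt : ∀ x, ENNReal.ofReal (|v x - ballAvg n v x₀ ρ| ^ q) ≤
      ENNReal.ofReal (2 ^ q) * ENNReal.ofReal (|v x - c| ^ q) +
        ENNReal.ofReal (2 ^ q * (4 ^ (n : ℝ) * Q ^ q)) := fun x => by
    rw [← ENNReal.ofReal_mul (by positivity), ← ENNReal.ofReal_add (by positivity) (by positivity)]
    refine ENNReal.ofReal_le_ofReal ?_
    have h3 : |v x - ballAvg n v x₀ ρ| ≤ |v x - c| + |ballAvg n v x₀ ρ - c| := by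
      rw [abs_sub_comm (ballAvg n v x₀ ρ) c]; exact abs_sub_le _ _ _
    have h4 := (Real.rpow_le_rpow (abs_nonneg _) h3 hq.le).trans
      (add_rpow_le_two_rpow_mul (abs_nonneg _) (abs_nonneg _) hq.le)
    have h5 := mul_le_mul_of_nonneg_left havg (show (0 : ℝ) ≤ 2 ^ q by positivity)
    linarith
  refine (lintegral_mono hpt).trans ?_
  rw [lintegral_add_right _ measurable_const, lintegral_const_mul _ (by fun_prop), setLIntegral_const]
  calc _ ≤ ENNReal.ofReal (2 ^ q) * (ENNReal.ofReal (4 ^ (n : ℝ) * Q ^ q) * volume (ball x₀ ρ)) +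
        ENNReal.ofReal (2 ^ q * (4 ^ (n : ℝ) * Q ^ q)) * volume (ball x₀ ρ) := by gcongr
    _ = _ := by
      rw [← mul_assoc, ← ENNReal.ofReal_mul (by positivity), ← add_mul,
        ← ENNReal.ofReal_add (by positivity) (by positivity), hN]
      congr 2; ring

lemma exists_oscBound_start (hn : 2 ≤ n) (hs : 0 < s) (hs1 : s < 1) (hp : 1 < p) {C₀ CT : ℝ}
    (hC₀ : 1 ≤ C₀) (hCT : 1 ≤ CT) : ∃ C : ℝ, 1 ≤ C ∧
    ∀ (Ω : Set (Rn n)) (u : Rn n → ℝ) (x₀ : Rn n) (c r Q : ℝ), Measurable u →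
      ∫⁻ x, ENNReal.ofReal (|u x| ^ p) < ⊤ →
      DeGiorgiClass n s p C₀ Ω u → DeGiorgiClass n s p C₀ Ω (fun x => -u x) → 0 < r →
      ball x₀ r ⊆ Ω → 0 < Q →
      ∫⁻ x in ball x₀ r, ENNReal.ofReal (|u x - c| ^ qStar p) ≤
        ENNReal.ofReal (Q ^ qStar p) * volume (ball x₀ r) →
      ∫⁻ x in (ball x₀ r)ᶜ, ENNReal.ofReal
        (|u x - c| ^ (p - 1) * ‖x - x₀‖ ^ (-((n : ℝ) + s * p))) ≤
          ENNReal.ofReal (Q ^ (p - 1) * r ^ (-(s * p))) →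
      OscBound n s p CT u x₀ c (C * Q) (r / 4) := by
  have hp1 : 0 < p - 1 := by linarith
  have hsp : 0 < s * p := mul_pos hs (by linarith)
  have hq := qStar_pos p
  set c₁ := (volume (ball (0 : Rn n) 1)).toReal with hc₁
  have hc₁0 : 0 < c₁ := unit_ball_pos n
  obtain ⟨C, hC, hloc⟩ := exists_local_bound hn hs hs1 hp hC₀ hc₁0.le
  set D : ℝ := ((c₁ + c₁) * 2 ^ ((n : ℝ) + s * p) + 1) * (1 / 2) ^ (-((n : ℝ) + s * p)) with hD
  have hD0 : 0 < D := by positivity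
  set C' := C + D ^ (1 / (p - 1)) with hC'
  have hDC : D ≤ C' ^ (p - 1) := by
    calc D = (D ^ (1 / (p - 1))) ^ (p - 1) := by
          rw [one_div, Real.rpow_inv_rpow hD0.le hp1.ne']
      _ ≤ _ := Real.rpow_le_rpow (by positivity) (by linarith) hp1.le
  have hC'C : C ≤ C' := le_add_of_nonneg_right (by positivity)
  refine ⟨C', hC.trans hC'C, ?_⟩
  intro Ω u x₀ c r Q hum hu hdg hdg' hr hball hQ h1 h2
  have h1' : ∫⁻ x in ball x₀ r, ENNReal.ofReal (|u x - c| ^ qStar p) ≤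
      ENNReal.ofReal (c₁ * Q ^ qStar p * r ^ (n : ℝ)) := by
    refine h1.trans_eq ?_
    rw [volume_ball_eq hn x₀ hr, ← ENNReal.ofReal_mul (by positivity)]
    congr 1; ring
  have hm1 : ∀ f : Rn n → ℝ, (∀ x, 0 ≤ f x) → (∀ x, f x ≤ |u x - c|) →
      ∫⁻ x in ball x₀ r, ENNReal.ofReal (f x ^ qStar p) ≤
        ENNReal.ofReal (c₁ * Q ^ qStar p * r ^ (n : ℝ)) := fun f hf0 hf =>
    (lintegral_mono fun x => ENNReal.ofReal_le_ofReal
      (Real.rpow_le_rpow (hf0 x) (hf x) hq.le)).trans h1'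
  have hm2 : ∀ f : Rn n → ℝ, (∀ x, 0 ≤ f x) → (∀ x, f x ≤ |u x - c|) →
      ∫⁻ x in (ball x₀ r)ᶜ, ENNReal.ofReal
        (f x ^ (p - 1) * ‖x - x₀‖ ^ (-((n : ℝ) + s * p))) ≤
          ENNReal.ofReal (Q ^ (p - 1) * r ^ (-(s * p))) := fun f hf0 hf =>
    (lintegral_mono fun x => ENNReal.ofReal_le_ofReal (mul_le_mul_of_nonneg_right
      (Real.rpow_le_rpow (hf0 x) (hf x) hp1.le) (by positivity))).trans h2
  have hup := hloc Ω u x₀ c r Q hum hdg hr hball hQ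
    (hm1 _ (fun x => le_max_right _ _) fun x => max_le (le_abs_self _) (abs_nonneg _))
    (hm2 _ (fun x => le_max_right _ _) fun x => max_le (le_abs_self _) (abs_nonneg _))
    (lintegral_ball_pos_part_rpow_lt_top hp hu c hum)
  have hle : ∀ x, -u x - -c ≤ |u x - c| := fun x => by linarith [neg_abs_le (u x - c)]
  have hlow := hloc Ω (fun x => -u x) x₀ (-c) r Q hum.neg hdg' hr hball hQ
    (hm1 _ (fun x => le_max_right _ _) fun x => max_le (hle x) (abs_nonneg _))
    (hm2 _ (fun x => le_max_right _ _) fun x => max_le (hle x) (abs_nonneg _))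
    (lintegral_ball_pos_part_rpow_lt_top hp (by simpa only [abs_neg] using hu) (-c) hum.neg)
  constructor
  · filter_upwards [hup, hlow] with x hx hx' hxb
    have hxb' : x ∈ ball x₀ (r / 2) := ball_subset_ball (by linarith) hxb
    have h3 := hx hxb'
    have h4 := hx' hxb'
    have h5 : C * Q ≤ C' * Q := by gcongr
    rw [abs_le]; constructor <;> linarith
  · have h6 := lintegral_tail_shift_le (w := fun x => |u x - c|) (z := x₀) (d := 1 / 2)
      (σ := 1 / 2) hn hs hp (fun x => abs_nonneg _) hr (by norm_num) (by norm_num)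
      (mem_ball_self (by positivity)) hc₁0.le hQ h1' h2
    rw [show 1 / 2 * r / 2 = r / 4 by ring] at h6
    refine h6.trans (ENNReal.ofReal_le_ofReal ?_)
    rw [← hD, Real.mul_rpow (by positivity) hQ.le]
    have h7 : r ^ (-(s * p)) ≤ (r / 4) ^ (-(s * p)) :=
      Real.rpow_le_rpow_of_nonpos (by positivity) (by linarith) (by linarith)
    have h8 : D ≤ CT * C' ^ (p - 1) := hDC.trans (le_mul_of_one_le_left (by positivity) hCT)
    calc D * Q ^ (p - 1) * r ^ (-(s * p))
        ≤ (CT * C' ^ (p - 1)) * Q ^ (p - 1) * (r / 4) ^ (-(s * p)) := by gcongr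
      _ = _ := by ring

lemma exists_excess_decay (hn : 2 ≤ n) (hs : 0 < s) (hs1 : s < 1) (hp : 1 < p) {C₀ : ℝ}
    (hC₀ : 1 ≤ C₀) : ∃ α C : ℝ, 0 < α ∧ α < s * p / qStar p ∧ 0 < C ∧
    ∀ (Ω : Set (Rn n)) (u : Rn n → ℝ) (x₀ : Rn n) (c r Q : ℝ), Measurable u →
      ∫⁻ x, ENNReal.ofReal (|u x| ^ p) < ⊤ →
      DeGiorgiClass n s p C₀ Ω u → DeGiorgiClass n s p C₀ Ω (fun x => -u x) → 0 < r →
      ball x₀ r ⊆ Ω → 0 < Q →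
      ∫⁻ x in ball x₀ r, ENNReal.ofReal (|u x - c| ^ qStar p) ≤
        ENNReal.ofReal (Q ^ qStar p) * volume (ball x₀ r) →
      ∫⁻ x in (ball x₀ r)ᶜ, ENNReal.ofReal
        (|u x - c| ^ (p - 1) * ‖x - x₀‖ ^ (-((n : ℝ) + s * p))) ≤
          ENNReal.ofReal (Q ^ (p - 1) * r ^ (-(s * p))) →
      ∀ ρ : ℝ, 0 < ρ → ρ ≤ r → locExcess n p u x₀ ρ ≤ ENNReal.ofReal (C * (ρ / r) ^ α * Q) := by
  have hsp : 0 < s * p := mul_pos hs (by linarith)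
  have hq := qStar_pos p
  obtain ⟨θ, κ, CT, hθ0, hθ4, hκ0, hκ2, hCT, hstep⟩ := exists_osc_step hn hs hs1 hp hC₀
  obtain ⟨C₁, hC₁, hstart⟩ := exists_oscBound_start hn hs hs1 hp hC₀ hCT
  obtain ⟨M, hM, hcrude⟩ := exists_locExcess_le_of_le_four_mul n hn p
  have hlθ : Real.log θ < 0 := Real.log_neg hθ0 (by linarith)
  have hlκ : Real.log (1 - κ) < 0 := Real.log_neg (by linarith) (by linarith)
  set α := min (Real.log (1 - κ) / Real.log θ) (s * p / (2 * qStar p)) with hα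
  have hα0 : 0 < α := lt_min (div_pos_of_neg_of_neg hlκ hlθ) (by positivity)
  have hα1 : α < s * p / qStar p := (min_le_right _ _).trans_lt
    (div_lt_div_of_pos_left hsp hq (by linarith))
  have hκα : 1 - κ ≤ θ ^ α := by
    rw [Real.le_rpow_iff_log_le (by linarith) hθ0]
    have h1 := mul_le_mul_of_nonpos_right
      (min_le_left (Real.log (1 - κ) / Real.log θ) (s * p / (2 * qStar p))) hlθ.le
    rwa [div_mul_cancel₀ _ hlθ.ne] at h1
  have hB : 0 < (4 / θ) ^ α := by positivity
  refine ⟨α, M * 4 ^ α + 2 * C₁ * (4 / θ) ^ α, hα0, hα1, by positivity, ?_⟩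
  intro Ω u x₀ c r Q hum hu hdg hdg' hr hball hQ h1 h2 ρ hρ hρr
  have hint := integrableOn_ball_of_lintegral_rpow hp hum hu x₀ ρ
  rcases lt_or_ge (r / 4) ρ with hρ4 | hρ4
  · refine (hcrude u x₀ c Q r ρ hum hr (by linarith) hρr hQ hint h1).trans
      (ENNReal.ofReal_le_ofReal ?_)
    have h3 : 1 ≤ (4 * (ρ / r)) ^ α := Real.one_le_rpow (by
      rw [← mul_div_assoc, le_div_iff₀ hr]; linarith) hα0.le
    rw [Real.mul_rpow (by norm_num) (by positivity)] at h3
    have h4 : 0 ≤ 2 * C₁ * (4 / θ) ^ α * (ρ / r) ^ α * Q := by positivity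
    calc M * Q ≤ M * Q * (4 ^ α * (ρ / r) ^ α) := le_mul_of_one_le_right (by positivity) h3
      _ ≤ _ := by linarith
  · have hosc : ∀ j : ℕ, ∃ c', OscBound n s p CT u x₀ c' ((1 - κ) ^ j * (C₁ * Q))
        (θ ^ j * (r / 4)) := by
      intro j
      induction j with
      | zero =>
        exact ⟨c, by simpa using hstart Ω u x₀ c r Q hum hu hdg hdg' hr hball hQ h1 h2⟩
      | succ j ih =>
        obtain ⟨c', hc'⟩ := ih
        have h5 : θ ^ j ≤ 1 := pow_le_one₀ hθ0.le (by linarith)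
        have h6 : θ ^ j * (r / 4) ≤ r := by nlinarith
        have h7 : 0 < (1 - κ) ^ j := pow_pos (by linarith) j
        obtain ⟨c'', hc''⟩ := hstep Ω u x₀ c' _ _ hum hdg hdg' (by positivity)
          ((ball_subset_ball h6).trans hball) (by positivity) hc'
        refine ⟨c'', ?_⟩
        rw [pow_succ', pow_succ', mul_assoc, mul_assoc]
        exact hc''
    obtain ⟨j, hj1, hj2⟩ := exists_nat_pow_near_of_lt_one (x := 4 * ρ / r) (y := θ)
      (by positivity) (by rw [div_le_one hr]; linarith) hθ0 (by linarith)
    obtain ⟨c', hc', -⟩ := hosc j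
    have h7 : 0 < (1 - κ) ^ j := pow_pos (by linarith) j
    rw [div_le_iff₀ hr] at hj2
    have hsub : ball x₀ ρ ⊆ ball x₀ (θ ^ j * (r / 4)) := ball_subset_ball (by linarith)
    refine (locExcess_le_of_ae_abs_sub_le hρ (by positivity) hint
      (hc'.mono fun x hx hxb => hx (hsub hxb))).trans (ENNReal.ofReal_le_ofReal ?_)
    have h8 : (1 - κ) ^ j ≤ (4 / θ) ^ α * (ρ / r) ^ α := by
      calc (1 - κ) ^ j ≤ (θ ^ α) ^ j := pow_le_pow_left₀ (by linarith) hκα j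
        _ = (θ ^ j) ^ α := by
          rw [← Real.rpow_natCast, ← Real.rpow_natCast, ← Real.rpow_mul hθ0.le,
            ← Real.rpow_mul hθ0.le, mul_comm]
        _ ≤ (4 / θ * (ρ / r)) ^ α := by
          refine Real.rpow_le_rpow (by positivity) ?_ hα0.le
          rw [pow_succ] at hj1
          rw [show 4 / θ * (ρ / r) = 4 * ρ / r / θ by field_simp, le_div_iff₀ hθ0]
          exact hj1.le
        _ = _ := Real.mul_rpow (by positivity) (by positivity)
    have h9 : 0 ≤ M * 4 ^ α * (ρ / r) ^ α * Q := by positivity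
    calc 2 * ((1 - κ) ^ j * (C₁ * Q))
        ≤ 2 * ((4 / θ) ^ α * (ρ / r) ^ α * (C₁ * Q)) := by gcongr
      _ ≤ _ := by linarith

end decay

section transfer

variable {n : ℕ} {s p : ℝ} {u v : Rn n → ℝ}

lemma nonlocalForm_congr_ae (h : u =ᵐ[volume] v) (Φ : ℝ → ℝ) (K : Rn n → Rn n → ℝ)
    (φ : Rn n → ℝ) : nonlocalForm n Φ K u φ = nonlocalForm n Φ K v φ := by
  refine integral_congr_ae (h.mono fun x hx => integral_congr_ae (h.mono fun y hy => ?_))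
  simp only [hx, hy]

lemma gagliardo_univ_congr_ae (h : u =ᵐ[volume] v) :
    gagliardo n s p univ u = gagliardo n s p univ v := by
  simp only [gagliardo, Measure.restrict_univ]
  refine lintegral_congr_ae (h.mono fun x hx => lintegral_congr_ae (h.mono fun y hy => ?_))
  simp only [hx, hy]

lemma ballAvg_congr_ae (h : u =ᵐ[volume] v) (x₀ : Rn n) (r : ℝ) :
    ballAvg n u x₀ r = ballAvg n v x₀ r :=
  average_congr (ae_restrict_of_ae h)

lemma locExcess_congr_ae (h : u =ᵐ[volume] v) (x₀ : Rn n) (r : ℝ) :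
    locExcess n p u x₀ r = locExcess n p v x₀ r := by
  rw [locExcess, locExcess, ballAvg_congr_ae h]
  congr 2
  refine lintegral_congr_ae ((ae_restrict_of_ae h).mono fun x hx => ?_)
  simp only [hx]

lemma tailFn_congr_ae (h : u =ᵐ[volume] v) (x₀ : Rn n) (r : ℝ) :
    tailFn n s p u x₀ r = tailFn n s p v x₀ r := by
  rw [tailFn, tailFn]
  congr 2
  refine lintegral_congr_ae ((ae_restrict_of_ae h).mono fun x hx => ?_)
  simp only [hx]

lemma excess_congr_ae (h : u =ᵐ[volume] v) (x₀ : Rn n) (r : ℝ) :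
    excess n s p u x₀ r = excess n s p v x₀ r := by
  rw [excess, excess, locExcess_congr_ae h, ballAvg_congr_ae h]
  congr 1
  exact tailFn_congr_ae (h.mono fun x hx => by simp only [hx]) x₀ r

lemma nonlocalForm_neg (Φ : ℝ → ℝ) (K : Rn n → Rn n → ℝ) (u φ : Rn n → ℝ) :
    nonlocalForm n (fun t => -Φ (-t)) K (fun x => -u x) φ = -nonlocalForm n Φ K u φ := by
  simp only [nonlocalForm, ← integral_neg]
  refine integral_congr_ae (Eventually.of_forall fun x => integral_congr_ae
    (Eventually.of_forall fun y => ?_))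
  simp only [show -(-u x - -u y) = u x - u y by ring]
  ring

lemma gagliardo_neg (O : Set (Rn n)) (u : Rn n → ℝ) :
    gagliardo n s p O (fun x => -u x) = gagliardo n s p O u := by
  simp only [gagliardo, show ∀ x y, |-u x - -u y| = |u x - u y| from fun x y => by
    rw [← abs_neg]; ring_nf]

lemma lintegral_le_of_locExcess_le {x₀ : Rn n} {r Q : ℝ} (hr : 0 < r) (hQ : 0 < Q)
    (h : locExcess n p u x₀ r ≤ ENNReal.ofReal Q) :
    ∫⁻ x in ball x₀ r, ENNReal.ofReal (|u x - ballAvg n u x₀ r| ^ qStar p) ≤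
      ENNReal.ofReal (Q ^ qStar p) * volume (ball x₀ r) := by
  have hq := qStar_pos p
  rw [locExcess, one_div, ENNReal.rpow_inv_le_iff hq, ENNReal.ofReal_rpow_of_pos hQ, mul_comm,
    ← div_eq_mul_inv] at h
  exact (ENNReal.div_le_iff (measure_ball_pos volume x₀ hr).ne' measure_ball_lt_top.ne).1 h

lemma lintegral_le_of_tailFn_le {x₀ : Rn n} {r Q : ℝ} (hp : 1 < p) (hr : 0 < r) (hQ : 0 < Q)
    (h : tailFn n s p u x₀ r ≤ ENNReal.ofReal Q) :
    ∫⁻ x in (ball x₀ r)ᶜ, ENNReal.ofReal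
      (|u x| ^ (p - 1) * ‖x - x₀‖ ^ (-((n : ℝ) + s * p))) ≤
        ENNReal.ofReal (Q ^ (p - 1) * r ^ (-(s * p))) := by
  have hp1 : 0 < p - 1 := by linarith
  have hrs : 0 < r ^ (s * p) := by positivity
  rw [tailFn, one_div, ENNReal.rpow_inv_le_iff hp1, ENNReal.ofReal_rpow_of_pos hQ, mul_comm,
    ← ENNReal.le_div_iff_mul_le (Or.inl (ENNReal.ofReal_pos.2 hrs).ne')
      (Or.inl ENNReal.ofReal_ne_top), ← ENNReal.ofReal_div_of_pos hrs] at h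
  simp only [Real.rpow_neg (norm_nonneg _), Real.rpow_neg hr.le, ← div_eq_mul_inv]
  exact h

end transfer

/-- Lemma 2.5, local excess decay. -/
theorem local_excess_decay
    (n : ℕ) (s p Λ : ℝ)
    (hn : 2 ≤ n) (hs : 0 < s) (hs1 : s < 1) (hp1 : 1 < p) (hΛ : 1 ≤ Λ) :
    ∃ α c : ℝ, 0 < α ∧ α < s * p / qStar p ∧ 0 < c ∧
      ∀ (Φ : ℝ → ℝ) (K : Rn n → Rn n → ℝ) (Ω : Set (Rn n)) (g v : Rn n → ℝ)
        (x₀ : Rn n) (r : ℝ),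
        KernelBounds n Λ s p K → PhiBounds Λ p Φ → IsOpen Ω →
        memWsp n s p univ g →
        WeakSol n Φ K s p Ω (fun _ => 0) g v →
        0 < r → ball x₀ (2 * r) ⊆ Ω →
        ∀ ρ : ℝ, 0 < ρ → ρ ≤ r →
          locExcess n p v x₀ ρ ≤
            ENNReal.ofReal (c * (ρ / r) ^ α) * excess n s p v x₀ r := by
  obtain ⟨C₀, hC₀, hdeGiorgi⟩ := exists_deGiorgiClass hn hs hs1 hp1 hΛ
  obtain ⟨α, C, hα, hα1, hC, hdecay⟩ := exists_excess_decay hn hs hs1 hp1 hC₀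
  refine ⟨α, C, hα, hα1, hC, ?_⟩
  intro Φ K Ω g v x₀ r hK hΦ hΩ _ hv hr hball ρ hρ hρr
  obtain ⟨⟨hvm, hvp, hvg⟩, -, hform⟩ := hv
  rw [Measure.restrict_univ] at hvm hvp
  set u := hvm.mk v
  have hum : Measurable u := hvm.measurable_mk
  have huv : v =ᵐ[volume] u := hvm.ae_eq_mk
  have hup : ∫⁻ x, ENNReal.ofReal (|u x| ^ p) < ⊤ := by
    refine (lintegral_congr_ae (huv.mono fun x hx => ?_)).trans_lt hvp
    simp only [hx]
  rw [gagliardo_univ_congr_ae huv] at hvg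
  have huform : ∀ φ, IsTestFun n Ω φ → nonlocalForm n Φ K u φ = 0 := fun φ hφ => by
    rw [← nonlocalForm_congr_ae huv, hform φ hφ]; simp
  have hdg := hdeGiorgi Φ K Ω u hK hΦ hΩ hum hup hvg huform
  have hdg' := hdeGiorgi _ K Ω (fun x => -u x) hK hΦ.reflect hΩ hum.neg
    (by simpa only [abs_neg] using hup) (by rwa [gagliardo_neg])
    fun φ hφ => by rw [nonlocalForm_neg, huform φ hφ, neg_zero]
  rw [locExcess_congr_ae huv, excess_congr_ae huv]
  have hA : 0 < C * (ρ / r) ^ α := by positivity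
  rcases eq_or_ne (excess n s p u x₀ r) ⊤ with htop | htop
  · rw [htop, ENNReal.mul_top (ENNReal.ofReal_pos.2 hA).ne']
    exact le_top
  · set E := (excess n s p u x₀ r).toReal with hE
    have hE0 : 0 ≤ E := ENNReal.toReal_nonneg
    have key : ∀ Q > E, locExcess n p u x₀ ρ ≤ ENNReal.ofReal (C * (ρ / r) ^ α * Q) := by
      intro Q hQ
      have hQ0 : 0 < Q := hE0.trans_lt hQ
      have hex : excess n s p u x₀ r ≤ ENNReal.ofReal Q := by
        rw [← ENNReal.ofReal_toReal htop]
        exact ENNReal.ofReal_le_ofReal hQ.le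
      exact hdecay Ω u x₀ (ballAvg n u x₀ r) r Q hum hup hdg hdg' hr
        ((ball_subset_ball (by linarith)).trans hball) hQ0
        (lintegral_le_of_locExcess_le hr hQ0 (le_self_add.trans hex))
        (lintegral_le_of_tailFn_le hp1 hr hQ0 (le_add_self.trans hex)) ρ hρ hρr
    have hlim : Tendsto (fun Q => ENNReal.ofReal (C * (ρ / r) ^ α * Q)) (𝓝[>] E)
        (𝓝 (ENNReal.ofReal (C * (ρ / r) ^ α * E))) :=
      (ENNReal.continuous_ofReal.comp (continuous_const.mul continuous_id)).continuousWithinAt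
    refine (ge_of_tendsto hlim (eventually_mem_nhdsWithin.mono key)).trans_eq ?_
    rw [ENNReal.ofReal_mul hA.le, hE, ENNReal.ofReal_toReal htop]
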